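/- arXiv:1101.4553 — 6 statements merged into one kernel-verified Lean document; each statement's English description precedes it below -/
import Mathlib

section
/- Let (n_k)_{k≥0} be a strictly increasing sequence of positive integers. Then (n_k)_{k≥0} is a Hilbertian Jamison sequence if and only if it is a Jamison sequence. That is: every bounded operator T on every separable complex Hilbert space satisfying sup_{k≥0} ‖T^{n_k}‖ < ∞ has an at most countable set of unimodular eigenvalues, if and only if every bounded operator T on every separable complex Banach space satisfying sup_{k≥0} ‖T^{n_k}‖ < ∞ has an at most countable set of unimodular eigenvalues. -/
open Filter Topology

/-- The Hilbert space of the construction. -/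
abbrev JamH : Type := lp (fun _ : ℕ => ℂ) 2

noncomputable def jamE (i : ℕ) : JamH := lp.single 2 i (1 : ℂ)

/-- Evaluation vectors along the binary tree. -/
noncomputable def jamK : ℕ → JamH
  | 0 => jamE 0
  | (n + 1) => jamK (n / 2) + ((1 / 2 : ℂ) ^ (n + 1)) • jamE (n + 1)
decreasing_by omega

lemma jamK_zero : jamK 0 = jamE 0 := by rw [jamK]

lemma jamK_succ (n : ℕ) :
    jamK (n + 1) = jamK (n / 2) + ((1 / 2 : ℂ) ^ (n + 1)) • jamE (n + 1) := by rw [jamK]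

lemma jamE_inner (i : ℕ) (x : JamH) : inner ℂ (jamE i) x = x i := by
  rw [jamE, lp.inner_single_left]; simp

lemma jamE_norm (i : ℕ) : ‖jamE i‖ = 1 := by
  rw [jamE, lp.norm_single (by norm_num)]; simp

lemma jamK_inner_succ (n : ℕ) (x : JamH) :
    inner ℂ (jamK (n + 1)) x = inner ℂ (jamK (n / 2)) x + (1 / 2 : ℂ) ^ (n + 1) * x (n + 1) := by
  rw [jamK_succ, inner_add_left, inner_smul_left, jamE_inner, map_pow, map_div₀, map_one,
    Complex.conj_ofNat]

lemma jamK_inner_zero (x : JamH) : inner ℂ (jamK 0) x = x 0 := by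
  rw [jamK_zero, jamE_inner]

lemma jamK_step (n : ℕ) : ‖jamK (n + 1) - jamK (n / 2)‖ = (1 / 2 : ℝ) ^ (n + 1) := by
  rw [jamK_succ, add_sub_cancel_left, norm_smul, jamE_norm]; simp

lemma jamK_norm (n : ℕ) : ‖jamK n‖ ≤ 2 - (1 / 2 : ℝ) ^ n := by
  induction n using Nat.strong_induction_on with
  | _ n ih =>
    match n with
    | 0 => rw [jamK_zero, jamE_norm]; norm_num
    | n + 1 =>
      have h1 := ih (n / 2) (by omega)
      have h2 : ‖jamK (n + 1)‖ ≤ ‖jamK (n / 2)‖ + (1 / 2 : ℝ) ^ (n + 1) := by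
        rw [← jamK_step]
        calc ‖jamK (n + 1)‖ = ‖jamK (n / 2) + (jamK (n + 1) - jamK (n / 2))‖ := by
              congr 1; abel
          _ ≤ _ := norm_add_le _ _
      have h3 : (1 / 2 : ℝ) ^ n ≤ (1 / 2 : ℝ) ^ (n / 2) :=
        pow_le_pow_of_le_one (by norm_num) (by norm_num) (by omega)
      rw [pow_succ] at h2 ⊢
      linarith

lemma jamK_coord_zero (n : ℕ) : (jamK n) 0 = 1 := by
  induction n using Nat.strong_induction_on with
  | _ n ih =>
    match n with
    | 0 => rw [jamK_zero, jamE]; simp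
    | n + 1 =>
      rw [jamK_succ, lp.coeFn_add, Pi.add_apply, ih (n / 2) (by omega), lp.coeFn_smul,
        Pi.smul_apply, jamE]
      simp

lemma jamK_ext {x y : JamH} (h : ∀ n, inner ℂ (jamK n) x = inner ℂ (jamK n) y) : x = y := by
  ext n
  match n with
  | 0 => simpa [jamK_inner_zero] using h 0
  | n + 1 =>
    have := h (n + 1)
    rw [jamK_inner_succ, jamK_inner_succ, h (n / 2)] at this
    have h2 : ((1 / 2 : ℂ) ^ (n + 1)) ≠ 0 := pow_ne_zero _ (by norm_num)
    exact mul_left_cancel₀ h2 (add_left_cancel this)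

/-- Multiplication by `g`, in coordinates. -/
noncomputable def jamFun (g : ℕ → ℂ) (x : JamH) : ℕ → ℂ
  | 0 => g 0 * x 0
  | (n + 1) => g (n + 1) * x (n + 1) + 2 ^ (n + 1) * (g (n + 1) - g (n / 2)) * inner ℂ (jamK (n / 2)) x

lemma jamFun_bound (g : ℕ → ℂ) (hg : ∀ i, ‖g i‖ = 1)
    (hd : ∀ i, ‖g (i + 1) - g (i / 2)‖ ≤ (1 / 4 : ℝ) ^ (i + 1)) (x : JamH) (i : ℕ) :
    ‖jamFun g x i‖ ^ 2 ≤ 2 * ‖x i‖ ^ 2 + 8 * ‖x‖ ^ 2 * (1 / 4 : ℝ) ^ i := by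
  match i with
  | 0 =>
    simp only [jamFun, norm_mul, hg, one_mul]
    nlinarith [sq_nonneg ‖x 0‖, sq_nonneg ‖x‖]
  | i + 1 =>
    have h1 : ‖jamFun g x (i + 1)‖ ≤ ‖x (i + 1)‖ + (1 / 2 : ℝ) ^ (i + 1) * (2 * ‖x‖) := by
      refine (norm_add_le _ _).trans ?_
      rw [norm_mul, hg, one_mul]
      gcongr
      rw [norm_mul]
      gcongr
      · rw [norm_mul, norm_pow]
        calc ‖(2 : ℂ)‖ ^ (i + 1) * ‖g (i + 1) - g (i / 2)‖
            ≤ 2 ^ (i + 1) * (1 / 4 : ℝ) ^ (i + 1) := by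
              rw [Complex.norm_ofNat]; gcongr; exact hd i
          _ = _ := by rw [← mul_pow]; norm_num
      · refine (norm_inner_le_norm _ _).trans ?_
        gcongr
        have := jamK_norm (i / 2)
        have : (0 : ℝ) ≤ (1 / 2 : ℝ) ^ (i / 2) := by positivity
        linarith
    have h2 : (1 / 4 : ℝ) ^ (i + 1) = ((1 / 2 : ℝ) ^ (i + 1)) ^ 2 := by
      rw [← pow_mul, mul_comm, pow_mul]; norm_num
    rw [h2]
    have h3 := pow_le_pow_left₀ (norm_nonneg _) h1 2
    nlinarith [sq_nonneg (‖x (i + 1)‖ - (1 / 2 : ℝ) ^ (i + 1) * (2 * ‖x‖))]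

lemma jamFun_sum (g : ℕ → ℂ) (hg : ∀ i, ‖g i‖ = 1)
    (hd : ∀ i, ‖g (i + 1) - g (i / 2)‖ ≤ (1 / 4 : ℝ) ^ (i + 1)) (x : JamH) (s : Finset ℕ) :
    ∑ i ∈ s, ‖jamFun g x i‖ ^ (2 : ENNReal).toReal ≤ (4 * ‖x‖) ^ (2 : ENNReal).toReal := by
  have e : (2 : ENNReal).toReal = ((2 : ℕ) : ℝ) := by norm_num
  have h1 : ∑ i ∈ s, ‖x i‖ ^ 2 ≤ ‖x‖ ^ 2 := by
    have := lp.sum_rpow_le_norm_rpow (p := 2) (by norm_num) x s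
    simp only [e, Real.rpow_natCast] at this
    exact this
  have h2 : ∑ i ∈ s, (1 / 4 : ℝ) ^ i ≤ 4 / 3 := by
    have hs : Summable (fun i : ℕ => (1 / 4 : ℝ) ^ i) :=
      summable_geometric_of_lt_one (by norm_num) (by norm_num)
    refine (hs.sum_le_tsum s (fun i _ => by positivity)).trans ?_
    rw [tsum_geometric_of_lt_one (by norm_num) (by norm_num)]; norm_num
  simp only [e, Real.rpow_natCast]
  calc ∑ i ∈ s, ‖jamFun g x i‖ ^ 2
      ≤ ∑ i ∈ s, (2 * ‖x i‖ ^ 2 + 8 * ‖x‖ ^ 2 * (1 / 4 : ℝ) ^ i) :=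
        Finset.sum_le_sum fun i _ => jamFun_bound g hg hd x i
    _ = 2 * ∑ i ∈ s, ‖x i‖ ^ 2 + 8 * ‖x‖ ^ 2 * ∑ i ∈ s, (1 / 4 : ℝ) ^ i := by
        rw [Finset.sum_add_distrib, Finset.mul_sum, Finset.mul_sum]
    _ ≤ 2 * ‖x‖ ^ 2 + 8 * ‖x‖ ^ 2 * (4 / 3) := by gcongr
    _ ≤ _ := by nlinarith [sq_nonneg ‖x‖]

lemma jam_exists_mul (g : ℕ → ℂ) (hg : ∀ i, ‖g i‖ = 1)
    (hd : ∀ i, ‖g (i + 1) - g (i / 2)‖ ≤ (1 / 4 : ℝ) ^ (i + 1)) :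
    ∃ M : JamH →L[ℂ] JamH, ‖M‖ ≤ 4 ∧
      ∀ x n, inner ℂ (jamK n) (M x) = g n * inner ℂ (jamK n) x := by
  let L : JamH →ₗ[ℂ] JamH :=
    { toFun := fun x => ⟨jamFun g x, memℓp_gen' (jamFun_sum g hg hd x)⟩
      map_add' := by
        intro x y
        ext i
        change jamFun g (x + y) i = jamFun g x i + jamFun g y i
        cases i with
        | zero => simp only [jamFun, lp.coeFn_add, Pi.add_apply]; ring
        | succ i => simp only [jamFun, inner_add_right, lp.coeFn_add, Pi.add_apply]; ring
      map_smul' := by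
        intro c x
        ext i
        change jamFun g (c • x) i = c * jamFun g x i
        cases i with
        | zero => simp only [jamFun, lp.coeFn_smul, Pi.smul_apply, smul_eq_mul]; ring
        | succ i =>
          simp only [jamFun, inner_smul_right, lp.coeFn_smul, Pi.smul_apply, smul_eq_mul]; ring }
  have hL : ∀ x, ‖L x‖ ≤ 4 * ‖x‖ := fun x =>
    lp.norm_le_of_forall_sum_le (by norm_num) (by positivity) (jamFun_sum g hg hd x)
  refine ⟨L.mkContinuous 4 hL, L.mkContinuous_norm_le (by norm_num) hL, ?_⟩
  intro x n
  rw [LinearMap.mkContinuous_apply]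
  induction n using Nat.strong_induction_on with
  | _ n ih =>
    match n with
    | 0 => rw [jamK_inner_zero, jamK_inner_zero]; rfl
    | n + 1 =>
      rw [jamK_inner_succ, jamK_inner_succ, ih (n / 2) (by omega)]
      have : (L x) (n + 1) = g (n + 1) * x (n + 1)
        + 2 ^ (n + 1) * (g (n + 1) - g (n / 2)) * inner ℂ (jamK (n / 2)) x := rfl
      rw [this]
      have h2 : (1 / 2 : ℂ) ^ (n + 1) * 2 ^ (n + 1) = 1 := by
        rw [← mul_pow]; norm_num
      linear_combination (g (n + 1) - g (n / 2)) * inner ℂ (jamK (n / 2)) x * h2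

lemma jam_exists_op (A : Set ℕ) (h1 : 1 ∈ A) (l : ℕ → ℂ) (hl : ∀ i, ‖l i‖ = 1)
    (hd : ∀ m ∈ A, ∀ i, ‖l (i + 1) ^ m - l (i / 2) ^ m‖ ≤ (1 / 4 : ℝ) ^ (i + 1)) :
    ∃ T : JamH →L[ℂ] JamH, (∀ m ∈ A, ‖T ^ m‖ ≤ 4) ∧
      ∀ n, T (jamK n) = (starRingEnd ℂ (l n)) • jamK n := by
  obtain ⟨M, -, hM⟩ := jam_exists_mul l hl (by simpa using hd 1 h1)
  have hp : ∀ (m : ℕ) x n, inner ℂ (jamK n) ((M ^ m) x) = l n ^ m * inner ℂ (jamK n) x := by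
    intro m
    induction m with
    | zero => simp
    | succ m ih =>
      intro x n
      rw [pow_succ, mul_apply_eq_comp, ih, hM]; ring
  refine ⟨star M, ?_, ?_⟩
  · intro m hm
    obtain ⟨N, hN, hN'⟩ := jam_exists_mul (fun i => l i ^ m) (by simp [hl]) (hd m hm)
    have : M ^ m = N := by
      ext1 x
      exact jamK_ext fun n => by rw [hp, hN']
    rw [← star_pow, this, ContinuousLinearMap.star_eq_adjoint]
    exact (LinearIsometryEquiv.norm_map ContinuousLinearMap.adjoint N).trans_le hN
  · intro n
    refine ext_inner_right ℂ fun x => ?_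
    rw [ContinuousLinearMap.star_eq_adjoint, ContinuousLinearMap.adjoint_inner_left, hM,
      inner_smul_left]
    simp

/-- The branch through the tree coded by `c`. -/
def jamB (c : ℕ → Bool) : ℕ → ℕ
  | 0 => 0
  | (i + 1) => 2 * jamB c i + (if c i then 1 else 0) + 1

lemma jamB_parent (c : ℕ → Bool) (i : ℕ) :
    (2 * jamB c i + (if c i then 1 else 0)) / 2 = jamB c i := by
  split_ifs <;> omega

lemma jamB_ge (c : ℕ → Bool) (i : ℕ) : i ≤ jamB c i := by
  induction i with
  | zero => exact Nat.zero_le _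
  | succ i ih => simp only [jamB]; omega

lemma jam_branch (A : Set ℕ) (h1 : 1 ∈ A) (l : ℕ → ℂ) (hl : ∀ i, ‖l i‖ = 1)
    (hd : ∀ m ∈ A, ∀ i, ‖l (i + 1) ^ m - l (i / 2) ^ m‖ ≤ (1 / 4 : ℝ) ^ (i + 1))
    (T : JamH →L[ℂ] JamH)
    (hT : ∀ n, T (jamK n) = (starRingEnd ℂ (l n)) • jamK n) (c : ℕ → Bool) :
    ∃ z : ℂ, ‖z‖ = 1 ∧ Tendsto (fun i => l (jamB c i)) atTop (𝓝 z) ∧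
      Module.End.HasEigenvalue (T : JamH →ₗ[ℂ] JamH) (starRingEnd ℂ z) := by
  have hc1 : CauchySeq (fun i => l (jamB c i)) := by
    refine cauchySeq_of_le_geometric (1 / 2) 1 (by norm_num) fun i => ?_
    rw [dist_comm, dist_eq_norm]
    have := hd 1 h1 (2 * jamB c i + (if c i then 1 else 0))
    rw [jamB_parent, pow_one, pow_one] at this
    refine this.trans ?_
    rw [one_mul]
    calc (1 / 4 : ℝ) ^ (jamB c (i + 1)) ≤ (1 / 4 : ℝ) ^ i :=
          pow_le_pow_of_le_one (by norm_num) (by norm_num)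
            ((Nat.le_succ i).trans (jamB_ge c (i + 1)))
      _ ≤ _ := pow_le_pow_left₀ (by norm_num) (by norm_num) i
  have hc2 : CauchySeq (fun i => jamK (jamB c i)) := by
    refine cauchySeq_of_le_geometric (1 / 2) 1 (by norm_num) fun i => ?_
    rw [dist_comm, dist_eq_norm]
    have := jamK_step (2 * jamB c i + (if c i then 1 else 0))
    rw [jamB_parent] at this
    refine this.le.trans ?_
    rw [one_mul]
    exact pow_le_pow_of_le_one (by norm_num) (by norm_num)
            ((Nat.le_succ i).trans (jamB_ge c (i + 1)))
  obtain ⟨z, hz⟩ := cauchySeq_tendsto_of_complete hc1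
  obtain ⟨v, hv⟩ := cauchySeq_tendsto_of_complete hc2
  refine ⟨z, ?_, hz, ?_⟩
  · refine tendsto_nhds_unique hz.norm ?_
    simp [hl]
  · have hTv : T v = (starRingEnd ℂ z) • v := by
      refine tendsto_nhds_unique ((T.continuous.tendsto v).comp hv) ?_
      have : (T ∘ fun i => jamK (jamB c i)) =
          fun i => (starRingEnd ℂ (l (jamB c i))) • jamK (jamB c i) := by
        funext i; exact hT _
      rw [this]
      exact ((Complex.continuous_conj.tendsto z).comp hz).smul hv
    have hv0 : v ≠ 0 := by
      rintro rfl
      have h : Tendsto (fun i => inner ℂ (jamE 0) (jamK (jamB c i))) atTop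
          (𝓝 (inner ℂ (jamE 0) (0 : JamH))) := tendsto_const_nhds.inner hv
      simp only [jamE_inner, jamK_coord_zero] at h
      have := tendsto_nhds_unique h tendsto_const_nhds
      simp at this
    exact Module.End.hasEigenvalue_of_hasEigenvector (x := v)
      ⟨Module.End.mem_eigenspace_iff.2 hTv, hv0⟩

lemma jam_move (l : ℕ → ℂ) (d : ℕ → ℝ) (hd0 : ∀ i, 0 < d i)
    (hd : ∀ i, d (i + 1) ≤ d i / 8)
    (h1 : ∀ i, l (2 * i + 1) = l i) (h2 : ∀ i, ‖l (2 * i + 2) - l i‖ = d i)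
    (c : ℕ → Bool) (t i : ℕ) :
    ‖l (jamB c (i + t)) - l (jamB c i)‖ ≤ 2 * d (jamB c i) := by
  have anti : Antitone d := antitone_nat_of_succ_le fun i => by linarith [hd i, hd0 i]
  induction t generalizing i with
  | zero => simp [(hd0 _).le]
  | succ t ih =>
    have a := ih (i + 1)
    have b : ‖l (jamB c (i + 1)) - l (jamB c i)‖ ≤ d (jamB c i) := by
      simp only [jamB]
      split_ifs
      · exact (h2 _).le
      · rw [add_zero, h1]; simp [(hd0 _).le]
    have e : d (jamB c (i + 1)) ≤ d (jamB c i) / 8 :=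
      (anti (by simp only [jamB]; omega)).trans (hd _)
    rw [show i + (t + 1) = i + 1 + t by ring]
    have := norm_sub_le_norm_sub_add_norm_sub (l (jamB c (i + 1 + t))) (l (jamB c (i + 1)))
      (l (jamB c i))
    have := hd0 (jamB c i)
    linarith

lemma jam_inj_aux (l : ℕ → ℂ) (d : ℕ → ℝ) (hd0 : ∀ i, 0 < d i)
    (hd : ∀ i, d (i + 1) ≤ d i / 8)
    (h1 : ∀ i, l (2 * i + 1) = l i) (h2 : ∀ i, ‖l (2 * i + 2) - l i‖ = d i)
    (c c' : ℕ → Bool) (z : ℂ) (hz : Tendsto (fun i => l (jamB c i)) atTop (𝓝 z))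
    (hz' : Tendsto (fun i => l (jamB c' i)) atTop (𝓝 z)) (i : ℕ) (hi : jamB c i = jamB c' i)
    (hc : c i = true) (hc' : c' i = false) : False := by
  have anti : Antitone d := antitone_nat_of_succ_le fun i => by linarith [hd i, hd0 i]
  have key : ∀ c : ℕ → Bool, Tendsto (fun i => l (jamB c i)) atTop (𝓝 z) →
      ‖z - l (jamB c (i + 1))‖ ≤ d (jamB c i) / 4 := by
    intro c hz
    have a : Tendsto (fun t => ‖l (jamB c (t + (i + 1))) - l (jamB c (i + 1))‖) atTop
        (𝓝 ‖z - l (jamB c (i + 1))‖) :=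
      (((tendsto_add_atTop_iff_nat (f := fun i => l (jamB c i)) (i + 1)).2 hz).sub_const _).norm
    refine le_of_tendsto' a fun t => ?_
    have e : d (jamB c (i + 1)) ≤ d (jamB c i) / 8 :=
      (anti (by simp only [jamB]; omega)).trans (hd _)
    have := jam_move l d hd0 hd h1 h2 c t (i + 1)
    rw [add_comm t]
    linarith
  have k1 := key c hz
  have k2 := key c' hz'
  have e1 : jamB c (i + 1) = 2 * jamB c i + 2 := by simp [jamB, hc]
  have e2 : jamB c' (i + 1) = 2 * jamB c i + 1 := by simp [jamB, hc', hi]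
  rw [e1] at k1
  rw [e2, h1, ← hi] at k2
  have := h2 (jamB c i)
  have t := norm_sub_le_norm_sub_add_norm_sub (l (2 * jamB c i + 2)) z (l (jamB c i))
  rw [norm_sub_rev _ z] at t
  linarith [hd0 (jamB c i)]

lemma jam_inj (l : ℕ → ℂ) (d : ℕ → ℝ) (hd0 : ∀ i, 0 < d i)
    (hd : ∀ i, d (i + 1) ≤ d i / 8)
    (h1 : ∀ i, l (2 * i + 1) = l i) (h2 : ∀ i, ‖l (2 * i + 2) - l i‖ = d i)
    (c c' : ℕ → Bool) (z : ℂ) (hz : Tendsto (fun i => l (jamB c i)) atTop (𝓝 z))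
    (hz' : Tendsto (fun i => l (jamB c' i)) atTop (𝓝 z)) : c = c' := by
  by_contra hne
  have hex : ∃ i, c i ≠ c' i := Function.ne_iff.1 hne
  classical
  have hi := Nat.find_spec hex
  have hlt : ∀ j < Nat.find hex, c j = c' j := fun j hj => not_not.1 (Nat.find_min hex hj)
  generalize Nat.find hex = i at hi hlt
  have hb : ∀ j ≤ i, jamB c j = jamB c' j := by
    intro j
    induction j with
    | zero => simp [jamB]
    | succ j ih => intro hj; simp only [jamB]; rw [ih (by omega), hlt j (by omega)]
  have hb := hb i le_rfl
  cases h : c i <;> cases h' : c' i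
  · simp [h, h'] at hi
  · exact jam_inj_aux l d hd0 hd h1 h2 c' c z hz' hz i hb.symm h' h
  · exact jam_inj_aux l d hd0 hd h1 h2 c c' z hz hz' i hb h h'
  · simp [h, h'] at hi

/-- State of the tree construction. -/
noncomputable def jamS {α : Type} (v : α → ℂ) (a : α) (next : α → ℝ → α) : ℕ → α × ℝ
  | 0 => (a, (1 / 4 : ℝ) ^ 2)
  | (n + 1) =>
    (if n % 2 = 0 then (jamS v a next (n / 2)).1
      else next (jamS v a next (n / 2)).1 (jamS v a next (n / 2)).2,
      min ((1 / 4 : ℝ) ^ (2 * n + 4))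
        (‖v (next (jamS v a next n).1 (jamS v a next n).2) - v (jamS v a next n).1‖ / 8))
decreasing_by all_goals omega

lemma jam_tree (A : Set ℕ) (h1 : 1 ∈ A) (S : Set ℂ) (hS : S.Nonempty)
    (hn : ∀ z ∈ S, ∀ ε > 0, ∃ w ∈ S, w ≠ z ∧ ∀ m ∈ A, ‖w ^ m - z ^ m‖ ≤ ε) :
    ∃ (l : ℕ → ℂ) (d : ℕ → ℝ), (∀ i, l i ∈ S) ∧ (∀ i, 0 < d i) ∧ (∀ i, d (i + 1) ≤ d i / 8) ∧
      (∀ i, l (2 * i + 1) = l i) ∧ (∀ i, ‖l (2 * i + 2) - l i‖ = d i) ∧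
      (∀ m ∈ A, ∀ i, ‖l (i + 1) ^ m - l (i / 2) ^ m‖ ≤ (1 / 4 : ℝ) ^ (i + 1)) := by
  have hn' : ∀ (z : S) (ε : ℝ), ∃ w : S, 0 < ε →
      (w : ℂ) ≠ z ∧ ∀ m ∈ A, ‖(w : ℂ) ^ m - (z : ℂ) ^ m‖ ≤ ε := by
    intro z ε
    by_cases h : 0 < ε
    · obtain ⟨w, hw, h'⟩ := hn z z.2 ε h
      exact ⟨⟨w, hw⟩, fun _ => h'⟩
    · exact ⟨z, fun h' => absurd h' h⟩
  choose next hnext using hn'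
  obtain ⟨a, ha⟩ := hS
  let s := jamS (fun x : S => (x : ℂ)) ⟨a, ha⟩ next
  have s0 : s 0 = (⟨a, ha⟩, (1 / 4 : ℝ) ^ 2) := by simp only [s]; rw [jamS]
  have ss : ∀ n, s (n + 1) = (if n % 2 = 0 then (s (n / 2)).1
      else next (s (n / 2)).1 (s (n / 2)).2,
      min ((1 / 4 : ℝ) ^ (2 * n + 4))
        (‖(next (s n).1 (s n).2 : ℂ) - ((s n).1 : ℂ)‖ / 8)) := by
    intro n; simp only [s]; rw [jamS]
  clear_value s
  have hpos : ∀ n, 0 < (s n).2 := by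
    intro n
    induction n with
    | zero => rw [s0]; positivity
    | succ n ih =>
      rw [ss]
      have := sub_ne_zero.2 (hnext (s n).1 (s n).2 ih).1
      exact lt_min (by positivity) (by positivity)
  have hle : ∀ n, (s n).2 ≤ (1 / 4 : ℝ) ^ (2 * n + 2) := by
    intro n
    cases n with
    | zero => rw [s0]
    | succ n => rw [ss]; exact min_le_left _ _
  have hodd : ∀ i, (s (2 * i + 1)).1 = (s i).1 := by
    intro i
    rw [ss]
    simp
  have heven : ∀ i, (s (2 * i + 2)).1 = next (s i).1 (s i).2 := by
    intro i
    rw [show 2 * i + 2 = (2 * i + 1) + 1 by ring, ss, show (2 * i + 1) / 2 = i by omega,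
      if_neg (by omega)]
  refine ⟨fun i => (s i).1, fun i => ‖(next (s i).1 (s i).2 : ℂ) - ((s i).1 : ℂ)‖,
    fun i => (s i).1.2, ?_, ?_, ?_, ?_, ?_⟩
  · intro i
    exact norm_pos_iff.2 (sub_ne_zero.2 (hnext _ _ (hpos i)).1)
  · intro i
    have a := (hnext (s (i + 1)).1 (s (i + 1)).2 (hpos _)).2 1 h1
    rw [pow_one, pow_one] at a
    refine a.trans ?_
    rw [ss]
    exact min_le_right _ _
  · intro i; simp only [hodd]
  · intro i; simp only [heven]
  · intro m hm i
    rcases Nat.even_or_odd' i with ⟨p, rfl | rfl⟩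
    · simp only [hodd]
      rw [show 2 * p / 2 = p by omega]
      simp
    · rw [show (2 * p + 1) / 2 = p by omega, show 2 * p + 1 + 1 = 2 * p + 2 by ring]
      simp only [heven]
      exact ((hnext _ _ (hpos p)).2 m hm).trans (hle p)

lemma jam_perfect {X : Type} [NormedAddCommGroup X] [NormedSpace ℂ X]
    [TopologicalSpace.SeparableSpace X] (A : Set ℕ) (T : X →L[ℂ] X) (C : ℝ)
    (hC : ∀ m ∈ A, ‖T ^ m‖ ≤ C) (h1 : 1 ∈ A)
    (hK : ¬ {z : ℂ | ‖z‖ = 1 ∧ Module.End.HasEigenvalue (T : X →ₗ[ℂ] X) z}.Countable) :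
    ∃ S : Set ℂ, S.Nonempty ∧ (∀ z ∈ S, ‖z‖ = 1) ∧
      ∀ z ∈ S, ∀ ε > 0, ∃ w ∈ S, w ≠ z ∧ ∀ m ∈ A, ‖w ^ m - z ^ m‖ ≤ ε := by
  set K := {z : ℂ | ‖z‖ = 1 ∧ Module.End.HasEigenvalue (T : X →ₗ[ℂ] X) z} with hKdef
  have hC0 : 0 ≤ C := (norm_nonneg _).trans (hC 1 h1)
  have : ∀ z : ℂ, ∃ e : X, z ∈ K → ‖e‖ = 1 ∧ T e = z • e := by
    intro z
    by_cases h : z ∈ K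
    · obtain ⟨v, hv, hv0⟩ := h.2.exists_hasEigenvector
      have hv : T v = z • v := Module.End.mem_eigenspace_iff.1 hv
      refine ⟨((‖v‖⁻¹ : ℝ) : ℂ) • v, fun _ => ⟨?_, ?_⟩⟩
      · rw [norm_smul, Complex.norm_real, norm_inv, norm_norm]
        exact inv_mul_cancel₀ (norm_ne_zero_iff.2 hv0)
      · rw [map_smul, hv, smul_comm]
    · exact ⟨0, fun h' => absurd h' h⟩
  choose e he using this
  have hpow : ∀ z ∈ K, ∀ m : ℕ, (T ^ m) (e z) = z ^ m • e z := by
    intro z hz m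
    induction m with
    | zero => simp
    | succ m ih => rw [pow_succ, mul_apply_eq_comp, (he z hz).2, map_smul, ih, smul_smul,
        pow_succ, mul_comm]
  have hest : ∀ z ∈ K, ∀ w ∈ K, ∀ m ∈ A, ‖w ^ m - z ^ m‖ ≤ (C + 1) * ‖e w - e z‖ := by
    intro z hz w hw m hm
    have h : (w ^ m - z ^ m) • e w = (T ^ m) (e w - e z) - z ^ m • (e w - e z) := by
      rw [map_sub, hpow z hz, hpow w hw]; module
    calc ‖w ^ m - z ^ m‖ = ‖(w ^ m - z ^ m) • e w‖ := by rw [norm_smul, (he w hw).1, mul_one]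
      _ = _ := by rw [h]
      _ ≤ ‖(T ^ m) (e w - e z)‖ + ‖z ^ m • (e w - e z)‖ := norm_sub_le _ _
      _ ≤ C * ‖e w - e z‖ + 1 * ‖e w - e z‖ := by
          refine add_le_add (((T ^ m).le_opNorm _).trans ?_) ?_
          · gcongr; exact hC m hm
          · rw [norm_smul, norm_pow, hz.1, one_pow]
      _ = _ := by ring
  have : SecondCountableTopology X := UniformSpace.secondCountable_of_separable X
  let b := TopologicalSpace.countableBasis X
  let N : Set ℂ := ⋃ U ∈ {U ∈ b | {w ∈ K | e w ∈ U}.Countable}, {w ∈ K | e w ∈ U}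
  have hN : N.Countable := by
    refine Set.Countable.biUnion ?_ fun U hU => hU.2
    exact (TopologicalSpace.countable_countableBasis X).mono fun U hU => hU.1
  refine ⟨K \ N, ?_, fun z hz => hz.1.1, ?_⟩
  · by_contra h
    rw [Set.not_nonempty_iff_eq_empty, Set.sdiff_eq_empty] at h
    exact hK (hN.mono h)
  · intro z hz ε hε
    have hC1 : 0 < C + 1 := by linarith
    obtain ⟨U, hU, hzU, hUs⟩ := (TopologicalSpace.isBasis_countableBasis X).exists_subset_of_mem_open
      (Metric.mem_ball_self (x := e z) (div_pos hε hC1)) Metric.isOpen_ball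
    have hunc : ¬ {w ∈ K | e w ∈ U}.Countable := by
      intro hc
      refine hz.2 ?_
      exact Set.mem_biUnion (x := U) ⟨hU, hc⟩ ⟨hz.1, hzU⟩
    have : ∃ w ∈ {w ∈ K | e w ∈ U}, w ∉ N ∪ {z} := by
      by_contra! h
      exact hunc ((hN.union (Set.countable_singleton z)).mono h)
    obtain ⟨w, ⟨hwK, hwU⟩, hw⟩ := this
    rw [Set.mem_union, not_or] at hw
    refine ⟨w, ⟨hwK, hw.1⟩, hw.2, fun m hm => ?_⟩
    refine (hest z hz.1 w hwK m hm).trans ?_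
    have := hUs hwU
    rw [Metric.mem_ball, dist_eq_norm, lt_div_iff₀ hC1] at this
    linarith

instance jamH_separable : TopologicalSpace.SeparableSpace JamH := by
  let b : HilbertBasis ℕ ℂ JamH := HilbertBasis.ofRepr (LinearIsometryEquiv.refl ℂ _)
  have h := ((Set.countable_range b).isSeparable.span (R := ℂ)).closure
  rw [← Submodule.topologicalClosure_coe, b.dense_span, Submodule.top_coe] at h
  exact TopologicalSpace.isSeparable_univ_iff.1 h

/-- A strictly increasing sequence of positive integers is a Hilbertian Jamison sequence
if and only if it is a Jamison sequence. -/
theorem hilbertianJamison_iff_jamison (n : ℕ → ℕ) (hmono : StrictMono n)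
    (hpos : ∀ k, 0 < n k) :
    (∀ (H : Type) (_ : NormedAddCommGroup H) (_ : InnerProductSpace ℂ H)
        (_ : CompleteSpace H) (_ : TopologicalSpace.SeparableSpace H)
        (T : H →L[ℂ] H), (∃ C : ℝ, ∀ k, ‖T ^ (n k)‖ ≤ C) →
        {z : ℂ | ‖z‖ = 1 ∧ Module.End.HasEigenvalue (T : H →ₗ[ℂ] H) z}.Countable)
    ↔
    (∀ (X : Type) (_ : NormedAddCommGroup X) (_ : NormedSpace ℂ X)
        (_ : CompleteSpace X) (_ : TopologicalSpace.SeparableSpace X)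
        (T : X →L[ℂ] X), (∃ C : ℝ, ∀ k, ‖T ^ (n k)‖ ≤ C) →
        {z : ℂ | ‖z‖ = 1 ∧ Module.End.HasEigenvalue (T : X →ₗ[ℂ] X) z}.Countable) := by
  constructor
  · intro hH X _ _ _ _ T hT
    by_contra hK
    obtain ⟨C, hC⟩ := hT
    let A : Set ℕ := insert 1 (Set.range n)
    have h1 : 1 ∈ A := Set.mem_insert _ _
    have hA : ∀ m ∈ A, ‖T ^ m‖ ≤ max ‖T‖ C := by
      rintro m (rfl | ⟨k, rfl⟩)
      · rw [pow_one]; exact le_max_left _ _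
      · exact (hC k).trans (le_max_right _ _)
    obtain ⟨S, hS, hS1, hSp⟩ := jam_perfect A T _ hA h1 hK
    obtain ⟨l, d, hl, hd0, hd, ho, hev, hlA⟩ := jam_tree A h1 S hS hSp
    have hl1 : ∀ i, ‖l i‖ = 1 := fun i => hS1 _ (hl i)
    obtain ⟨R, hR, hRK⟩ := jam_exists_op A h1 l hl1 hlA
    have hcount := hH JamH inferInstance inferInstance inferInstance inferInstance R
      ⟨4, fun k => hR _ (Set.mem_insert_of_mem _ ⟨k, rfl⟩)⟩
    choose z hz1 hz hze using jam_branch A h1 l hl1 hlA R hRK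
    have hinj : Function.Injective fun c => starRingEnd ℂ (z c) := by
      intro c c' h
      have h : z c = z c' := (starRingEnd ℂ).injective h
      exact jam_inj l d hd0 hd ho hev c c' (z c) (hz c) (h ▸ hz c')
    have hr : (Set.range fun c => starRingEnd ℂ (z c)).Countable := by
      refine hcount.mono ?_
      rintro _ ⟨c, rfl⟩
      exact ⟨by simp [hz1], hze c⟩
    have : Countable (ℕ → Bool) := by
      have := hr.to_subtype
      exact (Set.rangeFactorization_injective.2 hinj).countable
    obtain ⟨f, hf⟩ := exists_injective_nat (ℕ → Bool)
    exact Function.cantor_injective (fun s : Set ℕ => by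
      classical exact f (fun i => decide (i ∈ s))) (fun s t h => by
        ext i
        simpa using congrFun (hf h) i)
  · intro hX H _ _ _ _ T hT
    exact hX H inferInstance inferInstance inferInstance inferInstance T hT
end

section
/- Let (n_k)_{k≥0} be a strictly increasing sequence of positive integers with n_0 = 1 such that for every ε > 0 there exists λ ∈ 𝕋 \ {1} with sup_{k≥0} |λ^{n_k} − 1| ≤ ε. Then for every δ > 0 there exists a bounded linear operator T on the Hilbert space ℓ²(ℕ, ℂ) such that T has perfectly spanning unimodular eigenvectors and sup_{k≥0} ‖T^{n_k}‖ ≤ 1 + δ. In particular the set of unimodular eigenvalues of T is uncountable. -/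
open MeasureTheory Filter Topology

/-- A bounded operator `T` on a complex Hilbert space has perfectly spanning unimodular
eigenvectors if there is a continuous probability measure `σ` on the unit circle such that
for every Borel subset `B` of the circle of full measure, the closed linear span of the
eigenspaces `ker (T - λ)`, `λ ∈ B`, is the whole space. -/
def PerfectlySpanning {H : Type*} [NormedAddCommGroup H] [InnerProductSpace ℂ H]
    (T : H →L[ℂ] H) : Prop :=
  ∃ σ : Measure ℂ, IsProbabilityMeasure σ ∧ σ {z : ℂ | ‖z‖ = 1}ᶜ = 0 ∧
    (∀ z : ℂ, σ {z} = 0) ∧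
    ∀ B : Set ℂ, MeasurableSet B → B ⊆ {z : ℂ | ‖z‖ = 1} → σ B = 1 →
      (⨆ z ∈ B, Module.End.eigenspace (T : H →ₗ[ℂ] H) z).topologicalClosure = ⊤

/-- The compact group `(ℤ/2)^ℕ`, used as the Cantor space. -/
abbrev Cantor : Type := ℕ → ZMod 2

/-- Haar probability measure on the Cantor group. -/
noncomputable def cantorMeasure : Measure Cantor := Measure.addHaarMeasure ⊤

lemma cantor_neBot : (𝓝[≠] (0 : Cantor)).NeBot := by
  have ht : Tendsto (fun m : ℕ => (Pi.single m 1 : Cantor)) atTop (𝓝[≠] 0) := by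
    rw [tendsto_nhdsWithin_iff]
    constructor
    · rw [tendsto_pi_nhds]
      intro i
      apply tendsto_const_nhds.congr'
      filter_upwards [eventually_gt_atTop i] with m hm
      simp [Pi.single_apply, hm.ne]
    · refine Eventually.of_forall fun m => ?_
      simp
  exact ht.neBot

lemma cantorMeasure_prob : IsProbabilityMeasure cantorMeasure := by
  constructor
  have := Measure.addHaarMeasure_self (G := Cantor) (K₀ := ⊤)
  simpa [cantorMeasure] using this

lemma cantorMeasure_open : cantorMeasure.IsOpenPosMeasure := by
  unfold cantorMeasure; infer_instance

lemma cantorMeasure_singleton (x : Cantor) : cantorMeasure {x} = 0 := by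
  haveI := cantor_neBot
  haveI : cantorMeasure.IsAddHaarMeasure := by unfold cantorMeasure; infer_instance
  exact (Measure.IsAddHaarMeasure.nullSingletonClass (μ := cantorMeasure)).measure_singleton x

/-- A weakly continuous total eigenvector field parametrised by the Cantor space with
injective measurable eigenvalues yields perfect spanning. -/
lemma perfectlySpanning_of_field {H : Type*} [NormedAddCommGroup H] [InnerProductSpace ℂ H]
    [CompleteSpace H] (T : H →L[ℂ] H) (E : Cantor → H) (φ : Cantor → ℂ)
    (hφm : Measurable φ) (hφi : Function.Injective φ) (hφn : ∀ ε, ‖φ ε‖ = 1)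
    (hE0 : ∀ ε, E ε ≠ 0) (hEc : ∀ x : H, Continuous fun ε => inner ℂ (E ε) x)
    (hEd : ∀ x : H, (∀ ε, inner ℂ (E ε) x = 0) → x = 0)
    (hT : ∀ ε, T (E ε) = φ ε • E ε) :
    PerfectlySpanning T ∧ ¬ {z : ℂ | ‖z‖ = 1 ∧ Module.End.HasEigenvalue
          (T : H →ₗ[ℂ] H) z}.Countable := by
  haveI := cantorMeasure_prob
  haveI := cantorMeasure_open
  have hmem : ∀ ε, E ε ∈ Module.End.eigenspace (T : H →ₗ[ℂ] H) (φ ε) := by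
    intro ε
    rw [Module.End.mem_eigenspace_iff]
    exact hT ε
  have hcirc : MeasurableSet {z : ℂ | ‖z‖ = 1} :=
    (isClosed_eq continuous_norm continuous_const).measurableSet
  have hat : ∀ z : ℂ, (cantorMeasure.map φ) {z} = 0 := by
    intro z
    rw [Measure.map_apply hφm (measurableSet_singleton z)]
    have hs : (φ ⁻¹' {z}).Subsingleton := by
      intro a ha b hb
      exact hφi (ha.trans hb.symm)
    rcases hs.eq_empty_or_singleton with h | ⟨a, h⟩
    · rw [h]; simp
    · rw [h]; exact cantorMeasure_singleton a
  have hprob : IsProbabilityMeasure (cantorMeasure.map φ) :=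
    Measure.isProbabilityMeasure_map hφm.aemeasurable
  refine ⟨⟨cantorMeasure.map φ, hprob, ?_, hat, ?_⟩, ?_⟩
  · rw [Measure.map_apply hφm hcirc.compl]
    have : φ ⁻¹' {z : ℂ | ‖z‖ = 1}ᶜ = ∅ := by
      ext ε; simp [hφn]
    rw [this]; simp
  · intro B hB _ hB1
    rw [Submodule.topologicalClosure_eq_top_iff, Submodule.eq_bot_iff]
    intro x hx
    apply hEd
    rw [Submodule.mem_orthogonal] at hx
    have hae : ∀ᵐ ε ∂cantorMeasure, φ ε ∈ B := by
      rw [Measure.map_apply hφm hB] at hB1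
      exact (mem_ae_iff_prob_eq_one (hφm hB)).2 hB1
    have hd : Dense {ε | φ ε ∈ B} := Measure.dense_of_ae hae
    have hz : (fun ε => inner ℂ (E ε) x) = fun _ => 0 := by
      refine Continuous.ext_on hd (hEc x) continuous_const ?_
      intro ε hε
      apply hx
      exact Submodule.mem_iSup_of_mem (φ ε) (Submodule.mem_iSup_of_mem hε (hmem ε))
    intro ε
    exact congrFun hz ε
  · intro hc
    have h0 : (cantorMeasure.map φ) {z : ℂ | ‖z‖ = 1 ∧ Module.End.HasEigenvalue
          (T : H →ₗ[ℂ] H) z} = 0 := by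
      rw [← Set.biUnion_of_singleton {z : ℂ | ‖z‖ = 1 ∧ Module.End.HasEigenvalue
          (T : H →ₗ[ℂ] H) z}, measure_biUnion_null_iff hc]
      intro z _
      exact hat z
    rw [Measure.map_apply hφm hc.measurableSet] at h0
    have : φ ⁻¹' {z : ℂ | ‖z‖ = 1 ∧ Module.End.HasEigenvalue (T : H →ₗ[ℂ] H) z} = Set.univ := by
      refine Set.eq_univ_of_forall fun ε => ⟨hφn ε, ?_⟩
      exact Module.End.hasEigenvalue_of_hasEigenvector ⟨hmem ε, hE0 ε⟩
    rw [this] at h0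
    simp at h0

/-- Recursive choice of the numbers `λ_j`. -/
lemma exists_lam (n : ℕ → ℕ) (h0 : n 0 = 1)
    (h : ∀ ε > (0 : ℝ), ∃ z : ℂ, ‖z‖ = 1 ∧ z ≠ 1 ∧ ∀ k, ‖z ^ (n k) - 1‖ ≤ ε)
    (d : ℕ → ℝ) (hd : ∀ j, 0 < d j) :
    ∃ lam : ℕ → ℂ, (∀ j, ‖lam j‖ = 1) ∧ (∀ j, lam j ≠ 1) ∧
      (∀ j k, ‖lam j ^ (n k) - 1‖ ≤ d j) ∧
      ∀ j, ‖lam (j + 1) - 1‖ ≤ ‖lam j - 1‖ / 4 := by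
  choose! g hg1 hg2 hg3 using h
  let lam : ℕ → ℂ := fun j => Nat.rec (g (d 0))
    (fun i z => g (min (d (i + 1)) (‖z - 1‖ / 4))) j
  have hs : ∀ j, lam (j + 1) = g (min (d (j + 1)) (‖lam j - 1‖ / 4)) := fun j => rfl
  have hz : lam 0 = g (d 0) := rfl
  have hne : ∀ j, lam j ≠ 1 := by
    intro j
    induction j with
    | zero => rw [hz]; exact hg2 _ (hd 0)
    | succ j ih =>
      rw [hs]
      apply hg2
      have : 0 < ‖lam j - 1‖ := norm_pos_iff.2 (sub_ne_zero.2 ih)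
      exact lt_min (hd _) (by positivity)
  have hp : ∀ j, 0 < min (d (j + 1)) (‖lam j - 1‖ / 4) := by
    intro j
    have : 0 < ‖lam j - 1‖ := norm_pos_iff.2 (sub_ne_zero.2 (hne j))
    exact lt_min (hd _) (by positivity)
  refine ⟨lam, ?_, hne, ?_, ?_⟩
  · rintro (_ | j)
    · exact hg1 _ (hd 0)
    · rw [hs]; exact hg1 _ (hp j)
  · rintro (_ | j) k
    · exact hg3 _ (hd 0) k
    · rw [hs]; exact (hg3 _ (hp j) k).trans (min_le_left _ _)
  · intro j
    have := hg3 _ (hp j) 0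
    rw [h0, pow_one, ← hs] at this
    exact this.trans (min_le_right _ _)

/-- The factor of the eigenvalue coming from the `j`-th coordinate. -/
noncomputable def fac (lam : ℕ → ℂ) (ε : Cantor) (j : ℕ) : ℂ := if ε j = 0 then 1 else lam j

/-- The partial products of the eigenvalue. -/
noncomputable def pprod (lam : ℕ → ℂ) (N : ℕ) (ε : Cantor) : ℂ :=
  ∏ j ∈ Finset.range N, fac lam ε j

section pp
variable {lam : ℕ → ℂ} (h1 : ∀ j, ‖lam j‖ = 1) (hne : ∀ j, lam j ≠ 1)
  (hq : ∀ j, ‖lam (j + 1) - 1‖ ≤ ‖lam j - 1‖ / 4)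

include h1 in
lemma norm_fac (ε : Cantor) (j : ℕ) : ‖fac lam ε j‖ = 1 := by
  unfold fac; split_ifs <;> simp [h1]

include h1 in
lemma norm_pprod (N : ℕ) (ε : Cantor) : ‖pprod lam N ε‖ = 1 := by
  unfold pprod; simp [norm_prod, norm_fac h1]

include h1 in
lemma pprod_step (N : ℕ) (ε : Cantor) :
    ‖pprod lam (N + 1) ε - pprod lam N ε‖ ≤ ‖lam N - 1‖ := by
  have : pprod lam (N + 1) ε - pprod lam N ε = pprod lam N ε * (fac lam ε N - 1) := by
    unfold pprod; rw [Finset.prod_range_succ]; ring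
  rw [this, norm_mul, norm_pprod h1, one_mul]
  unfold fac; split_ifs <;> simp

include hq in
lemma lam_decay (m i : ℕ) : ‖lam (m + i) - 1‖ ≤ ‖lam m - 1‖ * (1 / 4) ^ i := by
  induction i with
  | zero => simp
  | succ i ih =>
    have := hq (m + i)
    rw [← add_assoc, pow_succ]
    linarith

lemma pprod_measurable (N : ℕ) : Measurable (pprod lam N) := by
  unfold pprod
  refine Finset.measurable_prod _ fun j _ => ?_
  have : (fun ε : Cantor => fac lam ε j) = (fun a : ZMod 2 => if a = 0 then (1 : ℂ) else lam j) ∘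
      (fun ε : Cantor => ε j) := rfl
  show Measurable (fun ε : Cantor => fac lam ε j)
  rw [this]
  exact measurable_from_top.comp (measurable_pi_apply j)

include h1 hq in
lemma pprod_cauchy (ε : Cantor) : CauchySeq fun N => pprod lam N ε := by
  refine cauchySeq_of_le_geometric (1 / 4) ‖lam 0 - 1‖ (by norm_num) fun N => ?_
  rw [dist_comm, dist_eq_norm]
  have := lam_decay hq 0 N
  rw [zero_add] at this
  exact (pprod_step h1 N ε).trans this

include h1 hq in
lemma pprod_sep (ε ε' : Cantor) (m : ℕ) (hlt : ∀ j < m, ε j = ε' j) (hm : ε m ≠ ε' m) (i : ℕ) :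
    ‖lam m - 1‖ * (1 / 3 + 2 / 3 * (1 / 4) ^ i) ≤
      ‖pprod lam (m + 1 + i) ε - pprod lam (m + 1 + i) ε'‖ := by
  induction i with
  | zero =>
    have hp : pprod lam m ε = pprod lam m ε' := by
      unfold pprod
      refine Finset.prod_congr rfl fun j hj => ?_
      unfold fac; rw [hlt j (Finset.mem_range.1 hj)]
    have : pprod lam (m + 1) ε - pprod lam (m + 1) ε'
        = pprod lam m ε' * (fac lam ε m - fac lam ε' m) := by
      have e1 : pprod lam (m + 1) ε = pprod lam m ε * fac lam ε m := Finset.prod_range_succ _ _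
      have e2 : pprod lam (m + 1) ε' = pprod lam m ε' * fac lam ε' m := Finset.prod_range_succ _ _
      rw [e1, e2, hp]; ring
    rw [add_zero, this, norm_mul, norm_pprod h1, one_mul]
    have hz : ∀ a b : ZMod 2, a ≠ b → (a = 0 ∧ b ≠ 0) ∨ (a ≠ 0 ∧ b = 0) := by decide
    rcases hz _ _ hm with ⟨ha, hb⟩ | ⟨ha, hb⟩
    · simp only [fac, ha, hb, if_true, if_false]
      rw [norm_sub_rev]; norm_num
    · simp only [fac, ha, hb, if_true, if_false]
      norm_num
  | succ i ih =>
    have s1 := pprod_step h1 (m + 1 + i) ε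
    have s2 := pprod_step h1 (m + 1 + i) ε'
    have hd : ‖lam (m + 1 + i) - 1‖ ≤ ‖lam m - 1‖ * (1 / 4) ^ (i + 1) := by
      have := lam_decay hq m (i + 1)
      rwa [show m + (i + 1) = m + 1 + i by ring] at this
    have tri : ‖pprod lam (m + 1 + i) ε - pprod lam (m + 1 + i) ε'‖ ≤
        ‖pprod lam (m + 1 + (i + 1)) ε - pprod lam (m + 1 + (i + 1)) ε'‖ +
        ‖pprod lam (m + 1 + i + 1) ε - pprod lam (m + 1 + i) ε‖ +
        ‖pprod lam (m + 1 + i + 1) ε' - pprod lam (m + 1 + i) ε'‖ := by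
      have e : pprod lam (m + 1 + i) ε - pprod lam (m + 1 + i) ε' =
        (pprod lam (m + 1 + (i + 1)) ε - pprod lam (m + 1 + (i + 1)) ε') -
        (pprod lam (m + 1 + i + 1) ε - pprod lam (m + 1 + i) ε) +
        (pprod lam (m + 1 + i + 1) ε' - pprod lam (m + 1 + i) ε') := by
        rw [← add_assoc]; ring
      conv_lhs => rw [e]
      exact (norm_add_le _ _).trans (add_le_add_left (norm_sub_le _ _) _)
    rw [pow_succ] at hd ⊢
    nlinarith

include h1 hne hq in
lemma limit_injective (φ : Cantor → ℂ)
    (hφ : ∀ ε, Tendsto (fun N => pprod lam N ε) atTop (𝓝 (φ ε))) : Function.Injective φ := by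
  intro ε ε' heq
  by_contra hcon
  have hex : ∃ m, ε m ≠ ε' m := Function.ne_iff.1 hcon
  classical
  have hlt : ∀ j < Nat.find hex, ε j = ε' j := fun j hj => not_not.1 (Nat.find_min hex hj)
  have hsep := pprod_sep h1 hq ε ε' (Nat.find hex) hlt (Nat.find_spec hex)
  set m := Nat.find hex
  have hpos : 0 < ‖lam m - 1‖ := norm_pos_iff.2 (sub_ne_zero.2 (hne m))
  have ht : Tendsto (fun N => ‖pprod lam N ε - pprod lam N ε'‖) atTop (𝓝 ‖φ ε - φ ε'‖) :=
    ((hφ ε).sub (hφ ε')).norm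
  rw [heq, sub_self, norm_zero] at ht
  have : ‖lam m - 1‖ * (1 / 3) ≤ 0 := by
    refine ge_of_tendsto ht ?_
    filter_upwards [eventually_ge_atTop (m + 1)] with N hN
    obtain ⟨i, rfl⟩ := Nat.exists_eq_add_of_le hN
    refine le_trans ?_ (hsep i)
    gcongr
    have : (0 : ℝ) < (1 / 4) ^ i := by positivity
    linarith
  linarith
end pp

/-- Partial products of operators. -/
noncomputable def opProd {H : Type*} [NormedAddCommGroup H] [InnerProductSpace ℂ H]
    (Q : ℕ → H →L[ℂ] H) (c : ℕ → ℂ) : ℕ → (H →L[ℂ] H)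
  | 0 => 1
  | N + 1 => opProd Q c N * (1 + (c N - 1) • Q N)

lemma abstract_main {H : Type*} [NormedAddCommGroup H] [InnerProductSpace ℂ H]
    [CompleteSpace H] (Q : ℕ → H →L[ℂ] H) (E : Cantor → H)
    (hE0 : ∀ ε, E ε ≠ 0) (hEc : ∀ x : H, Continuous fun ε => inner ℂ (E ε) x)
    (hEd : ∀ x : H, (∀ ε, inner ℂ (E ε) x = 0) → x = 0)
    (hQ : ∀ j ε, Q j (E ε) = if ε j = 0 then 0 else E ε)
    (n : ℕ → ℕ) (h0 : n 0 = 1)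
    (h : ∀ ε > (0 : ℝ), ∃ z : ℂ, ‖z‖ = 1 ∧ z ≠ 1 ∧ ∀ k, ‖z ^ (n k) - 1‖ ≤ ε)
    (δ : ℝ) (hδ : 0 < δ) :
    ∃ T : H →L[ℂ] H, PerfectlySpanning T ∧ (∀ k, ‖T ^ (n k)‖ ≤ 1 + δ) ∧
      ¬ {z : ℂ | ‖z‖ = 1 ∧ Module.End.HasEigenvalue (T : H →ₗ[ℂ] H) z}.Countable := by
  have hL : 0 < Real.log (1 + δ) := Real.log_pos (by linarith)
  set L := Real.log (1 + δ) with hLdef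
  let d : ℕ → ℝ := fun j => L / 2 * (1 / 2) ^ j / (‖Q j‖ + 1)
  have hd : ∀ j, 0 < d j := fun j => by positivity
  obtain ⟨lam, h1, hne, hk, hq⟩ := exists_lam n h0 h d hd
  -- norm bounds
  have hb : ∀ j k, ‖(lam j ^ n k - 1) • Q j‖ ≤ L / 2 * (1 / 2) ^ j := by
    intro j k
    rw [norm_smul]
    calc _ ≤ d j * (‖Q j‖ + 1) := by
          gcongr
          · exact hk j k
          · linarith
      _ = _ := by
          have : ‖Q j‖ + 1 ≠ 0 := by positivity
          simp only [d]; field_simp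
  have hbN : ∀ k N, ‖opProd Q (fun j => lam j ^ n k) N‖ ≤ Real.exp (L * (1 - (1 / 2) ^ N)) := by
    intro k N
    induction N with
    | zero =>
      simp only [opProd, pow_zero, sub_self, mul_zero, Real.exp_zero]
      exact ContinuousLinearMap.norm_id_le
    | succ N ih =>
      simp only [opProd]
      refine (norm_mul_le _ _).trans ?_
      have e : L * (1 - (1 / 2) ^ (N + 1)) = L * (1 - (1 / 2) ^ N) + L / 2 * (1 / 2) ^ N := by
        rw [pow_succ]; ring
      rw [e, Real.exp_add]
      gcongr
      refine (norm_add_le _ _).trans ?_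
      have a1 : ‖(1 : H →L[ℂ] H)‖ ≤ 1 := ContinuousLinearMap.norm_id_le
      have a2 := hb N k
      have a3 := Real.add_one_le_exp (L / 2 * (1 / 2) ^ N)
      linarith
  have hbd : ∀ k N, ‖opProd Q (fun j => lam j ^ n k) N‖ ≤ 1 + δ := by
    intro k N
    refine (hbN k N).trans ?_
    have : (0 : ℝ) < (1 / 2) ^ N := by positivity
    calc _ ≤ Real.exp L := Real.exp_le_exp.2 (by nlinarith)
      _ = 1 + δ := Real.exp_log (by linarith)
  -- action on eigenvectors
  have hact : ∀ (c : ℕ → ℂ) N ε, opProd Q c N (E ε) = pprod c N ε • E ε := by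
    intro c N ε
    induction N with
    | zero => simp [opProd, pprod]
    | succ N ih =>
      have e1 : pprod c (N + 1) ε = pprod c N ε * fac c ε N := Finset.prod_range_succ _ _
      have e2 : (1 + (c N - 1) • Q N) (E ε) = fac c ε N • E ε := by
        simp only [ContinuousLinearMap.add_apply, ContinuousLinearMap.one_apply,
          ContinuousLinearMap.smul_apply, hQ, fac]
        split_ifs
        · simp
        · rw [sub_smul]; simp
      simp only [opProd, ContinuousLinearMap.mul_apply, e2, map_smul, ih, e1, smul_smul]
      rw [mul_comm]
  have hpow : ∀ (m N : ℕ) ε, pprod (fun j => lam j ^ m) N ε = pprod lam N ε ^ m := by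
    intro m N ε
    unfold pprod
    rw [← Finset.prod_pow]
    refine Finset.prod_congr rfl fun j _ => ?_
    unfold fac; split_ifs <;> simp
  have hactpow : ∀ (m N : ℕ) ε, (opProd Q lam N ^ m) (E ε) = pprod lam N ε ^ m • E ε := by
    intro m N ε
    induction m with
    | zero => simp
    | succ m ih =>
      rw [pow_succ, ContinuousLinearMap.mul_apply, hact, map_smul, ih, smul_smul, pow_succ,
        mul_comm]
  have hdense : Dense (Submodule.span ℂ (Set.range E) : Set H) := by
    rw [Submodule.dense_iff_topologicalClosure_eq_top, Submodule.topologicalClosure_eq_top_iff,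
      Submodule.eq_bot_iff]
    intro x hx
    apply hEd
    intro ε
    rw [Submodule.mem_orthogonal] at hx
    exact hx _ (Submodule.subset_span ⟨ε, rfl⟩)
  have hpoweq : ∀ m N : ℕ, opProd Q lam N ^ m = opProd Q (fun j => lam j ^ m) N := by
    intro m N
    refine ContinuousLinearMap.ext_on hdense ?_
    rintro _ ⟨ε, rfl⟩
    rw [hactpow, hact, hpow]
  -- limit operator
  have hlam1 : (fun j => lam j ^ n 0) = lam := by ext j; rw [h0, pow_one]
  have hcau : CauchySeq (opProd Q lam) := by
    refine cauchySeq_of_le_geometric (1 / 2) ((1 + δ) * (L / 2)) (by norm_num) fun N => ?_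
    rw [dist_comm, dist_eq_norm]
    have : opProd Q lam (N + 1) - opProd Q lam N = opProd Q lam N * ((lam N - 1) • Q N) := by
      simp only [opProd]; rw [mul_add, mul_one, add_sub_cancel_left]
    rw [this]
    refine (norm_mul_le _ _).trans ?_
    rw [mul_assoc]
    have b1 := hbd 0 N
    have b2 := hb N 0
    rw [hlam1] at b1
    rw [h0, pow_one] at b2
    gcongr
  obtain ⟨T, hT⟩ := cauchySeq_tendsto_of_complete hcau
  choose φ hφ using fun ε => cauchySeq_tendsto_of_complete (pprod_cauchy h1 hq ε)
  have hTE : ∀ ε, T (E ε) = φ ε • E ε := by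
    intro ε
    have t1 : Tendsto (fun N => opProd Q lam N (E ε)) atTop (𝓝 (T (E ε))) :=
      ((ContinuousLinearMap.apply ℂ H (E ε)).continuous.tendsto T).comp hT
    have t2 : Tendsto (fun N => opProd Q lam N (E ε)) atTop (𝓝 (φ ε • E ε)) := by
      simp only [hact]
      exact (hφ ε).smul_const _
    exact tendsto_nhds_unique t1 t2
  have hφm : Measurable φ :=
    measurable_of_tendsto_metrizable (fun N => pprod_measurable (lam := lam) N)
      (tendsto_pi_nhds.2 hφ)
  have hφn : ∀ ε, ‖φ ε‖ = 1 := by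
    intro ε
    have := (hφ ε).norm
    simp only [norm_pprod h1] at this
    exact tendsto_nhds_unique this tendsto_const_nhds
  obtain ⟨p1, p2⟩ := perfectlySpanning_of_field T E φ hφm (limit_injective h1 hne hq φ hφ) hφn
    hE0 hEc hEd hTE
  refine ⟨T, p1, fun k => ?_, p2⟩
  have : Tendsto (fun N => ‖opProd Q lam N ^ n k‖) atTop (𝓝 ‖T ^ n k‖) := (hT.pow (n k)).norm
  refine le_of_tendsto this (Eventually.of_forall fun N => ?_)
  rw [hpoweq]
  exact hbd k N

section model

/-- Toggle membership of `j`, on codes of finite sets. -/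
noncomputable def tog (e : ℕ ≃ Finset ℕ) (j : ℕ) : Equiv.Perm ℕ :=
  (e.trans (Function.Involutive.toPerm (fun S : Finset ℕ => symmDiff S {j})
    (fun S => by simp [symmDiff_assoc]))).trans e.symm

lemma e_tog (e : ℕ ≃ Finset ℕ) (j m : ℕ) (h : j ∉ e m) : e (tog e j m) = insert j (e m) := by
  have : e (tog e j m) = symmDiff (e m) {j} := by
    simp only [tog, Equiv.trans_apply, Equiv.apply_symm_apply]; rfl
  rw [this]
  ext i
  simp only [Finset.mem_symmDiff, Finset.mem_singleton, Finset.mem_insert]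
  by_cases hi : i = j
  · subst hi; simp [h]
  · simp [hi]

/-- Coordinates of `Q_j x`. -/
noncomputable def qfun (e : ℕ ≃ Finset ℕ) (j : ℕ) (x : ℕ → ℂ) (m : ℕ) : ℂ :=
  if j ∈ e m then x m else (2 : ℂ) ^ j * x (tog e j m)

lemma qfun_sum (e : ℕ ≃ Finset ℕ) (j : ℕ) (x : lp (fun _ : ℕ => ℂ) 2) (s : Finset ℕ) :
    ∑ m ∈ s, ‖qfun e j x m‖ ^ (2 : ENNReal).toReal ≤
      (2 * 2 ^ j * ‖x‖) ^ (2 : ENNReal).toReal := by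
  have hs : ∀ s : Finset ℕ, ∑ i ∈ s, ‖x i‖ ^ 2 ≤ ‖x‖ ^ 2 := by
    intro s
    have := lp.sum_rpow_le_norm_rpow (p := 2) (by norm_num) x s
    simpa using this
  have h2 : ∑ m ∈ s, ‖x (tog e j m)‖ ^ 2 ≤ ‖x‖ ^ 2 := by
    have := hs (s.map (tog e j).toEmbedding)
    simpa using this
  have h1 := hs s
  have hp : (1 : ℝ) ≤ 2 ^ j := one_le_pow₀ (by norm_num)
  have hpt : ∀ m, ‖qfun e j x m‖ ^ 2 ≤ (2 ^ j) ^ 2 * (‖x m‖ ^ 2 + ‖x (tog e j m)‖ ^ 2) := by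
    intro m
    unfold qfun
    split_ifs
    · have : (1 : ℝ) ≤ (2 ^ j) ^ 2 := one_le_pow₀ hp
      nlinarith [sq_nonneg ‖x m‖, sq_nonneg ‖x (tog e j m)‖]
    · rw [norm_mul, norm_pow, mul_pow]
      have : ‖(2 : ℂ)‖ = 2 := by simp
      rw [this]
      have : 0 ≤ ((2 : ℝ) ^ j) ^ 2 * ‖x m‖ ^ 2 := by positivity
      linarith
  have hfin : ∑ m ∈ s, ‖qfun e j x m‖ ^ 2 ≤ (2 * 2 ^ j * ‖x‖) ^ 2 := by
    calc _ ≤ ∑ m ∈ s, (2 ^ j) ^ 2 * (‖x m‖ ^ 2 + ‖x (tog e j m)‖ ^ 2) :=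
          Finset.sum_le_sum fun m _ => hpt m
      _ = (2 ^ j) ^ 2 * (∑ m ∈ s, ‖x m‖ ^ 2 + ∑ m ∈ s, ‖x (tog e j m)‖ ^ 2) := by
          rw [← Finset.mul_sum, Finset.sum_add_distrib]
      _ ≤ (2 ^ j) ^ 2 * (‖x‖ ^ 2 + ‖x‖ ^ 2) := by gcongr
      _ ≤ _ := by
          have : 0 ≤ ((2 : ℝ) ^ j) ^ 2 * ‖x‖ ^ 2 := by positivity
          nlinarith
  simpa using hfin

/-- The operator `Q_j`. -/
noncomputable def qop (e : ℕ ≃ Finset ℕ) (j : ℕ) :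
    lp (fun _ : ℕ => ℂ) 2 →L[ℂ] lp (fun _ : ℕ => ℂ) 2 :=
  LinearMap.mkContinuous
    { toFun := fun x => ⟨qfun e j x, memℓp_gen' (qfun_sum e j x)⟩
      map_add' := by
        intro x y
        ext m
        show qfun e j _ m = qfun e j x m + qfun e j y m
        simp only [qfun, lp.coeFn_add, Pi.add_apply]
        split_ifs
        · rfl
        · ring
      map_smul' := by
        intro c x
        ext m
        show qfun e j _ m = c * qfun e j x m
        simp only [qfun, lp.coeFn_smul, Pi.smul_apply, smul_eq_mul]
        split_ifs
        · rfl
        · ring }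
    (2 * 2 ^ j)
    (fun x => lp.norm_le_of_forall_sum_le (by norm_num) (by positivity) (qfun_sum e j x))

/-- Coordinates of the eigenvector field, indexed by finite sets. -/
noncomputable def ecoef (ε : Cantor) (S : Finset ℕ) : ℂ :=
  ∏ j ∈ S, (if ε j = 0 then (0 : ℂ) else (1 / 2) ^ j)

lemma ecoef_norm (ε : Cantor) (S : Finset ℕ) : ‖ecoef ε S‖ ≤ ∏ j ∈ S, (1 / 2 : ℝ) ^ j := by
  unfold ecoef
  rw [norm_prod]
  refine Finset.prod_le_prod (fun _ _ => norm_nonneg _) fun j _ => ?_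
  split_ifs
  · simp
  · simp

lemma summable_wt_sq (e : ℕ ≃ Finset ℕ) :
    Summable fun m => (∏ j ∈ e m, (1 / 2 : ℝ) ^ j) ^ 2 := by
  have h : Summable fun S : Finset ℕ => ∏ j ∈ S, (1 / 4 : ℝ) ^ j :=
    summable_finsetProd_of_summable_nonneg (fun j => by positivity)
      (summable_geometric_of_lt_one (by norm_num) (by norm_num))
  have h2 := (e.summable_iff (f := fun S : Finset ℕ => ∏ j ∈ S, (1 / 4 : ℝ) ^ j)).2 h
  refine h2.congr fun m => ?_
  simp only [Function.comp]
  rw [← Finset.prod_pow]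
  refine Finset.prod_congr rfl fun j _ => ?_
  rw [← pow_mul, mul_comm, pow_mul]; norm_num

lemma ecoef_mem (e : ℕ ≃ Finset ℕ) (ε : Cantor) :
    Memℓp (E := fun _ : ℕ => ℂ) (fun m => ecoef ε (e m)) 2 := by
  apply memℓp_gen
  have : Summable fun m => ‖ecoef ε (e m)‖ ^ 2 := by
    refine (summable_wt_sq e).of_nonneg_of_le (fun m => by positivity) fun m => ?_
    gcongr
    exact ecoef_norm ε _
  simpa using this

/-- The eigenvector field. -/
noncomputable def evec (e : ℕ ≃ Finset ℕ) (ε : Cantor) : lp (fun _ : ℕ => ℂ) 2 :=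
  ⟨fun m => ecoef ε (e m), ecoef_mem e ε⟩

lemma evec_apply (e : ℕ ≃ Finset ℕ) (ε : Cantor) (m : ℕ) : evec e ε m = ecoef ε (e m) := rfl

lemma evec_ne (e : ℕ ≃ Finset ℕ) (ε : Cantor) : evec e ε ≠ 0 := by
  intro h
  have : evec e ε (e.symm ∅) = 0 := by rw [h]; rfl
  rw [evec_apply] at this
  simp [ecoef] at this

lemma qop_evec (e : ℕ ≃ Finset ℕ) (j : ℕ) (ε : Cantor) :
    qop e j (evec e ε) = if ε j = 0 then 0 else evec e ε := by
  have key : ∀ m, qfun e j (evec e ε) m = if ε j = 0 then 0 else ecoef ε (e m) := by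
    intro m
    unfold qfun
    rw [evec_apply, evec_apply]
    split_ifs with h1 h2 h2
    · unfold ecoef
      exact Finset.prod_eq_zero h1 (by simp [h2])
    · rfl
    · rw [e_tog e j m h1]
      unfold ecoef
      rw [Finset.prod_insert h1]
      simp [h2]
    · rw [e_tog e j m h1]
      unfold ecoef
      rw [Finset.prod_insert h1, if_neg h2, ← mul_assoc, ← mul_pow]
      norm_num
  ext m
  have h1 : (qop e j (evec e ε)) m = qfun e j (evec e ε) m := rfl
  rw [h1, key]
  split_ifs
  · rfl
  · rfl

lemma evec_inner (e : ℕ ≃ Finset ℕ) (x : lp (fun _ : ℕ => ℂ) 2) (ε : Cantor) :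
    inner ℂ (evec e ε) x = ∑' m, x m * star (ecoef ε (e m)) := by
  rw [lp.inner_eq_tsum]
  rfl

lemma ecoef_continuous (S : Finset ℕ) : Continuous fun ε : Cantor => ecoef ε S := by
  unfold ecoef
  refine continuous_finsetProd _ fun j _ => ?_
  exact (continuous_of_discreteTopology
    (f := fun a : ZMod 2 => if a = 0 then (0 : ℂ) else (1 / 2) ^ j)).comp (continuous_apply j)

lemma evec_inner_continuous (e : ℕ ≃ Finset ℕ) (x : lp (fun _ : ℕ => ℂ) 2) :
    Continuous fun ε => inner ℂ (evec e ε) x := by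
  simp only [evec_inner]
  have hx : Summable fun m => ‖x m‖ ^ 2 := by
    have := (lp.memℓp x).summable (by norm_num)
    simpa using this
  refine continuous_tsum (u := fun m => ‖x m‖ ^ 2 + (∏ j ∈ e m, (1 / 2 : ℝ) ^ j) ^ 2)
    (fun m => ?_) (hx.add (summable_wt_sq e)) fun m ε => ?_
  · exact continuous_const.mul (ecoef_continuous _).star
  · rw [norm_mul, norm_star]
    have h1 := ecoef_norm ε (e m)
    have h2 : ‖x m‖ * ‖ecoef ε (e m)‖ ≤ ‖x m‖ * ∏ j ∈ e m, (1 / 2 : ℝ) ^ j := by gcongr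
    nlinarith [sq_nonneg (‖x m‖ - ∏ j ∈ e m, (1 / 2 : ℝ) ^ j), sq_nonneg ‖x m‖,
      sq_nonneg (∏ j ∈ e m, (1 / 2 : ℝ) ^ j)]

lemma evec_total (e : ℕ ≃ Finset ℕ) (x : lp (fun _ : ℕ => ℂ) 2)
    (hx : ∀ ε, inner ℂ (evec e ε) x = 0) : x = 0 := by
  have key : ∀ S : Finset ℕ, x (e.symm S) = 0 := by
    intro S
    induction S using Finset.strongInduction with
    | H S ih =>
      let ε : Cantor := fun j => if j ∈ S then 1 else 0
      have h := hx ε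
      rw [evec_inner, tsum_eq_single (e.symm S)] at h
      · rcases mul_eq_zero.1 h with h | h
        · exact h
        · exfalso
          rw [star_eq_zero, Equiv.apply_symm_apply] at h
          unfold ecoef at h
          rw [Finset.prod_eq_zero_iff] at h
          obtain ⟨j, hj, h⟩ := h
          simp [ε, hj] at h
      · intro m hm
        by_cases hsub : e m ⊆ S
        · have hss : e m ⊂ S := by
            refine hsub.ssubset_of_ne fun heq => hm ?_
            rw [← heq, Equiv.symm_apply_apply]
          have := ih _ hss
          rw [Equiv.symm_apply_apply] at this
          rw [this, zero_mul]
        · obtain ⟨j, hj, hjS⟩ := Finset.not_subset.1 hsub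
          have : ecoef ε (e m) = 0 := Finset.prod_eq_zero hj (by simp [ε, hjS])
          rw [this, star_zero, mul_zero]
  ext m
  have := key (e m)
  rw [Equiv.symm_apply_apply] at this
  rw [this]; rfl

end model

/-- Theorem 2.1 (Theorem 1bis): if for every `ε > 0` there is a unimodular `λ ≠ 1` with
`sup_k |λ^{n_k} - 1| ≤ ε`, then for every `δ > 0` there is a bounded operator on `ℓ²(ℕ)`
with perfectly spanning unimodular eigenvectors satisfying `sup_k ‖T^{n_k}‖ ≤ 1 + δ`;
in particular its set of unimodular eigenvalues is uncountable. -/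
theorem exists_perfectlySpanning_partially_power_bounded
    (n : ℕ → ℕ) (hmono : StrictMono n) (hpos : ∀ k, 0 < n k) (h0 : n 0 = 1)
    (h : ∀ ε > (0 : ℝ), ∃ z : ℂ, ‖z‖ = 1 ∧ z ≠ 1 ∧ ∀ k, ‖z ^ (n k) - 1‖ ≤ ε)
    (δ : ℝ) (hδ : 0 < δ) :
    ∃ T : (lp (fun _ : ℕ => ℂ) 2) →L[ℂ] (lp (fun _ : ℕ => ℂ) 2),
      PerfectlySpanning T ∧ (∀ k, ‖T ^ (n k)‖ ≤ 1 + δ) ∧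
      ¬ {z : ℂ | ‖z‖ = 1 ∧ Module.End.HasEigenvalue
          (T : lp (fun _ : ℕ => ℂ) 2 →ₗ[ℂ] lp (fun _ : ℕ => ℂ) 2) z}.Countable := by
  let e : ℕ ≃ Finset ℕ := (Denumerable.eqv (Finset ℕ)).symm
  exact abstract_main (fun j => qop e j) (evec e) (evec_ne e) (evec_inner_continuous e)
    (evec_total e) (fun j ε => qop_evec e j ε) n h0 h δ hδ
end

section
/- Let (n_k)_{k≥0} be a strictly increasing sequence of positive integers with n_0 = 1. The following assertions are equivalent: (1) for every ε > 0 there exists λ ∈ 𝕋 \ {1} such that sup_{k≥0} |λ^{n_k} − 1| ≤ ε and |λ^{n_k} − 1| → 0 as k → ∞; (2) there exists a separable complex Banach space X and a bounded linear operator T on X such that the set of unimodular eigenvalues σ_p(T) ∩ 𝕋 is uncountable and T^{n_k} x → x as k → ∞ for every x ∈ X. -/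
open Filter Topology

lemma rig_dir2 (n : ℕ → ℕ) {X : Type} [NormedAddCommGroup X] [NormedSpace ℂ X] [CompleteSpace X]
    [TopologicalSpace.SeparableSpace X] (T : X →L[ℂ] X)
    (hT : ¬ {z : ℂ | ‖z‖ = 1 ∧ Module.End.HasEigenvalue (T : X →ₗ[ℂ] X) z}.Countable)
    (hlim : ∀ x : X, Tendsto (fun k => (T ^ (n k)) x) atTop (𝓝 x)) (ε : ℝ) (hε : 0 < ε) :
    ∃ z : ℂ, ‖z‖ = 1 ∧ z ≠ 1 ∧ (∀ k, ‖z ^ (n k) - 1‖ ≤ ε) ∧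
      Tendsto (fun k => ‖z ^ (n k) - 1‖) atTop (𝓝 0) := by
  obtain ⟨M, hM⟩ : ∃ M, ∀ k, ‖T ^ (n k)‖ ≤ M := by
    apply banach_steinhaus
    intro x
    obtain ⟨C, hC⟩ := (hlim x).norm.bddAbove_range
    exact ⟨C, fun k => hC ⟨k, rfl⟩⟩
  have hM0 : 0 ≤ M := (norm_nonneg _).trans (hM 0)
  set Λ := {z : ℂ | ‖z‖ = 1 ∧ Module.End.HasEigenvalue (T : X →ₗ[ℂ] X) z} with hΛ
  have hvec : ∀ z : Λ, ∃ x : X, ‖x‖ = 1 ∧ T x = (z : ℂ) • x := by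
    rintro ⟨z, hz1, hz⟩
    obtain ⟨v, hv⟩ := hz.exists_hasEigenvector
    have hv0 : v ≠ 0 := hv.2
    have hTv : T v = z • v := hv.apply_eq_smul
    refine ⟨((‖v‖ : ℂ)⁻¹) • v, ?_, ?_⟩
    · rw [norm_smul]; simp [hv0]
    · rw [map_smul, hTv, smul_comm]
  choose x hx1 hx using hvec
  have hpow : ∀ (z : Λ) (m : ℕ), (T ^ m) (x z) = (z : ℂ) ^ m • x z := by
    intro z m
    induction m with
    | zero => simp
    | succ m ih => rw [pow_succ', mul_apply_eq_comp, ih, map_smul, hx, smul_smul, pow_succ]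
  have hone : ∀ z : Λ, Tendsto (fun k => (z : ℂ) ^ n k) atTop (𝓝 1) := by
    intro z
    rw [tendsto_iff_norm_sub_tendsto_zero]
    have h := tendsto_iff_norm_sub_tendsto_zero.1 (hlim (x z))
    refine h.congr fun k => ?_
    rw [hpow]
    calc ‖(z : ℂ) ^ n k • x z - x z‖ = ‖((z : ℂ) ^ n k - 1) • x z‖ := by rw [sub_smul, one_smul]
      _ = _ := by rw [norm_smul, hx1, mul_one]
  set δ := ε / (M + 1) with hδ
  have hδ0 : 0 < δ := by positivity
  obtain ⟨a, b, hab, hclose⟩ : ∃ a b : Λ, a ≠ b ∧ ‖x a - x b‖ < δ := by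
    by_contra! hcon
    apply hT
    have : Countable Λ := by
      refine Pairwise.countable_of_isOpen_disjoint (s := fun a : Λ => Metric.ball (x a) (δ / 2))
        ?_ (fun _ => Metric.isOpen_ball) (fun _ => Metric.nonempty_ball.2 (by positivity))
      intro a b hab
      apply Metric.ball_disjoint_ball
      rw [dist_eq_norm]
      linarith [hcon a b hab]
    exact this
  have hb0 : (b : ℂ) ≠ 0 := by
    intro h; have := b.2.1; rw [h] at this; simp at this
  have hbn : ∀ m : ℕ, ‖(b : ℂ) ^ m‖ = 1 := fun m => by rw [norm_pow, b.2.1, one_pow]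
  have key : ∀ k, ‖((a : ℂ) / b) ^ n k - 1‖ = ‖(a : ℂ) ^ n k - (b : ℂ) ^ n k‖ := by
    intro k
    rw [div_pow, div_sub_one (pow_ne_zero _ hb0), norm_div, hbn, div_one]
  refine ⟨a / b, by rw [norm_div, a.2.1, b.2.1, div_one], ?_, ?_, ?_⟩
  · rw [Ne, div_eq_one_iff_eq hb0]
    exact fun h => hab (Subtype.ext h)
  · intro k
    rw [key]
    have e : ((a : ℂ) ^ n k - (b : ℂ) ^ n k) • x a
        = (T ^ n k) (x a - x b) - (b : ℂ) ^ n k • (x a - x b) := by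
      rw [map_sub, hpow, hpow, sub_smul, smul_sub]; abel
    calc ‖(a : ℂ) ^ n k - (b : ℂ) ^ n k‖ = ‖((a : ℂ) ^ n k - (b : ℂ) ^ n k) • x a‖ := by
          rw [norm_smul, hx1, mul_one]
      _ ≤ ‖(T ^ n k) (x a - x b)‖ + ‖(b : ℂ) ^ n k • (x a - x b)‖ := by rw [e]; exact norm_sub_le _ _
      _ ≤ M * ‖x a - x b‖ + ‖x a - x b‖ := by
          gcongr
          · exact (T ^ n k).le_of_opNorm_le (hM k) _
          · rw [norm_smul, hbn, one_mul]
      _ = (M + 1) * ‖x a - x b‖ := by ring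
      _ ≤ (M + 1) * δ := by gcongr
      _ = ε := by rw [hδ]; field_simp
  · simp_rw [key]
    simpa using ((hone a).sub (hone b)).norm

section
open BoundedContinuousFunction

lemma rig_cantor (n : ℕ → ℕ) (h0 : n 0 = 1)
    (h : ∀ ε > (0 : ℝ), ∃ z : ℂ, ‖z‖ = 1 ∧ z ≠ 1 ∧ (∀ k, ‖z ^ (n k) - 1‖ ≤ ε) ∧
      Tendsto (fun k => ‖z ^ (n k) - 1‖) atTop (𝓝 0)) :
    ∃ c : (ℕ → Bool) → (ℕ →ᵇ ℂ), Continuous c ∧ Function.Injective c ∧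
      (∀ w, ‖c w 0‖ = 1) ∧ (∀ w k, c w k = (c w 0) ^ n k) ∧
      ∀ w, Tendsto (c w) atTop (𝓝 1) := by
  set G : Set (ℕ →ᵇ ℂ) := {u | ‖u 0‖ = 1 ∧ (∀ k, u k = (u 0) ^ n k) ∧
    Tendsto u atTop (𝓝 1)} with hG
  have hcl : IsClosed G := by
    have ev : ∀ k, Continuous (fun u : ℕ →ᵇ ℂ => u k) := fun k => continuous_eval_const k
    have h1 : IsClosed {u : ℕ →ᵇ ℂ | ‖u 0‖ = 1} := isClosed_eq (ev 0).norm continuous_const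
    have h2 : IsClosed {u : ℕ →ᵇ ℂ | ∀ k, u k = (u 0) ^ n k} := by
      simp only [Set.ofPred_forall]
      exact isClosed_iInter fun k => isClosed_eq (ev k) ((ev 0).pow _)
    have h3 : IsClosed {u : ℕ →ᵇ ℂ | Tendsto u atTop (𝓝 1)} := by
      have he : Equicontinuous (fun (k : ℕ) (u : ℕ →ᵇ ℂ) => u k) := by
        apply UniformEquicontinuous.equicontinuous
        apply LipschitzWith.uniformEquicontinuous _ 1
        intro k
        refine LipschitzWith.of_dist_le_mul fun u v => ?_
        simpa using dist_coe_le_dist (f := u) (g := v) k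
      exact he.isClosed_setOfPred_tendsto (f := fun _ => (1 : ℂ)) continuous_const
    exact h1.inter (h2.inter h3)
  have hperf : Perfect G := by
    refine ⟨hcl, preperfect_iff_nhds.2 ?_⟩
    rintro u ⟨hu1, hu2, hu3⟩ U hU
    obtain ⟨ε, hε, hball⟩ := Metric.mem_nhds_iff.1 hU
    obtain ⟨z, hz1, hz2, hz3, hz4⟩ := h (ε / 2) (by positivity)
    have hun : ∀ k, ‖u k‖ = 1 := fun k => by rw [hu2, norm_pow, hu1, one_pow]
    let v : ℕ →ᵇ ℂ := ofNormedAddCommGroupDiscrete (fun k => u k * z ^ n k) 1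
      (fun k => by rw [norm_mul, hun, norm_pow, hz1]; simp)
    have hv : ∀ k, v k = u k * z ^ n k := fun k => rfl
    refine ⟨v, ⟨hball ?_, ?_, ?_, ?_⟩, ?_⟩
    · rw [Metric.mem_ball]
      refine lt_of_le_of_lt ((dist_le (C := ε / 2) (by positivity)).2 fun k => ?_) (by linarith)
      rw [hv, dist_eq_norm]
      calc ‖u k * z ^ n k - u k‖ = ‖u k * (z ^ n k - 1)‖ := by ring_nf
        _ ≤ ε / 2 := by rw [norm_mul, hun, one_mul]; exact hz3 k
    · rw [hv, norm_mul, norm_pow, hz1, hu1]; simp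
    · intro k
      rw [hv, hv, h0, pow_one, mul_pow, hu2]
    · have := hu3.mul (tendsto_iff_norm_sub_tendsto_zero.2 hz4)
      rw [mul_one] at this
      exact this
    · intro hvu
      have := hv 0
      rw [hvu, h0, pow_one] at this
      have hu0 : u 0 ≠ 0 := by intro h'; rw [h'] at hu1; simp at hu1
      exact hz2 (mul_left_cancel₀ hu0 (by rw [← this, mul_one]))
  have hne : G.Nonempty := by
    refine ⟨BoundedContinuousFunction.const ℕ 1, ?_, ?_, ?_⟩
    · simp
    · simp
    · simp
  obtain ⟨c, hc1, hc2, hc3⟩ := hperf.exists_nat_bool_injection hne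
  have hc : ∀ w, c w ∈ G := fun w => hc1 ⟨w, rfl⟩
  exact ⟨c, hc2, hc3, fun w => (hc w).1, fun w => (hc w).2.1, fun w => (hc w).2.2⟩

/-- The unit ball of bounded Lipschitz functions for the pseudo-metric pulled back by `c`. -/
def RigBall (c : (ℕ → Bool) → (ℕ →ᵇ ℂ)) : Type :=
  {f : (ℕ → Bool) → ℂ // (∀ w, ‖f w‖ ≤ 1) ∧ ∀ w w', ‖f w - f w'‖ ≤ dist (c w) (c w')}

instance (c : (ℕ → Bool) → (ℕ →ᵇ ℂ)) : TopologicalSpace (RigBall c) :=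
  inferInstanceAs (TopologicalSpace (Subtype _))

/-- Multiplication by the `k`-th coordinate, divided by two. -/
noncomputable def rigMul (c : (ℕ → Bool) → (ℕ →ᵇ ℂ)) (hc : ∀ w k, ‖c w k‖ = 1) (k : ℕ) :
    C(RigBall c, RigBall c) where
  toFun f := ⟨fun w => c w k * f.1 w / 2, by
    constructor
    · intro w
      rw [norm_div, norm_mul, hc]
      have := f.2.1 w
      simp; linarith
    · intro w w'
      have h1 : ‖c w k - c w' k‖ ≤ dist (c w) (c w') := by
        rw [← dist_eq_norm]; exact dist_coe_le_dist k
      have h2 := f.2.2 w w'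
      have h3 := f.2.1 w
      calc ‖c w k * f.1 w / 2 - c w' k * f.1 w' / 2‖
          = ‖((c w k - c w' k) * f.1 w + c w' k * (f.1 w - f.1 w')) / 2‖ := by ring_nf
        _ ≤ (‖(c w k - c w' k)‖ * ‖f.1 w‖ + ‖c w' k‖ * ‖(f.1 w - f.1 w')‖) / 2 := by
            rw [norm_div, ← norm_mul, ← norm_mul]
            simp only [Complex.norm_ofNat]
            gcongr
            exact norm_add_le _ _
        _ ≤ (dist (c w) (c w') * 1 + 1 * dist (c w) (c w')) / 2 := by
            rw [hc]; gcongr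
        _ = _ := by ring⟩
  continuous_toFun := by
    refine Continuous.subtype_mk ?_ _
    refine continuous_pi fun w => ?_
    have : Continuous fun f : RigBall c => f.1 w := (continuous_apply w).comp continuous_subtype_val
    exact (continuous_const.mul this).div_const 2

/-- The operator dual to multiplication by the `k`-th coordinate. -/
noncomputable def rigOp (c : (ℕ → Bool) → (ℕ →ᵇ ℂ)) (hc : ∀ w k, ‖c w k‖ = 1) (k : ℕ) :
    (RigBall c →ᵇ ℂ) →L[ℂ] (RigBall c →ᵇ ℂ) :=
  LinearMap.mkContinuous
    { toFun := fun φ => (2 : ℂ) • φ.compContinuous (rigMul c hc k)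
      map_add' := by intro φ ψ; ext f; simp [mul_add]
      map_smul' := by intro a φ; ext f; simp; ring } 2 (by
    intro φ
    simp only [LinearMap.coe_mk, AddHom.coe_mk]
    rw [norm_smul]
    simp only [Complex.norm_ofNat]
    gcongr
    rw [norm_le (norm_nonneg _)]
    intro f
    exact φ.norm_coe_le_norm _)

/-- Point evaluations. -/
noncomputable def rigEv (c : (ℕ → Bool) → (ℕ →ᵇ ℂ)) (w : ℕ → Bool) : RigBall c →ᵇ ℂ :=
  BoundedContinuousFunction.ofNormedAddCommGroup (fun f : RigBall c => f.1 w)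
    ((continuous_apply w).comp continuous_subtype_val) 1 (fun f => f.2.1 w)

lemma rigOp_norm (c : (ℕ → Bool) → (ℕ →ᵇ ℂ)) (hc : ∀ w k, ‖c w k‖ = 1) (k : ℕ) :
    ‖rigOp c hc k‖ ≤ 2 := LinearMap.mkContinuous_norm_le _ (by norm_num) _

lemma rigOp_ev (c : (ℕ → Bool) → (ℕ →ᵇ ℂ)) (hc : ∀ w k, ‖c w k‖ = 1) (k : ℕ) (w : ℕ → Bool) :
    rigOp c hc k (rigEv c w) = c w k • rigEv c w := by
  ext f
  change (2 : ℂ) * (c w k * f.1 w / 2) = c w k * f.1 w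
  ring

lemma rigEv_cont (c : (ℕ → Bool) → (ℕ →ᵇ ℂ)) (hc : Continuous c) : Continuous (rigEv c) := by
  rw [continuous_iff_continuousAt]
  intro w
  rw [ContinuousAt, tendsto_iff_dist_tendsto_zero]
  refine squeeze_zero (fun _ => dist_nonneg) (g := fun w' => dist (c w') (c w)) ?_ ?_
  · intro w'
    refine (dist_le dist_nonneg).2 fun f => ?_
    rw [dist_eq_norm]
    exact f.2.2 w' w
  · exact tendsto_iff_dist_tendsto_zero.1 hc.continuousAt

lemma rigEv_ne (c : (ℕ → Bool) → (ℕ →ᵇ ℂ)) (w : ℕ → Bool) : rigEv c w ≠ 0 := by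
  intro h
  let f : RigBall c := ⟨fun _ => 1, by simp, by simp⟩
  have : rigEv c w f = 0 := by rw [h]; rfl
  have h2 : rigEv c w f = 1 := rfl
  rw [h2] at this
  exact one_ne_zero this

lemma rig_dir1 (n : ℕ → ℕ) (h0 : n 0 = 1)
    (h : ∀ ε > (0 : ℝ), ∃ z : ℂ, ‖z‖ = 1 ∧ z ≠ 1 ∧ (∀ k, ‖z ^ (n k) - 1‖ ≤ ε) ∧
      Tendsto (fun k => ‖z ^ (n k) - 1‖) atTop (𝓝 0)) :
    (∃ (X : Type) (_ : NormedAddCommGroup X) (_ : NormedSpace ℂ X) (_ : CompleteSpace X)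
      (_ : TopologicalSpace.SeparableSpace X) (T : X →L[ℂ] X),
      ¬ {z : ℂ | ‖z‖ = 1 ∧ Module.End.HasEigenvalue (T : X →ₗ[ℂ] X) z}.Countable ∧
      ∀ x : X, Tendsto (fun k => (T ^ (n k)) x) atTop (𝓝 x)) := by
  obtain ⟨c, hcc, hci, hc0, hcn, hcl⟩ := rig_cantor n h0 h
  have hc : ∀ w k, ‖c w k‖ = 1 := fun w k => by rw [hcn, norm_pow, hc0, one_pow]
  let V : Submodule ℂ (RigBall c →ᵇ ℂ) := (Submodule.span ℂ (Set.range (rigEv c))).topologicalClosure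
  have hVc : IsClosed (V : Set (RigBall c →ᵇ ℂ)) := Submodule.isClosed_topologicalClosure _
  have hVsep : TopologicalSpace.IsSeparable (V : Set (RigBall c →ᵇ ℂ)) := by
    have := ((TopologicalSpace.isSeparable_range (rigEv_cont c hcc)).span (R := ℂ)).closure
    simpa [V, Submodule.topologicalClosure_coe] using this
  have hsub : ∀ W : Submodule ℂ (RigBall c →ᵇ ℂ), IsClosed (W : Set (RigBall c →ᵇ ℂ)) →
      (∀ w, rigEv c w ∈ W) → V ≤ W := by
    intro W hW hw
    refine Submodule.topologicalClosure_minimal _ (Submodule.span_le.2 ?_) hW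
    rintro _ ⟨w, rfl⟩
    exact hw w
  have hmem : ∀ w, rigEv c w ∈ V := fun w =>
    Submodule.le_topologicalClosure _ (Submodule.subset_span ⟨w, rfl⟩)
  have hinv : ∀ x ∈ V, rigOp c hc 0 x ∈ V := by
    have := hsub (V.comap (rigOp c hc 0).toLinearMap) (hVc.preimage (rigOp c hc 0).continuous) ?_
    · exact this
    · intro w
      change rigOp c hc 0 (rigEv c w) ∈ V
      rw [rigOp_ev]
      exact V.smul_mem _ (hmem w)
  let T : V →L[ℂ] V := (rigOp c hc 0).restrict hinv
  have hTcoe : ∀ x : V, ((T x : V) : RigBall c →ᵇ ℂ) = rigOp c hc 0 x := fun x => rfl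
  have hTpow : ∀ (m : ℕ) (x : V), (((T ^ m) x : V) : RigBall c →ᵇ ℂ) = ((rigOp c hc 0) ^ m) x := by
    intro m
    induction m with
    | zero => intro x; simp
    | succ m ih =>
      intro x
      rw [pow_succ', pow_succ', mul_apply_eq_comp, mul_apply_eq_comp, hTcoe, ih]
  have hevpow : ∀ (m : ℕ) w, ((rigOp c hc 0) ^ m) (rigEv c w) = (c w 0) ^ m • rigEv c w := by
    intro m w
    induction m with
    | zero => simp
    | succ m ih =>
      rw [pow_succ', mul_apply_eq_comp, ih, map_smul, rigOp_ev, smul_smul, pow_succ]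
  have hagree : ∀ k, ∀ x ∈ V, ((rigOp c hc 0) ^ n k) x = rigOp c hc k x := by
    intro k
    have := hsub (LinearMap.eqLocus ((rigOp c hc 0) ^ n k).toLinearMap (rigOp c hc k).toLinearMap)
      (isClosed_eq ((rigOp c hc 0) ^ n k).continuous (rigOp c hc k).continuous) ?_
    · exact this
    · intro w
      change ((rigOp c hc 0) ^ n k) (rigEv c w) = rigOp c hc k (rigEv c w)
      rw [hevpow, rigOp_ev, hcn w k]
  have hlim : ∀ x ∈ V, Tendsto (fun k => rigOp c hc k x) atTop (𝓝 x) := by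
    let W : Submodule ℂ (RigBall c →ᵇ ℂ) :=
      { carrier := {x | Tendsto (fun k => rigOp c hc k x) atTop (𝓝 x)}
        add_mem' := by
          intro a b ha hb
          simpa using Tendsto.add ha hb
        zero_mem' := by simp
        smul_mem' := by
          intro a x hx
          simpa using Tendsto.const_smul hx a }
    refine hsub W ?_ ?_
    · have he : Equicontinuous (fun (k : ℕ) (x : RigBall c →ᵇ ℂ) => rigOp c hc k x) := by
        apply UniformEquicontinuous.equicontinuous
        apply LipschitzWith.uniformEquicontinuous _ 2
        intro k
        exact (rigOp c hc k).lipschitz.weaken (rigOp_norm c hc k)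
      exact he.isClosed_setOfPred_tendsto continuous_id
    · intro w
      change Tendsto (fun k => rigOp c hc k (rigEv c w)) atTop (𝓝 (rigEv c w))
      simp_rw [rigOp_ev]
      simpa using (hcl w).smul_const (rigEv c w)
  refine ⟨V, inferInstance, inferInstance, hVc.completeSpace_coe, hVsep.separableSpace, T, ?_, ?_⟩
  · intro hcount
    have hinj : Function.Injective (fun w => c w 0) := by
      intro w w' hww
      apply hci
      ext k
      have : c w 0 = c w' 0 := hww
      rw [hcn w, hcn w', this]
    have hsubset : Set.range (fun w => c w 0) ⊆
        {z : ℂ | ‖z‖ = 1 ∧ Module.End.HasEigenvalue (T : V →ₗ[ℂ] V) z} := by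
      rintro _ ⟨w, rfl⟩
      refine ⟨hc0 w, ?_⟩
      apply Module.End.hasEigenvalue_of_hasEigenvector (x := (⟨rigEv c w, hmem w⟩ : V))
      refine ⟨Module.End.mem_eigenspace_iff.2 ?_, ?_⟩
      · apply Subtype.ext
        exact rigOp_ev c hc 0 w
      · intro h'
        exact rigEv_ne c w (congrArg Subtype.val h')
    have h1 := hcount.mono hsubset
    have h2 : Countable (ℕ → Bool) := by
      have := h1.to_subtype
      exact (Set.rangeFactorization_injective.2 hinj).countable
    rw [← Cardinal.mk_le_aleph0_iff] at h2
    simp only [Cardinal.mk_pi, Cardinal.mk_bool, Cardinal.prod_const, Cardinal.lift_id, Cardinal.mk_nat] at h2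
    exact absurd h2 (not_le.2 (by simpa using Cardinal.cantor Cardinal.aleph0))
  · intro x
    rw [tendsto_subtype_rng]
    simp_rw [hTpow, hagree _ _ x.2]
    exact hlim _ x.2

end

/-- Theorem 1.4, equivalence (1) ⟺ (2): for a strictly increasing sequence of positive
integers with `n 0 = 1`, the existence, for each `ε > 0`, of a unimodular `λ ≠ 1` with
`sup_k |λ^{n_k} - 1| ≤ ε` and `|λ^{n_k} - 1| → 0`, is equivalent to the existence of a
bounded operator on a separable complex Banach space whose set of unimodular eigenvalues
is uncountable and with `T^{n_k} x → x` for every `x`. -/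
theorem topological_rigidity_characterization
    (n : ℕ → ℕ) (hmono : StrictMono n) (hpos : ∀ k, 0 < n k) (h0 : n 0 = 1) :
    (∀ ε > (0 : ℝ), ∃ z : ℂ, ‖z‖ = 1 ∧ z ≠ 1 ∧ (∀ k, ‖z ^ (n k) - 1‖ ≤ ε) ∧
      Tendsto (fun k => ‖z ^ (n k) - 1‖) atTop (𝓝 0))
    ↔
    (∃ (X : Type) (_ : NormedAddCommGroup X) (_ : NormedSpace ℂ X) (_ : CompleteSpace X)
      (_ : TopologicalSpace.SeparableSpace X) (T : X →L[ℂ] X),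
      ¬ {z : ℂ | ‖z‖ = 1 ∧ Module.End.HasEigenvalue (T : X →ₗ[ℂ] X) z}.Countable ∧
      ∀ x : X, Tendsto (fun k => (T ^ (n k)) x) atTop (𝓝 x)) := by
  constructor
  · exact rig_dir1 n h0
  · rintro ⟨X, _, _, _, _, T, hT, hlim⟩ ε hε
    exact rig_dir2 n T hT hlim ε hε
end

section
/- Let (n_k)_{k≥0} be a strictly increasing sequence of positive integers with n_0 = 1 such that for every ε > 0 there exists λ ∈ 𝕋 \ {1} with sup_{k≥0} |λ^{n_k} − 1| ≤ ε and |λ^{n_k} − 1| → 0 as k → ∞. Then there exists a bounded linear operator T on the Hilbert space ℓ²(ℕ, ℂ) such that T has perfectly spanning unimodular eigenvectors and T^{n_k} x → x as k → ∞ for every x ∈ ℓ²(ℕ, ℂ) (i.e. T is topologically rigid with respect to (n_k)). -/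
open MeasureTheory Filter Topology

/-- Fair coin-tossing measure on the Cantor space. -/
lemma exists_cantor_measure : ∃ ν : Measure (ℕ → Bool), IsProbabilityMeasure ν ∧
    (∀ x, ν {x} = 0) ∧ ∀ U : Set (ℕ → Bool), IsOpen U → U.Nonempty → ν U ≠ 0 := by
  let c : Measure Bool := (PMF.uniformOfFintype Bool).toMeasure
  have hc : ∀ a, c {a} = 2⁻¹ := by
    intro a
    simp [c]
  let ν := Measure.infinitePi (fun _ : ℕ => c)
  have hbox : ∀ (x : ℕ → Bool) (s : Finset ℕ),
      ν (Set.pi (s : Set ℕ) (fun i => {x i})) = 2⁻¹ ^ s.card := by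
    intro x s
    simp only [ν]
    rw [Measure.infinitePi_pi]
    · simp [hc]
    · intro i _; exact measurableSet_singleton _
  refine ⟨ν, inferInstance, ?_, ?_⟩
  · intro x
    have h1 : ∀ N : ℕ, ν {x} ≤ (2⁻¹ : ENNReal) ^ N := by
      intro N
      have := hbox x (Finset.range N)
      rw [Finset.card_range] at this
      rw [← this]
      apply measure_mono
      rintro y rfl
      intro i _
      rfl
    have h2 : Tendsto (fun N : ℕ => (2⁻¹ : ENNReal) ^ N) atTop (𝓝 0) :=
      ENNReal.tendsto_pow_atTop_nhds_zero_of_lt_one (by simp)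
    exact le_antisymm (ge_of_tendsto' h2 h1) bot_le
  · rintro U hU ⟨x, hx⟩
    obtain ⟨s, u, hu, hsub⟩ := isOpen_pi_iff.1 hU x hx
    have h3 : ν (Set.pi (s : Set ℕ) (fun i => {x i})) ≤ ν U := by
      apply measure_mono
      refine Set.Subset.trans ?_ hsub
      apply Set.pi_mono
      intro i hi y hy
      rw [Set.mem_singleton_iff] at hy
      rw [hy]; exact (hu i hi).2
    rw [hbox] at h3
    intro h0
    rw [h0] at h3
    have : (2⁻¹ : ENNReal) ^ s.card ≠ 0 := by simp
    exact this (le_antisymm h3 bot_le)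

/-- Diagonal unitary plus absolutely convergent sum of rank-one operators. -/
lemma exists_diag_add {ι H : Type*} [NormedAddCommGroup H] [InnerProductSpace ℂ H]
    [CompleteSpace H] (b : HilbertBasis ι ℂ H) (d : ι → ℂ) (hd : ∀ i, ‖d i‖ = 1)
    (u : ι → H) (c : ι → ℝ) (hc : Summable c) (hu : ∀ i, ‖u i‖ ≤ c i) :
    ∃ M : H →L[ℂ] H, (∀ i, M (b i) = d i • b i + u i) ∧ ‖M‖ ≤ 1 + ∑' i, c i := by
  classical
  have ho : Orthonormal ℂ (fun i => d i • b i) := by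
    have hb := b.orthonormal
    rw [orthonormal_iff_ite] at hb ⊢
    intro i j
    rw [inner_smul_left, inner_smul_right, hb]
    split_ifs with hij
    · subst hij
      rw [mul_one, Complex.conj_mul', hd]; simp
    · simp
  have hsp : ⊤ ≤ (Submodule.span ℂ (Set.range (fun i => d i • b i))).topologicalClosure := by
    rw [← b.dense_span]
    apply Submodule.topologicalClosure_mono
    rw [Submodule.span_le]
    rintro _ ⟨i, rfl⟩
    have hne : d i ≠ 0 := by
      intro h0; have := hd i; rw [h0] at this; simp at this
    have h1 : b i = (d i)⁻¹ • (d i • b i) := by rw [smul_smul, inv_mul_cancel₀ hne, one_smul]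
    rw [h1]
    exact Submodule.smul_mem _ _ (Submodule.subset_span ⟨i, rfl⟩)
  let b' := HilbertBasis.mk ho hsp
  have hb' : ∀ i, b' i = d i • b i := fun i => by
    have := HilbertBasis.coe_mk ho hsp
    exact congrFun this i
  let D : H ≃ₗᵢ[ℂ] H := b.repr.trans b'.repr.symm
  have hD : ∀ i, D (b i) = d i • b i := by
    intro i
    simp only [D, LinearIsometryEquiv.trans_apply]
    rw [b.repr_self, b'.repr_symm_single, hb']
  let R : ι → (H →L[ℂ] H) := fun i => (innerSL ℂ (b i)).smulRight (u i)
  have hR : ∀ i, ‖R i‖ ≤ c i := by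
    intro i
    simp only [R, ContinuousLinearMap.norm_smulRight_apply, innerSL_apply_norm]
    rw [b.orthonormal.1 i, one_mul]; exact hu i
  have hRs : Summable R := Summable.of_norm_bounded hc hR
  refine ⟨(D.toContinuousLinearEquiv : H →L[ℂ] H) + ∑' i, R i, ?_, ?_⟩
  · intro i
    rw [add_apply]
    congr 1
    · exact hD i
    · have h1 : (∑' j, R j) (b i) = ∑' j, R j (b i) :=
        (ContinuousLinearMap.apply ℂ H (b i)).map_tsum hRs
      rw [h1, tsum_eq_single i]
      · simp [R, b.orthonormal.1 i]
      · intro j hj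
        simp [R, b.orthonormal.2 hj]
  · refine (norm_add_le _ _).trans (add_le_add ?_ ?_)
    · refine ContinuousLinearMap.opNorm_le_bound _ zero_le_one ?_
      intro x
      rw [one_mul]
      exact (D.norm_map x).le
    · exact tsum_of_norm_bounded hc.hasSum hR

/-- The choice of the generators. -/
lemma exists_mu (n : ℕ → ℕ) (h0 : n 0 = 1)
    (h : ∀ ε > (0 : ℝ), ∃ z : ℂ, ‖z‖ = 1 ∧ z ≠ 1 ∧ (∀ k, ‖z ^ (n k) - 1‖ ≤ ε) ∧
      Tendsto (fun k => ‖z ^ (n k) - 1‖) atTop (𝓝 0))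
    (δ : ℕ → ℝ) (hδ : ∀ j, 0 < δ j) :
    ∃ μ : ℕ → ℂ, (∀ j, ‖μ j‖ = 1) ∧ (∀ j, μ j ≠ 1) ∧ (∀ j k, ‖μ j ^ (n k) - 1‖ ≤ δ j) ∧
      (∀ j, ‖μ (j + 1) - 1‖ ≤ ‖μ j - 1‖ / 4) ∧
      ∀ j, Tendsto (fun k => μ j ^ (n k)) atTop (𝓝 1) := by
  choose! f hf using h
  let μ : ℕ → ℂ := fun j => Nat.rec (f (δ 0))
    (fun j z => f (min (δ (j + 1)) (‖z - 1‖ / 4))) j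
  have hs : ∀ j, μ (j + 1) = f (min (δ (j + 1)) (‖μ j - 1‖ / 4)) := fun j => rfl
  have hz : μ 0 = f (δ 0) := rfl
  have hne : ∀ j, μ j ≠ 1 := by
    intro j
    induction j with
    | zero => exact (hf _ (hδ 0)).2.1
    | succ j ih =>
      rw [hs]
      have : 0 < ‖μ j - 1‖ := norm_pos_iff.2 (sub_ne_zero.2 ih)
      exact (hf _ (lt_min (hδ _) (by positivity))).2.1
  have hp : ∀ j, 0 < min (δ (j + 1)) (‖μ j - 1‖ / 4) := by
    intro j
    have : 0 < ‖μ j - 1‖ := norm_pos_iff.2 (sub_ne_zero.2 (hne j))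
    exact lt_min (hδ _) (by positivity)
  have hall : ∀ j, ‖μ j‖ = 1 ∧ (∀ k, ‖μ j ^ (n k) - 1‖ ≤ δ j) ∧
      Tendsto (fun k => ‖μ j ^ (n k) - 1‖) atTop (𝓝 0) := by
    intro j
    cases j with
    | zero => rw [hz]; exact ⟨(hf _ (hδ 0)).1, (hf _ (hδ 0)).2.2.1, (hf _ (hδ 0)).2.2.2⟩
    | succ j =>
      rw [hs]
      obtain ⟨h1, _, h3, h4⟩ := hf _ (hp j)
      exact ⟨h1, fun k => (h3 k).trans (min_le_left _ _), h4⟩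
  refine ⟨μ, fun j => (hall j).1, hne, fun j => (hall j).2.1, ?_, ?_⟩
  · intro j
    have := (hf _ (hp j)).2.2.1 0
    rw [h0, pow_one, ← hs] at this
    exact this.trans (min_le_right _ _)
  · intro j
    exact tendsto_iff_norm_sub_tendsto_zero.2 (hall j).2.2

/-- Truncation of a point of the Cantor space. -/
def trunc (x : ℕ → Bool) (j : ℕ) : Finset ℕ := (Finset.range j).filter (fun i => x i = true)

lemma trunc_lt (x : ℕ → Bool) (j : ℕ) : ∀ i ∈ trunc x j, i < j := by
  intro i hi
  simp only [trunc, Finset.mem_filter, Finset.mem_range] at hi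
  exact hi.1

lemma trunc_zero (x : ℕ → Bool) : trunc x 0 = ∅ := by simp [trunc]

lemma trunc_succ (x : ℕ → Bool) (j : ℕ) :
    trunc x (j + 1) = if x j = true then insert j (trunc x j) else trunc x j := by
  simp only [trunc]
  rw [Finset.range_add_one, Finset.filter_insert]

lemma trunc_congr (x y : ℕ → Bool) (j : ℕ) (h : ∀ i < j, x i = y i) : trunc x j = trunc y j := by
  apply Finset.filter_congr
  intro i hi
  rw [h i (Finset.mem_range.1 hi)]

/-- Extension to the Cantor space. -/
lemma exists_extension {V : Type*} [NormedAddCommGroup V] [CompleteSpace V]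
    (F : Finset ℕ → V) (r : ℕ → ℝ) (hr : Summable r)
    (hF : ∀ (j : ℕ) (s : Finset ℕ), (∀ i ∈ s, i < j) → ‖F (insert j s) - F s‖ ≤ r j) :
    ∃ G : (ℕ → Bool) → V, Continuous G ∧
      ∀ x, Tendsto (fun j => F (trunc x j)) atTop (𝓝 (G x)) := by
  have hr0 : ∀ j, 0 ≤ r j := fun j => (norm_nonneg _).trans (hF j ∅ (by simp))
  have hb : ∀ j x, ‖F (trunc x (j + 1)) - F (trunc x j)‖ ≤ r j := by
    intro j x
    rw [trunc_succ]
    split_ifs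
    · exact hF j _ (trunc_lt x j)
    · simpa using hr0 j
  have hcont : ∀ j, Continuous (fun x : ℕ → Bool => F (trunc x j)) := by
    intro j
    apply IsLocallyConstant.continuous
    rw [IsLocallyConstant.iff_eventually_eq]
    intro x
    have : ∀ᶠ y in 𝓝 x, ∀ i ∈ Finset.range j, y i = x i := by
      rw [eventually_all_finset]
      intro i _
      have h1 : Tendsto (fun y : ℕ → Bool => y i) (𝓝 x) (𝓝 (x i)) :=
        (continuous_apply i).tendsto x
      exact h1.eventually (p := fun a => a = x i) (by simp [nhds_discrete])
    filter_upwards [this] with y hy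
    rw [trunc_congr y x j (fun i hi => hy i (Finset.mem_range.2 hi))]
  refine ⟨fun x => F ∅ + ∑' j, (F (trunc x (j + 1)) - F (trunc x j)), ?_, ?_⟩
  · exact continuous_const.add
      (continuous_tsum (fun j => (hcont (j + 1)).sub (hcont j)) hr hb)
  · intro x
    have hs : Summable (fun j => F (trunc x (j + 1)) - F (trunc x j)) :=
      Summable.of_norm_bounded hr (fun j => hb j x)
    have := (hs.hasSum.tendsto_sum_nat).const_add (F ∅)
    refine this.congr ?_
    intro N
    rw [Finset.sum_range_sub (fun j => F (trunc x j)), trunc_zero]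
    abel

/-- The eigenvectors. -/
noncomputable def eigv {H : Type*} [NormedAddCommGroup H] [InnerProductSpace ℂ H]
    (b : Finset ℕ → H) (s : Finset ℕ) : H :=
  b ∅ + ∑ j ∈ s, ((1 / 2 : ℂ) ^ j) • b (s.filter (fun i => i ≤ j))

section
variable {H : Type*} [NormedAddCommGroup H] [InnerProductSpace ℂ H]

lemma eigv_empty (b : Finset ℕ → H) : eigv b ∅ = b ∅ := by simp [eigv]

lemma eigv_insert (b : Finset ℕ → H) (j : ℕ) (s : Finset ℕ) (hs : ∀ i ∈ s, i < j) :
    eigv b (insert j s) = eigv b s + ((1 / 2 : ℂ) ^ j) • b (insert j s) := by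
  have hj : j ∉ s := fun h => lt_irrefl _ (hs j h)
  have h1 : (insert j s).filter (fun i => i ≤ j) = insert j s := by
    apply Finset.filter_true_of_mem
    intro i hi
    rcases Finset.mem_insert.1 hi with rfl | hi
    · exact le_rfl
    · exact (hs i hi).le
  have h2 : ∀ k ∈ s, (insert j s).filter (fun i => i ≤ k) = s.filter (fun i => i ≤ k) := by
    intro k hk
    rw [Finset.filter_insert, if_neg (not_le.2 (hs k hk))]
  simp only [eigv]
  rw [Finset.sum_insert hj, h1, Finset.sum_congr rfl (fun k hk => by rw [h2 k hk])]
  abel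

lemma norm_eigv_le (b : Finset ℕ → H) (hb : ∀ s, ‖b s‖ = 1) (s : Finset ℕ) :
    ‖eigv b s‖ ≤ 3 := by
  have h1 : ‖∑ j ∈ s, ((1 / 2 : ℂ) ^ j) • b (s.filter (fun i => i ≤ j))‖
      ≤ ∑ j ∈ s, (1 / 2 : ℝ) ^ j := by
    apply norm_sum_le_of_le
    intro j _
    rw [norm_smul, hb, mul_one, norm_pow]
    simp
  have h2 : ∑ j ∈ s, (1 / 2 : ℝ) ^ j ≤ 2 := by
    refine le_of_le_of_eq ?_ tsum_geometric_two
    exact summable_geometric_two.sum_le_tsum s (fun i _ => by positivity)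
  calc ‖eigv b s‖ ≤ ‖b ∅‖ + ‖∑ j ∈ s, ((1 / 2 : ℂ) ^ j) • b (s.filter (fun i => i ≤ j))‖ :=
        norm_add_le _ _
    _ ≤ 1 + 2 := add_le_add (hb _).le (h1.trans h2)
    _ = 3 := by norm_num

lemma sup_insert_max (j : ℕ) (s : Finset ℕ) (hs : ∀ i ∈ s, i < j) :
    (insert j s).sup id = j ∧ (insert j s).erase ((insert j s).sup id) = s := by
  have h1 : (insert j s).sup id = j := by
    rw [Finset.sup_insert]
    apply sup_eq_left.2
    apply Finset.sup_le
    intro i hi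
    exact (hs i hi).le
  refine ⟨h1, ?_⟩
  rw [h1]
  exact Finset.erase_insert (fun h => lt_irrefl _ (hs j h))

end

lemma prod_insert_max (μ : ℕ → ℂ) (j : ℕ) (s : Finset ℕ) (hs : ∀ i ∈ s, i < j) :
    ∏ i ∈ insert j s, μ i = μ j * ∏ i ∈ s, μ i :=
  Finset.prod_insert (fun h => lt_irrefl _ (hs j h))

lemma norm_prod_one (μ : ℕ → ℂ) (hμ : ∀ j, ‖μ j‖ = 1) (s : Finset ℕ) :
    ‖∏ i ∈ s, μ i‖ = 1 := by
  rw [norm_prod]; exact Finset.prod_eq_one (fun i _ => hμ i)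

/-- The operators with prescribed eigenvectors, with control of the norm. -/
lemma exists_op {H : Type*} [NormedAddCommGroup H] [InnerProductSpace ℂ H]
    [CompleteSpace H] (b : HilbertBasis (Finset ℕ) ℂ H) (c : Finset ℕ → ℝ) (hc : Summable c)
    (hc0 : ∀ s, 0 < c s) (δ : ℕ → ℝ)
    (hδ : ∀ (j : ℕ) (s : Finset ℕ), (∀ i ∈ s, i < j) → 3 * 2 ^ j * δ j ≤ c (insert j s))
    (ν : ℕ → ℂ) (hν : ∀ j, ‖ν j‖ = 1) (hνδ : ∀ j, ‖ν j - 1‖ ≤ δ j) :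
    ∃ M : H →L[ℂ] H, (∀ s, M (eigv b s) = (∏ i ∈ s, ν i) • eigv b s) ∧
      ‖M‖ ≤ 1 + ∑' s, c s := by
  let L : Finset ℕ → ℂ := fun s => ∏ i ∈ s, ν i
  let p : Finset ℕ → Finset ℕ := fun s => s.erase (s.sup id)
  let u : Finset ℕ → H := fun s => ((2 : ℂ) ^ (s.sup id) * (L s - L (p s))) • eigv b (p s)
  have hp0 : p ∅ = ∅ := by simp [p]
  have hu0 : u ∅ = 0 := by simp [u, hp0]
  have hui : ∀ (j : ℕ) (s : Finset ℕ), (∀ i ∈ s, i < j) →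
      u (insert j s) = ((2 : ℂ) ^ j * ((ν j - 1) * L s)) • eigv b s := by
    intro j s hs
    obtain ⟨h1, h2⟩ := sup_insert_max j s hs
    simp only [u, p, L]
    rw [h2, h1, prod_insert_max ν j s hs]
    congr 2
    ring
  have hL : ∀ s, ‖L s‖ = 1 := norm_prod_one ν hν
  have hun : ∀ s, ‖u s‖ ≤ c s := by
    intro s
    induction s using Finset.induction_on_max with
    | empty => rw [hu0, norm_zero]; exact (hc0 _).le
    | insert j s hs _ =>
      rw [hui j s hs, norm_smul, norm_mul, norm_mul, hL, mul_one, norm_pow]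
      refine le_trans ?_ (hδ j s hs)
      have h3 := norm_eigv_le b b.orthonormal.1 s
      have h4 := hνδ j
      simp only [Complex.norm_ofNat]
      calc (2 : ℝ) ^ j * ‖ν j - 1‖ * ‖eigv b s‖ ≤ 2 ^ j * δ j * 3 := by
            have : 0 ≤ δ j := (norm_nonneg _).trans h4
            gcongr
        _ = 3 * 2 ^ j * δ j := by ring
  obtain ⟨M, hM, hMn⟩ := exists_diag_add b L hL u c hc hun
  refine ⟨M, ?_, hMn⟩
  intro s
  induction s using Finset.induction_on_max with
  | empty => rw [eigv_empty, hM, hu0]; simp [L]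
  | insert j s hs ih =>
    rw [eigv_insert b j s hs, map_add, map_smul, ih, hM, hui j s hs, prod_insert_max ν j s hs]
    simp only [L]
    rw [prod_insert_max ν j s hs]
    have h2 : (1 / 2 : ℂ) ^ j * 2 ^ j = 1 := by rw [← mul_pow]; norm_num
    simp only [smul_add, smul_smul]
    rw [← mul_assoc ((1 / 2 : ℂ) ^ j) (2 ^ j), h2]
    module

/-- Bounded operators which agree on the eigenvectors agree. -/
lemma span_eigv_dense {H : Type*} [NormedAddCommGroup H] [InnerProductSpace ℂ H]
    [CompleteSpace H] (b : HilbertBasis (Finset ℕ) ℂ H) (W : Submodule ℂ H)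
    (hW : IsClosed (W : Set H)) (h : ∀ s, eigv b s ∈ W) : W = ⊤ := by
  have hb : ∀ s, b s ∈ W := by
    intro s
    induction s using Finset.induction_on_max with
    | empty => rw [← eigv_empty (b : Finset ℕ → H)]; exact h ∅
    | insert j s hs _ =>
      have h1 := W.sub_mem (h (insert j s)) (h s)
      rw [eigv_insert b j s hs, add_sub_cancel_left] at h1
      have h2 := W.smul_mem ((2 : ℂ) ^ j) h1
      rw [smul_smul, ← mul_pow] at h2
      norm_num at h2
      exact h2
  rw [eq_top_iff, ← b.dense_span]
  apply Submodule.topologicalClosure_minimal _ _ hW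
  rw [Submodule.span_le]
  rintro _ ⟨s, rfl⟩
  exact hb s

lemma lambda_injective (μ : ℕ → ℂ) (hμ : ∀ j, ‖μ j‖ = 1) (hne : ∀ j, μ j ≠ 1)
    (h4 : ∀ j, ‖μ (j + 1) - 1‖ ≤ ‖μ j - 1‖ / 4) (G : (ℕ → Bool) → ℂ)
    (hG : ∀ x, Tendsto (fun j => ∏ i ∈ trunc x j, μ i) atTop (𝓝 (G x))) :
    Function.Injective G := by
  have hstep : ∀ x j, ‖(∏ i ∈ trunc x (j + 1), μ i) - ∏ i ∈ trunc x j, μ i‖ ≤ ‖μ j - 1‖ := by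
    intro x j
    rw [trunc_succ]
    split_ifs
    · rw [prod_insert_max μ j _ (trunc_lt x j), ← sub_one_mul, norm_mul, norm_prod_one μ hμ,
        mul_one]
    · simp
  have htail : ∀ x j N, ‖(∏ i ∈ trunc x (j + 1 + N), μ i) - ∏ i ∈ trunc x (j + 1), μ i‖ ≤
      ‖μ j - 1‖ / 3 - ‖μ (j + N) - 1‖ / 3 := by
    intro x j N
    induction N with
    | zero => simp
    | succ N ih =>
      have h1 := hstep x (j + 1 + N)
      have h2 := h4 (j + N)
      have h3 : j + 1 + N = j + N + 1 := by ring
      have h5 := norm_sub_le_norm_sub_add_norm_sub (∏ i ∈ trunc x (j + 1 + N + 1), μ i)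
        (∏ i ∈ trunc x (j + 1 + N), μ i) (∏ i ∈ trunc x (j + 1), μ i)
      rw [← add_assoc, ← add_assoc]
      rw [h3] at h1 h5 ih ⊢
      linarith
  have hlim : ∀ x j, ‖G x - ∏ i ∈ trunc x (j + 1), μ i‖ ≤ ‖μ j - 1‖ / 3 := by
    intro x j
    have h1 : Tendsto (fun N => ‖(∏ i ∈ trunc x (j + 1 + N), μ i)
        - ∏ i ∈ trunc x (j + 1), μ i‖) atTop (𝓝 ‖G x - ∏ i ∈ trunc x (j + 1), μ i‖) := by
      refine (((hG x).comp ?_).sub_const _).norm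
      exact tendsto_add_atTop_nat (j + 1) |>.congr (fun N => by ring)
    refine le_of_tendsto' h1 (fun N => (htail x j N).trans ?_)
    have := norm_nonneg (μ (j + N) - 1)
    linarith
  have key : ∀ x y j, (∀ i < j, x i = y i) → x j = true → y j = false → G x ≠ G y := by
    intro x y j hxy hx hy heq
    have h1 := hlim x j
    have h2 := hlim y j
    rw [trunc_succ, if_pos hx, prod_insert_max μ j _ (trunc_lt x j)] at h1
    rw [trunc_succ, if_neg (by simp [hy]), ← trunc_congr x y j hxy, ← heq] at h2
    have h3 : ‖μ j - 1‖ = ‖(G x - ∏ i ∈ trunc x j, μ i) - (G x - μ j * ∏ i ∈ trunc x j, μ i)‖ := by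
      have : (G x - ∏ i ∈ trunc x j, μ i) - (G x - μ j * ∏ i ∈ trunc x j, μ i)
          = (μ j - 1) * ∏ i ∈ trunc x j, μ i := by ring
      rw [this, norm_mul, norm_prod_one μ hμ, mul_one]
    have h5 := norm_sub_le (G x - ∏ i ∈ trunc x j, μ i) (G x - μ j * ∏ i ∈ trunc x j, μ i)
    have h6 : 0 < ‖μ j - 1‖ := norm_pos_iff.2 (sub_ne_zero.2 (hne j))
    linarith
  intro x y hxy
  by_contra hne'
  have hex : ∃ j, x j ≠ y j := by
    by_contra! hall
    exact hne' (funext hall)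
  classical
  have hmin : ∀ i < Nat.find hex, x i = y i := fun i hi => not_not.1 (Nat.find_min hex hi)
  have hj := Nat.find_spec hex
  cases hx : x (Nat.find hex) <;> cases hy : y (Nat.find hex)
  · exact hj (hx.trans hy.symm)
  · exact key y x _ (fun i hi => (hmin i hi).symm) hy hx hxy.symm
  · exact key x y _ hmin hx hy hxy
  · exact hj (hx.trans hy.symm)

/-- The abstract version of the theorem. -/
lemma exists_of_hilbertBasis {H : Type*} [NormedAddCommGroup H] [InnerProductSpace ℂ H]
    [CompleteSpace H] (b : HilbertBasis (Finset ℕ) ℂ H)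
    (n : ℕ → ℕ) (h0 : n 0 = 1)
    (h : ∀ ε > (0 : ℝ), ∃ z : ℂ, ‖z‖ = 1 ∧ z ≠ 1 ∧ (∀ k, ‖z ^ (n k) - 1‖ ≤ ε) ∧
      Tendsto (fun k => ‖z ^ (n k) - 1‖) atTop (𝓝 0)) :
    ∃ T : H →L[ℂ] H, PerfectlySpanning T ∧
      ∀ x : H, Tendsto (fun k => (T ^ (n k)) x) atTop (𝓝 x) := by
  obtain ⟨c, hc0, C, hcC, -⟩ := posSumOfEncodable (zero_lt_one' ℝ) (Finset ℕ)
  have hc : Summable c := hcC.summable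
  have hδex : ∀ j : ℕ, ∃ δ : ℝ, 0 < δ ∧ ∀ s : Finset ℕ, (∀ i ∈ s, i < j) →
      3 * 2 ^ j * δ ≤ c (insert j s) := by
    intro j
    obtain ⟨s0, hs0, hmin⟩ := Finset.exists_min_image (Finset.range j).powerset
      (fun s => c (insert j s)) ⟨∅, by simp⟩
    refine ⟨c (insert j s0) / (3 * 2 ^ j), div_pos (hc0 _) (by positivity), ?_⟩
    intro s hs
    rw [mul_div_cancel₀ _ (by positivity)]
    exact hmin s (Finset.mem_powerset.2 (fun i hi => Finset.mem_range.2 (hs i hi)))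
  choose δ hδ0 hδ using hδex
  obtain ⟨μ, hμ, hne, hμδ, h4, hlim⟩ := exists_mu n h0 h δ hδ0
  have hop : ∀ k, ∃ M : H →L[ℂ] H,
      (∀ s, M (eigv b s) = (∏ i ∈ s, μ i ^ (n k)) • eigv b s) ∧ ‖M‖ ≤ 1 + ∑' s, c s := by
    intro k
    exact exists_op b c hc hc0 δ hδ (fun j => μ j ^ (n k)) (fun j => by simp [hμ])
      (fun j => hμδ j k)
  choose M hM hMn using hop
  let T := M 0
  have hT : ∀ s, T (eigv b s) = (∏ i ∈ s, μ i) • eigv b s := by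
    intro s
    have := hM 0 s
    simpa [h0] using this
  have hTpow : ∀ m s, (T ^ m) (eigv b s) = (∏ i ∈ s, μ i) ^ m • eigv b s := by
    intro m s
    induction m with
    | zero => simp
    | succ m ih =>
      rw [pow_succ', mul_apply_eq_comp, ih, map_smul, hT, smul_smul, pow_succ]
  have hTM : ∀ k, T ^ (n k) = M k := by
    intro k
    have h1 : LinearMap.ker ((T ^ (n k) - M k : H →L[ℂ] H) : H →ₗ[ℂ] H) = ⊤ := by
      apply span_eigv_dense b _ (T ^ (n k) - M k).isClosed_ker
      intro s
      rw [LinearMap.mem_ker]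
      change (T ^ (n k) - M k) (eigv b s) = 0
      rw [sub_apply, hTpow, hM, Finset.prod_pow, sub_self]
    ext x
    have h2 : x ∈ LinearMap.ker ((T ^ (n k) - M k : H →L[ℂ] H) : H →ₗ[ℂ] H) := by
      rw [h1]; trivial
    rw [LinearMap.mem_ker] at h2
    exact sub_eq_zero.1 h2
  refine ⟨T, ?_, ?_⟩
  · -- perfectly spanning
    have hr : ∀ j, ‖μ j - 1‖ ≤ 2 * (1 / 4 : ℝ) ^ j := by
      intro j
      induction j with
      | zero =>
        have := norm_sub_le (μ 0) 1
        rw [hμ 0, norm_one] at this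
        norm_num at this ⊢
        exact this
      | succ j ih =>
        have := h4 j
        rw [pow_succ]
        linarith
    obtain ⟨G, hGc, hG⟩ := exists_extension (fun s => ∏ i ∈ s, μ i)
      (fun j => 2 * (1 / 4 : ℝ) ^ j)
      ((summable_geometric_of_lt_one (by norm_num) (by norm_num)).mul_left 2)
      (by
        intro j s hs
        rw [prod_insert_max μ j s hs, ← sub_one_mul, norm_mul, norm_prod_one μ hμ, mul_one]
        exact hr j)
    obtain ⟨E, hEc, hE⟩ := exists_extension (eigv b) (fun j => (1 / 2 : ℝ) ^ j)
      summable_geometric_two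
      (by
        intro j s hs
        rw [eigv_insert b j s hs, add_sub_cancel_left, norm_smul, b.orthonormal.1, norm_pow]
        simp)
    have hTE : ∀ x, T (E x) = G x • E x := by
      intro x
      have h1 : Tendsto (fun j => T (eigv b (trunc x j))) atTop (𝓝 (T (E x))) :=
        (T.continuous.tendsto _).comp (hE x)
      have h2 := (hG x).smul (hE x)
      refine tendsto_nhds_unique h1 (h2.congr ?_)
      intro j
      rw [hT]
    have hEs : ∀ s, ∃ x, E x = eigv b s := by
      intro s
      refine ⟨fun i => decide (i ∈ s), ?_⟩
      refine tendsto_nhds_unique (hE _) ?_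
      apply tendsto_const_nhds.congr'
      filter_upwards [eventually_ge_atTop (s.sup id + 1)] with j hj
      congr 1
      ext i
      simp only [trunc, Finset.mem_filter, Finset.mem_range, decide_eq_true_eq]
      constructor
      · intro hi
        have : i ≤ s.sup id := Finset.le_sup (f := id) hi
        exact ⟨by omega, hi⟩
      · exact fun hi => hi.2
    have hGn : ∀ x, ‖G x‖ = 1 := by
      intro x
      refine tendsto_nhds_unique (hG x).norm ?_
      simp only [norm_prod_one μ hμ]
      exact tendsto_const_nhds
    have hinj := lambda_injective μ hμ hne h4 G hG
    obtain ⟨ν, hνp, hνa, hνo⟩ := exists_cantor_measure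
    have hGm : Measurable G := hGc.measurable
    refine ⟨ν.map G, Measure.isProbabilityMeasure_map hGm.aemeasurable, ?_, ?_, ?_⟩
    · have hcl : MeasurableSet {z : ℂ | ‖z‖ = 1}ᶜ :=
        (isClosed_eq continuous_norm continuous_const).measurableSet.compl
      rw [Measure.map_apply hGm hcl]
      have : G ⁻¹' {z : ℂ | ‖z‖ = 1}ᶜ = ∅ := by
        ext x; simp [hGn]
      rw [this, measure_empty]
    · intro z
      rw [Measure.map_apply hGm (measurableSet_singleton z)]
      have hsub : (G ⁻¹' {z}).Subsingleton := by
        intro x hx y hy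
        exact hinj ((show G x = z from hx).trans (show G y = z from hy).symm)
      rcases hsub.eq_empty_or_singleton with h1 | ⟨x, h1⟩
      · rw [h1, measure_empty]
      · rw [h1, hνa]
    · intro B hB _ hσ
      rw [Measure.map_apply hGm hB] at hσ
      have hdense : Dense (G ⁻¹' B) := by
        have h1 : ν (G ⁻¹' B)ᶜ = 0 := by
          rw [prob_compl_eq_zero_iff (hGm hB)]; exact hσ
        rw [dense_iff_inter_open]
        intro U hU hUne
        by_contra hemp
        rw [Set.not_nonempty_iff_eq_empty] at hemp
        apply hνo U hU hUne
        apply measure_mono_null _ h1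
        intro x hx hxB
        have : x ∈ U ∩ G ⁻¹' B := ⟨hx, hxB⟩
        rw [hemp] at this
        exact this
      set W := (⨆ z ∈ B, Module.End.eigenspace (T : H →ₗ[ℂ] H) z).topologicalClosure with hW
      have hWc : IsClosed (W : Set H) := Submodule.isClosed_topologicalClosure _
      apply span_eigv_dense b W hWc
      have hall : ∀ x, E x ∈ W := by
        intro x
        have hcl : IsClosed (E ⁻¹' (W : Set H)) := hWc.preimage hEc
        have hsub : G ⁻¹' B ⊆ E ⁻¹' (W : Set H) := by
          intro y hy
          apply Submodule.le_topologicalClosure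
          have hle : Module.End.eigenspace (T : H →ₗ[ℂ] H) (G y) ≤
              ⨆ z ∈ B, Module.End.eigenspace (T : H →ₗ[ℂ] H) z :=
            le_iSup₂_of_le (G y) hy le_rfl
          apply hle
          rw [Module.End.mem_eigenspace_iff]
          exact hTE y
        have := hcl.closure_subset_iff.2 hsub
        rw [hdense.closure_eq] at this
        exact this (Set.mem_univ x)
      intro s
      obtain ⟨x, hx⟩ := hEs s
      rw [← hx]
      exact hall x
  · -- rigidity
    have hCpos : 0 < 1 + ∑' s, c s := by
      have : 0 ≤ ∑' s, c s := tsum_nonneg (fun s => (hc0 s).le)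
      linarith
    set K := 1 + ∑' s, c s with hK
    let W : Submodule ℂ H :=
      { carrier := {x | Tendsto (fun k => (T ^ (n k)) x) atTop (𝓝 x)}
        add_mem' := by
          intro x y hx hy
          have := Tendsto.add hx hy
          simpa only [Set.mem_ofPred_eq, map_add] using this
        zero_mem' := by simp
        smul_mem' := by
          intro a x hx
          have := Tendsto.const_smul hx a
          simpa only [Set.mem_ofPred_eq, map_smul] using this }
    have hWc : IsClosed (W : Set H) := by
      rw [← closure_subset_iff_isClosed]
      intro x hx
      change Tendsto (fun k => (T ^ (n k)) x) atTop (𝓝 x)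
      rw [Metric.tendsto_atTop]
      intro ε hε
      obtain ⟨y, hy, hxy⟩ := Metric.mem_closure_iff.1 hx (ε / (2 * (K + 1))) (by positivity)
      have hy' : Tendsto (fun k => (T ^ (n k)) y) atTop (𝓝 y) := hy
      obtain ⟨N, hN⟩ := Metric.tendsto_atTop.1 hy' (ε / 2) (by positivity)
      refine ⟨N, fun k hk => ?_⟩
      have h1 := hN k hk
      have h2 : dist ((T ^ (n k)) x) ((T ^ (n k)) y) ≤ K * dist x y := by
        rw [dist_eq_norm, dist_eq_norm, ← map_sub, hTM]
        exact (M k).le_of_opNorm_le (hMn k) _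
      have h3 : dist ((T ^ (n k)) x) x ≤ dist ((T ^ (n k)) x) ((T ^ (n k)) y)
          + dist ((T ^ (n k)) y) y + dist y x := dist_triangle4 _ _ _ _
      rw [dist_comm y x] at h3
      rw [lt_div_iff₀ (by positivity)] at hxy
      linarith
    have hWtop : W = ⊤ := by
      apply span_eigv_dense b W hWc
      intro s
      change Tendsto (fun k => (T ^ (n k)) (eigv b s)) atTop (𝓝 (eigv b s))
      simp only [hTpow, ← Finset.prod_pow]
      have h1 : Tendsto (fun k => ∏ i ∈ s, μ i ^ (n k)) atTop (𝓝 (∏ i ∈ s, (1 : ℂ))) :=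
        tendsto_finsetProd _ (fun i _ => hlim i)
      rw [Finset.prod_const_one] at h1
      have h2 := h1.smul_const (eigv b s)
      rwa [one_smul] at h2
    intro x
    have : x ∈ W := by rw [hWtop]; trivial
    exact this

/-- Theorem 4.2 (Theorem 2ter): if for every `ε > 0` there is a unimodular `λ ≠ 1` with
`sup_k |λ^{n_k} - 1| ≤ ε` and `|λ^{n_k} - 1| → 0`, then there is a bounded operator on
`ℓ²(ℕ)` with perfectly spanning unimodular eigenvectors which is topologically rigid with
respect to `(n_k)`, i.e. `T^{n_k} x → x` for every `x`. -/
theorem exists_perfectlySpanning_topologically_rigid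
    (n : ℕ → ℕ) (hmono : StrictMono n) (hpos : ∀ k, 0 < n k) (h0 : n 0 = 1)
    (h : ∀ ε > (0 : ℝ), ∃ z : ℂ, ‖z‖ = 1 ∧ z ≠ 1 ∧ (∀ k, ‖z ^ (n k) - 1‖ ≤ ε) ∧
      Tendsto (fun k => ‖z ^ (n k) - 1‖) atTop (𝓝 0)) :
    ∃ T : (lp (fun _ : ℕ => ℂ) 2) →L[ℂ] (lp (fun _ : ℕ => ℂ) 2),
      PerfectlySpanning T ∧
      ∀ x : lp (fun _ : ℕ => ℂ) 2, Tendsto (fun k => (T ^ (n k)) x) atTop (𝓝 x) := by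
  classical
  let e : Finset ℕ ≃ ℕ := Denumerable.eqv (Finset ℕ)
  let b0 : HilbertBasis ℕ ℂ (lp (fun _ : ℕ => ℂ) 2) := ⟨LinearIsometryEquiv.refl ℂ _⟩
  have hsp : ⊤ ≤ (Submodule.span ℂ (Set.range (b0 ∘ e))).topologicalClosure := by
    rw [e.surjective.range_comp, b0.dense_span]
  exact exists_of_hilbertBasis
    (HilbertBasis.mk (b0.orthonormal.comp e e.injective) hsp) n h0 h
end

section
/- Let (n_k)_{k≥0} be a strictly increasing sequence of positive integers. The following assertions are equivalent: (1) there exists an uncountable subset K of 𝕋 such that λ^{n_k} tends to 1 uniformly on K, i.e. sup_{λ∈K} |λ^{n_k} − 1| → 0 as k → ∞; (2) there exists a separable complex Banach space X and a bounded linear operator T on X such that the set of unimodular eigenvalues σ_p(T) ∩ 𝕋 is uncountable and ‖T^{n_k} − I‖ → 0 as k → ∞. -/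
open Filter Topology

/-- Choice of normalising constants. -/
lemma exists_eps (n : ℕ → ℕ) (K : Set ℂ) (hK : K ⊆ {z : ℂ | ‖z‖ = 1})
    (h : TendstoUniformlyOn (fun k (z : ℂ) => z ^ (n k)) (fun _ => 1) atTop K) :
    ∃ (e c : ℕ → ℝ), (∀ k, 0 < e k) ∧ Tendsto e atTop (𝓝 0) ∧ Tendsto c atTop (𝓝 0) ∧
      (∀ k, c k ≤ 1 / 2) ∧ ∀ k, ∀ z ∈ K, ‖z ^ (n k) - 1‖ ≤ c k * e k := by
  set η : ℕ → ℝ := fun k => ⨆ z : K, ‖(z : ℂ) ^ (n k) - 1‖ with hη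
  have hb : ∀ k (z : K), ‖(z : ℂ) ^ (n k) - 1‖ ≤ 2 := by
    intro k z
    have h1 : ‖(z : ℂ)‖ = 1 := hK z.2
    calc _ ≤ ‖(z : ℂ) ^ (n k)‖ + ‖(1 : ℂ)‖ := norm_sub_le _ _
      _ = 2 := by rw [norm_pow, h1]; norm_num
  have hbdd : ∀ k, BddAbove (Set.range fun z : K => ‖(z : ℂ) ^ (n k) - 1‖) := by
    intro k
    refine ⟨2, ?_⟩
    rintro _ ⟨z, rfl⟩
    exact hb k z
  have hη0 : ∀ k, 0 ≤ η k := fun k => Real.iSup_nonneg fun z => norm_nonneg _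
  have hη2 : ∀ k, η k ≤ 2 := fun k => Real.iSup_le (hb k) (by norm_num)
  have hηz : ∀ k, ∀ z ∈ K, ‖z ^ (n k) - 1‖ ≤ η k := fun k z hz =>
    le_ciSup (hbdd k) ⟨z, hz⟩
  have hηt : Tendsto η atTop (𝓝 0) := by
    rw [Metric.tendsto_atTop']
    intro ε hε
    rw [Metric.tendstoUniformlyOn_iff] at h
    obtain ⟨N, hN⟩ := eventually_atTop.1 (h (ε / 2) (by positivity))
    refine ⟨N, fun k hk => ?_⟩
    rw [Real.dist_eq, sub_zero, abs_of_nonneg (hη0 k)]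
    have : η k ≤ ε / 2 := Real.iSup_le (fun z => by
      have := hN k hk.le z z.2
      rw [dist_comm, dist_eq_norm] at this
      exact this.le) (by positivity)
    linarith
  have hs : Tendsto (fun k => √(η k)) atTop (𝓝 0) := by
    simpa using hηt.sqrt
  refine ⟨fun k => 4 * √(η k) + 1 / ((k : ℝ) + 1), fun k => √(η k) / 4, fun k => by positivity,
    ?_, ?_, fun k => ?_, fun k z hz => (hηz k z hz).trans ?_⟩
  · simpa using (hs.const_mul 4).add tendsto_one_div_add_atTop_nhds_zero_nat
  · simpa using hs.div_const 4
  · have : √(η k) ≤ 2 := by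
      rw [Real.sqrt_le_left (by norm_num)]
      linarith [hη2 k]
    show √(η k) / 4 ≤ 1 / 2
    linarith
  · have h1 := Real.mul_self_sqrt (hη0 k)
    have h2 : 0 ≤ √(η k) / 4 * (1 / ((k : ℝ) + 1)) := by positivity
    show η k ≤ √(η k) / 4 * (4 * √(η k) + 1 / ((k : ℝ) + 1))
    nlinarith

/-- index set -/
abbrev Idx : Type := FreeMonoid ℕ
instance : TopologicalSpace Idx := ⊥
instance : DiscreteTopology Idx := ⟨rfl⟩

open BoundedContinuousFunction in
/-- composition with a self-map of the index set -/
noncomputable def shiftOp (a : ℕ) : (Idx →ᵇ ℂ) →L[ℂ] (Idx →ᵇ ℂ) :=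
  LinearMap.mkContinuous
    { toFun := fun x => x.compContinuous ⟨fun l => FreeMonoid.of a * l, continuous_of_discreteTopology⟩
      map_add' := fun x y => by ext; rfl
      map_smul' := fun c x => by ext; rfl } 1 (by
    intro x
    rw [one_mul]
    exact (norm_le (norm_nonneg _)).2 fun l => x.norm_coe_le_norm _)

lemma shiftOp_apply (a : ℕ) (x : BoundedContinuousFunction Idx ℂ) (l : Idx) :
    shiftOp a x l = x (FreeMonoid.of a * l) := rfl

lemma shiftOp_norm (a : ℕ) (x : BoundedContinuousFunction Idx ℂ) : ‖shiftOp a x‖ ≤ ‖x‖ :=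
  (BoundedContinuousFunction.norm_le (norm_nonneg _)).2 fun l => x.norm_coe_le_norm _

/-- the multiplicative extension of a sequence of scalars -/
noncomputable def multExt (u : ℕ → ℂ) : Idx →* ℂ := FreeMonoid.lift u

lemma ext_le (u : ℕ → ℂ) (hu : ∀ a, ‖u a‖ ≤ 1 / 2) (l : Idx) : ‖multExt u l‖ ≤ 1 := by
  induction l using FreeMonoid.inductionOn' with
  | one => simp
  | of_mul a l ih =>
    rw [map_mul, norm_mul, multExt, FreeMonoid.lift_eval_of]
    rw [multExt] at ih
    nlinarith [hu a, norm_nonneg (u a), norm_nonneg (FreeMonoid.lift u l)]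

lemma ext_sub_le (u v : ℕ → ℂ) (hu : ∀ a, ‖u a‖ ≤ 1 / 2) (hv : ∀ a, ‖v a‖ ≤ 1 / 2) (D : ℝ)
    (hD : ∀ a, ‖u a - v a‖ ≤ D) (l : Idx) : ‖multExt u l - multExt v l‖ ≤ 2 * D := by
  have hD0 : 0 ≤ D := (norm_nonneg _).trans (hD 0)
  induction l using FreeMonoid.inductionOn' with
  | one => simpa
  | of_mul a l ih =>
    have h1 := ext_le u hu l
    have e1 : ∀ w : ℕ → ℂ, multExt w (FreeMonoid.of a * l) = w a * multExt w l := fun w => by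
      rw [map_mul]; simp [multExt]
    rw [e1, e1]
    calc ‖u a * multExt u l - v a * multExt v l‖
        = ‖(u a - v a) * multExt u l + v a * (multExt u l - multExt v l)‖ := by ring_nf
      _ ≤ ‖u a - v a‖ * ‖multExt u l‖ + ‖v a‖ * ‖multExt u l - multExt v l‖ := by
        refine (norm_add_le _ _).trans ?_
        rw [norm_mul, norm_mul]
      _ ≤ D * 1 + 1 / 2 * (2 * D) := by
        gcongr
        · exact hD a
        · exact hv a
      _ = 2 * D := by ring

/-- evaluation vector -/
noncomputable def evalVec (u : ℕ → ℂ) (hu : ∀ a, ‖u a‖ ≤ 1 / 2) : BoundedContinuousFunction Idx ℂ :=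
  BoundedContinuousFunction.ofNormedAddCommGroup (multExt u) continuous_of_discreteTopology 1
    (ext_le u hu)

lemma shiftOp_evalVec (u : ℕ → ℂ) (hu : ∀ a, ‖u a‖ ≤ 1 / 2) (a : ℕ) :
    shiftOp a (evalVec u hu) = u a • evalVec u hu := by
  ext l
  rw [shiftOp_apply]
  show multExt u (FreeMonoid.of a * l) = u a * multExt u l
  rw [map_mul]; simp [multExt]

lemma evalVec_ne (u : ℕ → ℂ) (hu : ∀ a, ‖u a‖ ≤ 1 / 2) : evalVec u hu ≠ 0 := by
  intro h
  have : evalVec u hu 1 = 0 := by rw [h]; rfl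
  have h2 : evalVec u hu 1 = 1 := map_one (multExt u)
  rw [h2] at this
  exact one_ne_zero this

lemma evalVec_continuous {A : Type*} [TopologicalSpace A] (u : A → ℕ → ℂ)
    (hu : ∀ z a, ‖u z a‖ ≤ 1 / 2) (hc : ∀ a, Continuous fun z => u z a) (c : ℕ → ℝ)
    (hct : Tendsto c atTop (𝓝 0)) (huc : ∀ z a, ‖u z a‖ ≤ c a) :
    Continuous fun z => evalVec (u z) (hu z) := by
  rw [continuous_iff_continuousAt]
  intro w
  rw [ContinuousAt, Metric.tendsto_nhds]
  intro ε hε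
  obtain ⟨N, hN⟩ := eventually_atTop.1 (hct.eventually_lt_const (show 0 < ε / 8 by positivity))
  have h1 : ∀ᶠ z in 𝓝 w, ∀ a ∈ Finset.range N, ‖u z a - u w a‖ < ε / 4 := by
    rw [Filter.eventually_all_finset]
    intro a _
    have := Metric.tendsto_nhds.1 ((hc a).tendsto w) (ε / 4) (by positivity)
    simpa [dist_eq_norm] using this
  filter_upwards [h1] with z hz
  have hD : ∀ a, ‖u z a - u w a‖ ≤ ε / 4 := by
    intro a
    by_cases ha : a < N
    · exact (hz a (Finset.mem_range.2 ha)).le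
    · have := hN a (not_lt.1 ha)
      linarith [norm_sub_le (u z a) (u w a), huc z a, huc w a]
  refine lt_of_le_of_lt (b := 2 * (ε / 4)) ?_ (by linarith)
  refine (BoundedContinuousFunction.dist_le (by positivity)).2 fun l => ?_
  rw [dist_eq_norm]
  exact ext_sub_le _ _ (hu z) (hu w) _ hD l

/-- Theorem 1.5, equivalence (1) ⟺ (2): for a strictly increasing sequence of positive
integers, the existence of an uncountable subset `K` of the unit circle on which
`λ^{n_k} → 1` uniformly is equivalent to the existence of a bounded operator on a
separable complex Banach space whose set of unimodular eigenvalues is uncountable and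
with `‖T^{n_k} - I‖ → 0`. -/
theorem uniform_rigidity_characterization
    (n : ℕ → ℕ) (hmono : StrictMono n) (hpos : ∀ k, 0 < n k) :
    (∃ K : Set ℂ, K ⊆ {z : ℂ | ‖z‖ = 1} ∧ ¬ K.Countable ∧
      TendstoUniformlyOn (fun k (z : ℂ) => z ^ (n k)) (fun _ => 1) atTop K)
    ↔
    (∃ (X : Type) (_ : NormedAddCommGroup X) (_ : NormedSpace ℂ X) (_ : CompleteSpace X)
      (_ : TopologicalSpace.SeparableSpace X) (T : X →L[ℂ] X),
      ¬ {z : ℂ | ‖z‖ = 1 ∧ Module.End.HasEigenvalue (T : X →ₗ[ℂ] X) z}.Countable ∧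
      Tendsto (fun k => ‖T ^ (n k) - 1‖) atTop (𝓝 0)) := by
  constructor
  · rintro ⟨K, hK, hKc, hu⟩
    obtain ⟨e, c, he, het, hct, hc2, hcz⟩ := exists_eps n K hK hu
    let u : K → ℕ → ℂ := fun z a => Nat.casesOn a ((z : ℂ) / 2) fun k => ((z : ℂ) ^ n k - 1) / e k
    let c' : ℕ → ℝ := fun a => Nat.casesOn a (1 / 2) c
    have hc' : Tendsto c' atTop (𝓝 0) := (tendsto_add_atTop_iff_nat 1).1 hct
    have huc : ∀ z a, ‖u z a‖ ≤ c' a := by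
      intro z a
      cases a with
      | zero =>
        have : ‖(z : ℂ)‖ = 1 := hK z.2
        show ‖(z : ℂ) / 2‖ ≤ 1 / 2
        rw [norm_div, this]; norm_num
      | succ k =>
        show ‖((z : ℂ) ^ n k - 1) / e k‖ ≤ c k
        rw [norm_div, Complex.norm_real, Real.norm_of_nonneg (he k).le, div_le_iff₀ (he k)]
        exact hcz k z z.2
    have hub : ∀ z a, ‖u z a‖ ≤ 1 / 2 := by
      intro z a
      refine (huc z a).trans ?_
      cases a with
      | zero => exact le_rfl
      | succ k => exact hc2 k
    have huc0 : ∀ a, Continuous fun z => u z a := by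
      intro a
      cases a with
      | zero => show Continuous fun z : K => (z : ℂ) / 2; fun_prop
      | succ k => show Continuous fun z : K => ((z : ℂ) ^ n k - 1) / e k; fun_prop
    let δ : K → BoundedContinuousFunction Idx ℂ := fun z => evalVec (u z) (hub z)
    have hδ : Continuous δ := evalVec_continuous u hub huc0 c' hc' huc
    let X : Submodule ℂ (BoundedContinuousFunction Idx ℂ) :=
      (Submodule.span ℂ (Set.range δ)).topologicalClosure
    have hXc : IsClosed (X : Set (BoundedContinuousFunction Idx ℂ)) :=
      Submodule.isClosed_topologicalClosure _
    have hδX : ∀ z, δ z ∈ X := fun z =>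
      Submodule.le_topologicalClosure _ (Submodule.subset_span ⟨z, rfl⟩)
    have hsep : TopologicalSpace.SeparableSpace X := by
      have : TopologicalSpace.IsSeparable (X : Set (BoundedContinuousFunction Idx ℂ)) := by
        rw [Submodule.topologicalClosure_coe]
        exact ((TopologicalSpace.isSeparable_range hδ).span (R := ℂ)).closure
      exact this.separableSpace
    let S : BoundedContinuousFunction Idx ℂ →L[ℂ] BoundedContinuousFunction Idx ℂ :=
      (2 : ℂ) • shiftOp 0
    have hS : ∀ z, S (δ z) = (z : ℂ) • δ z := by
      intro z
      show (2 : ℂ) • shiftOp 0 (δ z) = _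
      rw [shiftOp_evalVec, smul_smul]
      congr 1
      show 2 * ((z : ℂ) / 2) = z
      ring
    have hSX : ∀ x ∈ X, S x ∈ X := by
      have : X ≤ X.comap (S : _ →ₗ[ℂ] _) := by
        refine Submodule.topologicalClosure_minimal _ ?_ (hXc.preimage S.continuous)
        rw [Submodule.span_le]
        rintro _ ⟨z, rfl⟩
        show S (δ z) ∈ X
        rw [hS]
        exact X.smul_mem _ (hδX z)
      exact this
    have hSp : ∀ z m, (S ^ m) (δ z) = (z : ℂ) ^ m • δ z := by
      intro z m
      induction m with
      | zero => simp
      | succ m ih => rw [pow_succ, mul_apply_eq_comp, hS, map_smul, ih, smul_smul, pow_succ']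
    have hrel : ∀ k, ∀ x ∈ X, (S ^ n k - 1) x = (e k : ℂ) • shiftOp (k + 1) x := by
      intro k
      have : X ≤ LinearMap.ker (((S ^ n k - 1) - (e k : ℂ) • shiftOp (k + 1) :
          BoundedContinuousFunction Idx ℂ →L[ℂ] BoundedContinuousFunction Idx ℂ) :
          BoundedContinuousFunction Idx ℂ →ₗ[ℂ] BoundedContinuousFunction Idx ℂ) := by
        refine Submodule.topologicalClosure_minimal _ ?_ (ContinuousLinearMap.isClosed_ker _)
        rw [Submodule.span_le]
        rintro _ ⟨z, rfl⟩
        show (S ^ n k) (δ z) - δ z - (e k : ℂ) • shiftOp (k + 1) (δ z) = 0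
        rw [hSp, shiftOp_evalVec, smul_smul]
        have h0 : (e k : ℂ) ≠ 0 := by exact_mod_cast (he k).ne'
        have : (e k : ℂ) * u z (k + 1) = (z : ℂ) ^ n k - 1 := by
          show (e k : ℂ) * (((z : ℂ) ^ n k - 1) / e k) = _
          field_simp
        rw [this, sub_smul, one_smul, sub_self]
      intro x hx
      exact sub_eq_zero.1 (this hx)
    let T : X →L[ℂ] X := (S.comp X.subtypeL).codRestrict X fun x => hSX x x.2
    have hT : ∀ x : X, (T x : BoundedContinuousFunction Idx ℂ) = S x := fun x => rfl
    have hTp : ∀ m (x : X), ((T ^ m) x : BoundedContinuousFunction Idx ℂ) = (S ^ m) x := by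
      intro m
      induction m with
      | zero => intro x; rfl
      | succ m ih => intro x; rw [pow_succ, mul_apply_eq_comp, ih, hT, pow_succ]; rfl
    refine ⟨X, inferInstance, inferInstance, hXc.completeSpace_coe, hsep, T, ?_, ?_⟩
    · intro hcount
      refine hKc (Set.Countable.mono (fun z hz => ?_) hcount)
      refine ⟨hK hz, ?_⟩
      refine Module.End.hasEigenvalue_of_hasEigenvector (x := (⟨δ ⟨z, hz⟩, hδX _⟩ : X)) ⟨?_, ?_⟩
      · rw [Module.End.mem_eigenspace_iff]
        exact Subtype.ext (hS ⟨z, hz⟩)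
      · intro h0
        exact evalVec_ne _ (hub ⟨z, hz⟩) (congrArg Subtype.val h0)
    · refine squeeze_zero (fun k => norm_nonneg _) (fun k => ?_) het
      refine ContinuousLinearMap.opNorm_le_bound _ (he k).le fun x => ?_
      have h1 : (((T ^ n k - 1) x : X) : BoundedContinuousFunction Idx ℂ)
          = (e k : ℂ) • shiftOp (k + 1) x := by
        rw [← hrel k x x.2]
        show ((T ^ n k) x : BoundedContinuousFunction Idx ℂ) - x = (S ^ n k) x - x
        rw [hTp]
      rw [Submodule.coe_norm, h1, norm_smul, Complex.norm_real, Real.norm_of_nonneg (he k).le]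
      exact mul_le_mul_of_nonneg_left (shiftOp_norm _ _) (he k).le
  · rintro ⟨X, _, _, _, _, T, hc, ht⟩
    refine ⟨_, fun z hz => hz.1, hc, ?_⟩
    rw [Metric.tendstoUniformlyOn_iff]
    intro ε hε
    filter_upwards [ht.eventually_lt_const hε] with k hk
    rintro z ⟨hz1, hz⟩
    obtain ⟨x, hx⟩ := hz.exists_hasEigenvector
    have hTx : T x = z • x := hx.apply_eq_smul
    have hp : ∀ m, (T ^ m) x = z ^ m • x := by
      intro m
      induction m with
      | zero => simp
      | succ m ih => rw [pow_succ, mul_apply_eq_comp, hTx, map_smul, ih, smul_smul, pow_succ']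
    have h1 := (T ^ n k - 1).le_opNorm x
    have h2 : (T ^ n k - 1) x = (z ^ n k - 1) • x := by
      rw [sub_smul, one_smul, ← hp]; rfl
    rw [h2, norm_smul] at h1
    have h3 := le_of_mul_le_mul_right h1 (norm_pos_iff.2 hx.2)
    rw [dist_comm, dist_eq_norm]
    exact h3.trans_lt hk
end

section
/- Let (n_k)_{k≥0} be a strictly increasing sequence of positive integers. If there exists an uncountable subset K of 𝕋 such that sup_{λ∈K} |λ^{n_k} − 1| → 0 as k → ∞, then there exists a bounded linear operator T on the Hilbert space ℓ²(ℕ, ℂ) such that T has perfectly spanning unimodular eigenvectors and ‖T^{n_k} − I‖ → 0 as k → ∞ (i.e. T is uniformly rigid with respect to (n_k)). -/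
open MeasureTheory Filter Topology

namespace Rigid

/-- Flip of one coordinate. -/
def flipAt (i : ℕ) (ω : ℕ → Bool) : ℕ → Bool := fun j => if j = i then !(ω j) else ω j

lemma exists_mu : ∃ μ : Measure (ℕ → Bool), IsProbabilityMeasure μ ∧ (∀ ω, μ {ω} = 0) ∧
    ∀ i, MeasurePreserving (flipAt i) μ μ := by
  let β : Measure Bool := ProbabilityTheory.uniformOn Set.univ
  have hβ : ∀ b : Bool, β {b} = 2⁻¹ := by
    intro b
    change ProbabilityTheory.uniformOn Set.univ {b} = _
    rw [ProbabilityTheory.uniformOn_univ]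
    simp
  have hβnot : β.map (fun b => !b) = β := by
    refine Measure.ext_of_singleton ?_
    intro b
    rw [Measure.map_apply (measurable_of_finite _) (measurableSet_singleton b)]
    have : (fun b : Bool => !b) ⁻¹' {b} = {!b} := by
      ext x; cases x <;> cases b <;> simp
    rw [this, hβ, hβ]
  refine ⟨Measure.infinitePi (fun _ => β), inferInstance, ?_, ?_⟩
  · intro ω
    have h : ∀ n : ℕ, Measure.infinitePi (fun _ : ℕ => β) {ω} ≤ (2⁻¹ : ENNReal) ^ n := by
      intro n
      calc Measure.infinitePi (fun _ : ℕ => β) {ω}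
          ≤ Measure.infinitePi (fun _ : ℕ => β)
            (((Finset.range n : Finset ℕ) : Set ℕ).pi (fun i => {ω i})) := by
              apply measure_mono
              intro x hx
              rw [Set.mem_singleton_iff] at hx
              subst hx
              intro i _
              simp
        _ = (2⁻¹ : ENNReal) ^ n := by
              rw [Measure.infinitePi_pi]
              · simp [hβ]
              · intro i _; exact measurableSet_singleton _
    have ht : Tendsto (fun n : ℕ => (2⁻¹ : ENNReal) ^ n) atTop (𝓝 0) :=
      ENNReal.tendsto_pow_atTop_nhds_zero_of_lt_one (by simp)
    exact le_antisymm (ge_of_tendsto' ht h) (zero_le)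
  · intro i
    have hm : ∀ j : ℕ, Measurable (fun b : Bool => if j = i then !b else b) :=
      fun j => measurable_of_finite _
    have key := Measure.infinitePi_map_pi (fun _ : ℕ => β) hm
    refine ⟨?_, ?_⟩
    · exact measurable_pi_lambda _ fun j => (hm j).comp (measurable_pi_apply j)
    · refine key.trans ?_
      congr 1
      funext j
      by_cases hj : j = i
      · simp [hj, hβnot]
      · simp [hj]

/-- A sign. -/
def sgn (b : Bool) : ℂ := if b then -1 else 1

lemma sgn_mul_self (b : Bool) : sgn b * sgn b = 1 := by cases b <;> simp [sgn]
lemma norm_sgn (b : Bool) : ‖sgn b‖ = 1 := by cases b <;> simp [sgn]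
lemma sgn_not (b : Bool) : sgn (!b) = - sgn b := by cases b <;> simp [sgn]
lemma conj_sgn (b : Bool) : (starRingEnd ℂ) (sgn b) = sgn b := by cases b <;> simp [sgn]

/-- Walsh function. -/
def walsh (A : Finset ℕ) (ω : ℕ → Bool) : ℂ := ∏ i ∈ A, sgn (ω i)

lemma walsh_mul_self (A : Finset ℕ) (ω : ℕ → Bool) : walsh A ω * walsh A ω = 1 := by
  simp [walsh, ← Finset.prod_mul_distrib, sgn_mul_self]

lemma norm_walsh (A : Finset ℕ) (ω : ℕ → Bool) : ‖walsh A ω‖ = 1 := by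
  simp [walsh, norm_sgn]

lemma conj_walsh (A : Finset ℕ) (ω : ℕ → Bool) : (starRingEnd ℂ) (walsh A ω) = walsh A ω := by
  simp [walsh, conj_sgn]

lemma measurable_walsh (A : Finset ℕ) : Measurable (walsh A) := by
  unfold walsh
  refine Finset.measurable_prod _ fun i _ => ?_
  exact (measurable_of_finite sgn).comp (measurable_pi_apply i)

lemma walsh_flip_mem {A : Finset ℕ} {i : ℕ} (h : i ∈ A) (ω : ℕ → Bool) :
    walsh A (flipAt i ω) = - walsh A ω := by
  unfold walsh
  rw [← Finset.mul_prod_erase _ _ h, ← Finset.mul_prod_erase _ _ h]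
  have : ∏ x ∈ A.erase i, sgn (flipAt i ω x) = ∏ x ∈ A.erase i, sgn (ω x) := by
    refine Finset.prod_congr rfl fun x hx => ?_
    simp [flipAt, Finset.ne_of_mem_erase hx]
  rw [this]
  simp [flipAt, sgn_not]

lemma walsh_flip_notMem {A : Finset ℕ} {i : ℕ} (h : i ∉ A) (ω : ℕ → Bool) :
    walsh A (flipAt i ω) = walsh A ω := by
  unfold walsh
  refine Finset.prod_congr rfl fun x hx => ?_
  have : x ≠ i := fun h' => h (h' ▸ hx)
  simp [flipAt, this]

lemma flipAt_flipAt (i : ℕ) (ω : ℕ → Bool) : flipAt i (flipAt i ω) = ω := by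
  funext j
  by_cases h : j = i <;> simp [flipAt, h]

lemma integral_walsh_ne {μ : Measure (ℕ → Bool)}
    (hμ : ∀ i, MeasurePreserving (flipAt i) μ μ) {A B : Finset ℕ} (h : A ≠ B) :
    ∫ ω, walsh A ω * walsh B ω ∂μ = 0 := by
  obtain ⟨i, hi⟩ : ∃ i, ¬ (i ∈ A ↔ i ∈ B) := by
    by_contra hc
    push Not at hc
    exact h (Finset.ext hc)
  have hflip : ∀ ω, walsh A (flipAt i ω) * walsh B (flipAt i ω) = - (walsh A ω * walsh B ω) := by
    intro ω
    by_cases hA : i ∈ A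
    · have hB : i ∉ B := fun hB => hi ⟨fun _ => hB, fun _ => hA⟩
      rw [walsh_flip_mem hA, walsh_flip_notMem hB]; ring
    · have hB : i ∈ B := by
        by_contra hB
        exact hi ⟨fun h => absurd h hA, fun h => absurd h hB⟩
      rw [walsh_flip_notMem hA, walsh_flip_mem hB]; ring
  have hmeas : Measurable (flipAt i) := (hμ i).measurable
  have h1 : ∫ ω, walsh A ω * walsh B ω ∂μ
      = ∫ ω, walsh A (flipAt i ω) * walsh B (flipAt i ω) ∂μ := by
    let e : (ℕ → Bool) ≃ᵐ (ℕ → Bool) :=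
      { toFun := flipAt i, invFun := flipAt i, left_inv := flipAt_flipAt i,
        right_inv := flipAt_flipAt i, measurable_toFun := hmeas, measurable_invFun := hmeas }
    exact ((hμ i).integral_comp e.measurableEmbedding
      (fun ω => walsh A ω * walsh B ω)).symm
  simp_rw [hflip] at h1
  rw [integral_neg] at h1
  have h2 : (2 : ℂ) * ∫ ω, walsh A ω * walsh B ω ∂μ = 0 := by
    linear_combination h1
  simpa using h2

/-- `ℓ²(ℕ)` -/
noncomputable abbrev L2 : Type := lp (fun _ : ℕ => ℂ) 2

lemma exists_wshift (π : ℕ → ℕ) (hπ : Function.Injective π) (r : ℕ → ℂ) (C : ℝ)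
    (hr : ∀ m, ‖r m‖ ≤ C) :
    ∃ S : L2 →L[ℂ] L2, ∀ x : L2, ∀ m, (S x : ℕ → ℂ) m = r m * (x : ℕ → ℂ) (π m) := by
  have hC : 0 ≤ C := (norm_nonneg _).trans (hr 0)
  have h2 : (0 : ℝ) < (2 : ENNReal).toReal := by simp
  have hbd : ∀ x : L2, ∀ s : Finset ℕ,
      ∑ m ∈ s, ‖r m * (x : ℕ → ℂ) (π m)‖ ^ (2 : ENNReal).toReal
        ≤ (C * ‖x‖) ^ (2 : ENNReal).toReal := by
    intro x s
    calc ∑ m ∈ s, ‖r m * (x : ℕ → ℂ) (π m)‖ ^ (2 : ENNReal).toReal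
        ≤ ∑ m ∈ s, C ^ (2 : ENNReal).toReal * ‖(x : ℕ → ℂ) (π m)‖ ^ (2 : ENNReal).toReal := by
          refine Finset.sum_le_sum fun m _ => ?_
          rw [norm_mul, Real.mul_rpow (norm_nonneg _) (norm_nonneg _)]
          gcongr
          exact hr m
      _ = C ^ (2 : ENNReal).toReal * ∑ m ∈ s.image π, ‖(x : ℕ → ℂ) m‖ ^ (2 : ENNReal).toReal := by
          rw [Finset.sum_image (fun a _ b _ h => hπ h), Finset.mul_sum]
      _ ≤ C ^ (2 : ENNReal).toReal * ‖x‖ ^ (2 : ENNReal).toReal := by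
          gcongr
          exact lp.sum_rpow_le_norm_rpow h2 x _
      _ = _ := by rw [Real.mul_rpow hC (norm_nonneg _)]
  let S₀ : L2 →ₗ[ℂ] L2 :=
    { toFun := fun x => ⟨fun m => r m * (x : ℕ → ℂ) (π m), memℓp_gen' (hbd x)⟩
      map_add' := by
        intro x y
        apply lp.ext
        funext m
        change r m * ((x + y : L2) : ℕ → ℂ) (π m) = r m * (x : ℕ → ℂ) (π m) + r m * (y : ℕ → ℂ) (π m)
        rw [lp.coeFn_add, Pi.add_apply]; ring
      map_smul' := by
        intro c x
        apply lp.ext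
        funext m
        change r m * ((c • x : L2) : ℕ → ℂ) (π m) = c * (r m * (x : ℕ → ℂ) (π m))
        rw [lp.coeFn_smul, Pi.smul_apply, smul_eq_mul]; ring }
  refine ⟨S₀.mkContinuous C fun x => ?_, fun x m => rfl⟩
  exact lp.norm_le_of_forall_sum_le h2 (by positivity) (hbd x)

/-- Eigenvectors. -/
lemma memlp_vec (ω : ℕ → Bool) :
    Memℓp (fun m : ℕ => walsh (Finset.equivBitIndices m) ω / ((m : ℂ) + 1)) 2 := by
  apply memℓp_gen
  have h : ∀ m : ℕ, ‖(m : ℂ) + 1‖ = (m : ℝ) + 1 := by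
    intro m
    rw [← Nat.cast_succ, Complex.norm_natCast]; simp
  simp only [norm_div, norm_walsh, h]
  have := (summable_nat_add_iff 1).2 (Real.summable_one_div_nat_pow.2 (one_lt_two))
  simpa using this

/-- Eigenvectors. -/
noncomputable def vec (ω : ℕ → Bool) : L2 := ⟨_, memlp_vec ω⟩

lemma vec_apply (ω : ℕ → Bool) (m : ℕ) :
    (vec ω : ℕ → ℂ) m = walsh (Finset.equivBitIndices m) ω / ((m : ℂ) + 1) := rfl

/-- Toggle. -/
def toggle (i : ℕ) (A : Finset ℕ) : Finset ℕ := if i ∈ A then A.erase i else insert i A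

lemma toggle_toggle (i : ℕ) (A : Finset ℕ) : toggle i (toggle i A) = A := by
  by_cases h : i ∈ A <;> simp [toggle, h]

lemma walsh_toggle (i : ℕ) (A : Finset ℕ) (ω : ℕ → Bool) :
    walsh (toggle i A) ω = sgn (ω i) * walsh A ω := by
  unfold walsh toggle
  split_ifs with h
  · rw [← Finset.mul_prod_erase A _ h, ← mul_assoc, sgn_mul_self, one_mul]
  · rw [Finset.prod_insert h]

lemma sum_toggle_le (i : ℕ) (A : Finset ℕ) :
    ∑ j ∈ toggle i A, 2 ^ j ≤ 2 ^ i + ∑ j ∈ A, 2 ^ j := by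
  unfold toggle
  split_ifs with h
  · have := Finset.sum_le_sum_of_subset (f := fun j => 2 ^ j) (Finset.erase_subset i A)
    exact this.trans (Nat.le_add_left _ _)
  · rw [Finset.sum_insert h]

lemma exists_S (i : ℕ) : ∃ S : L2 →L[ℂ] L2, ∀ ω, S (vec ω) = sgn (ω i) • vec ω := by
  let e := Finset.equivBitIndices
  let π : ℕ → ℕ := fun m => e.symm (toggle i (e m))
  have hπ : Function.Injective π := by
    intro a b hab
    have h1 : toggle i (e a) = toggle i (e b) := e.symm.injective hab
    have h2 := congrArg (toggle i) h1
    rw [toggle_toggle, toggle_toggle] at h2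
    exact e.injective h2
  have hn : ∀ m : ℕ, ‖(m : ℂ) + 1‖ = (m : ℝ) + 1 := by
    intro m
    rw [← Nat.cast_succ, Complex.norm_natCast]; simp
  obtain ⟨S, hS⟩ := exists_wshift π hπ (fun m => ((π m : ℂ) + 1) / ((m : ℂ) + 1)) (2 ^ i + 1) (by
    intro m
    rw [norm_div, hn, hn, div_le_iff₀ (by positivity)]
    have h1 : π m ≤ 2 ^ i + m := by
      have := sum_toggle_le i (e m)
      have h3 : ∑ j ∈ e m, 2 ^ j = m := e.symm_apply_apply m
      rw [h3] at this
      exact this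
    have h2 : (π m : ℝ) ≤ 2 ^ i + m := by exact_mod_cast h1
    have h4 : (0 : ℝ) ≤ 2 ^ i * m := by positivity
    nlinarith)
  refine ⟨S, fun ω => ?_⟩
  apply lp.ext
  funext m
  rw [hS, lp.coeFn_smul, Pi.smul_apply, smul_eq_mul, vec_apply, vec_apply]
  have h1 : Finset.equivBitIndices (π m) = toggle i (e m) := e.apply_symm_apply _
  rw [h1, walsh_toggle]
  have h2 : ((π m : ℂ) + 1) ≠ 0 := Nat.cast_add_one_ne_zero _
  have h3 : ((m : ℂ) + 1) ≠ 0 := Nat.cast_add_one_ne_zero _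
  field_simp
  rfl

lemma total {μ : Measure (ℕ → Bool)} [IsProbabilityMeasure μ]
    (hμ : ∀ i, MeasurePreserving (flipAt i) μ μ) (x : L2)
    (hx : ∀ᵐ ω ∂μ, inner ℂ (vec ω) x = 0) : x = 0 := by
  apply lp.ext
  funext b
  let e := Finset.equivBitIndices
  let c : ℕ → ℂ := fun m => (x : ℕ → ℂ) m / ((m : ℂ) + 1)
  have hin : ∀ ω m, inner ℂ ((vec ω : ℕ → ℂ) m) ((x : ℕ → ℂ) m) = walsh (e m) ω * c m := by
    intro ω m
    rw [vec_apply, RCLike.inner_apply, map_div₀, conj_walsh]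
    simp only [map_add, map_one, Complex.conj_natCast, c, e]
    ring
  have hsum : ∀ ω, HasSum (fun m => walsh (e m) ω * c m) (inner ℂ (vec ω) x) := by
    intro ω
    have := lp.hasSum_inner (𝕜 := ℂ) (vec ω) x
    simpa only [hin] using this
  have hc : Summable fun m => ‖c m‖ := by
    have := (hsum fun _ => false).summable.norm
    simpa only [norm_mul, norm_walsh, one_mul] using this
  let F : ℕ → (ℕ → Bool) → ℂ := fun m ω => c m * (walsh (e m) ω * walsh (e b) ω)
  have hFn : ∀ m ω, ‖F m ω‖ = ‖c m‖ := by
    intro m ω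
    simp [F, norm_walsh]
  have hFm : ∀ m, Measurable (F m) := fun m =>
    measurable_const.mul ((measurable_walsh _).mul (measurable_walsh _))
  have hFi : ∀ m, Integrable (F m) μ := fun m =>
    Integrable.of_bound (hFm m).aestronglyMeasurable ‖c m‖ (ae_of_all _ fun ω => (hFn m ω).le)
  have hI := hasSum_integral_of_summable_integral_norm hFi (by
    simp only [hFn]
    simpa using hc)
  have h0 : ∫ ω, ∑' m, F m ω ∂μ = 0 := by
    refine integral_eq_zero_of_ae ?_
    filter_upwards [hx] with ω hω
    have h1 := (hsum ω).mul_right (walsh (e b) ω)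
    rw [hω, zero_mul] at h1
    have h2 : (fun m => walsh (e m) ω * c m * walsh (e b) ω) = fun m => F m ω := by
      funext m; simp only [F]; ring
    rw [h2] at h1
    exact h1.tsum_eq
  have h3 : ∀ m, ∫ ω, F m ω ∂μ = if m = b then c b else 0 := by
    intro m
    simp only [F]
    rw [integral_const_mul]
    split_ifs with h
    · subst h
      simp [walsh_mul_self]
    · rw [integral_walsh_ne hμ (fun h' => h (e.injective h')), mul_zero]
  simp only [h3] at hI
  rw [h0] at hI
  have h4 : c b = 0 := (hasSum_ite_eq b (c b)).unique hI
  have h5 : ((b : ℂ) + 1) ≠ 0 := Nat.cast_add_one_ne_zero _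
  simpa [c, h5] using h4

lemma exists_P (j : ℕ) (s : ℕ → Bool) : ∃ P : L2 →L[ℂ] L2,
    ∀ ω, P (vec ω) = if (∀ i < j, ω i = s i) then vec ω else 0 := by
  induction j with
  | zero => exact ⟨1, fun ω => by simp⟩
  | succ j ih =>
    obtain ⟨P, hP⟩ := ih
    obtain ⟨S, hS⟩ := exists_S j
    refine ⟨P ∘L ((1 / 2 : ℂ) • (1 + sgn (s j) • S)), fun ω => ?_⟩
    have h1 : (P ∘L ((1 / 2 : ℂ) • (1 + sgn (s j) • S))) (vec ω)
        = ((1 / 2 : ℂ) * (1 + sgn (s j) * sgn (ω j))) • P (vec ω) := by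
      simp [hS, add_smul, mul_smul]
    rw [h1, hP]
    have h2 : (∀ i < j + 1, ω i = s i) ↔ (∀ i < j, ω i = s i) ∧ ω j = s j := by
      constructor
      · intro h
        exact ⟨fun i hi => h i (by omega), h j (by omega)⟩
      · rintro ⟨h, h'⟩ i hi
        rcases Nat.lt_succ_iff_lt_or_eq.1 hi with hi | rfl
        · exact h i hi
        · exact h'
    by_cases hj : ω j = s j
    · have h3 : (1 / 2 : ℂ) * (1 + sgn (s j) * sgn (ω j)) = 1 := by
        rw [hj, sgn_mul_self]; norm_num
      rw [h3, one_smul]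
      simp only [h2, hj, and_true]
    · have h3 : (1 / 2 : ℂ) * (1 + sgn (s j) * sgn (ω j)) = 0 := by
        revert hj
        cases ω j <;> cases s j <;> simp [sgn]
      rw [h3, zero_smul]
      simp only [h2, hj, and_false, if_false]

/-- Truncation. -/
def trunc (j : ℕ) (ω : ℕ → Bool) : ℕ → Bool := fun i => if i < j then ω i else false

lemma trunc_trunc {i j : ℕ} (h : i ≤ j) (ω : ℕ → Bool) : trunc i (trunc j ω) = trunc i ω := by
  funext k
  unfold trunc
  by_cases hk : k < i
  · simp [hk, hk.trans_le h]
  · simp [hk]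

lemma exists_Op (j : ℕ) : ∃ W : ℝ, 1 ≤ W ∧ ∀ (u : (ℕ → Bool) → ℂ) (c : ℝ), (∀ ω, ‖u ω‖ ≤ c) →
    ∃ Q : L2 →L[ℂ] L2, (∀ ω, Q (vec ω) = u (trunc j ω) • vec ω) ∧ ‖Q‖ ≤ W * c := by
  choose P hP using exists_P j
  let χ : Finset ℕ → ℕ → Bool := fun A i => decide (i ∈ A)
  refine ⟨1 + ∑ A ∈ (Finset.range j).powerset, ‖P (χ A)‖, ?_, ?_⟩
  · have : 0 ≤ ∑ A ∈ (Finset.range j).powerset, ‖P (χ A)‖ :=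
      Finset.sum_nonneg fun _ _ => norm_nonneg _
    linarith
  intro u c hu
  have hc : 0 ≤ c := (norm_nonneg _).trans (hu fun _ => false)
  refine ⟨∑ A ∈ (Finset.range j).powerset, u (χ A) • P (χ A), ?_, ?_⟩
  · intro ω
    rw [ContinuousLinearMap.sum_apply]
    let A₀ := (Finset.range j).filter (fun i => ω i = true)
    have hA₀ : χ A₀ = trunc j ω := by
      funext i
      by_cases h : i < j <;> simp [χ, A₀, trunc, h]
    rw [Finset.sum_eq_single A₀]
    · rw [hA₀, ContinuousLinearMap.smul_apply, hP, if_pos]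
      intro i hi
      simp [trunc, hi]
    · intro A hA hne
      rw [ContinuousLinearMap.smul_apply, hP, if_neg, smul_zero]
      intro h
      apply hne
      ext i
      rw [Finset.mem_powerset] at hA
      simp only [A₀, Finset.mem_filter, Finset.mem_range]
      constructor
      · intro hi
        have hij := Finset.mem_range.1 (hA hi)
        exact ⟨hij, by simp [h i hij, χ, hi]⟩
      · rintro ⟨hij, hi⟩
        have := h i hij
        rw [hi] at this
        simpa [χ] using this.symm
    · intro h
      exact absurd (Finset.mem_powerset.2 (Finset.filter_subset _ _)) h
  · calc ‖∑ A ∈ (Finset.range j).powerset, u (χ A) • P (χ A)‖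
        ≤ ∑ A ∈ (Finset.range j).powerset, ‖u (χ A) • P (χ A)‖ := norm_sum_le _ _
      _ ≤ ∑ A ∈ (Finset.range j).powerset, ‖P (χ A)‖ * c := by
          refine Finset.sum_le_sum fun A _ => ?_
          rw [norm_smul, mul_comm]
          gcongr
          exact hu _
      _ = (∑ A ∈ (Finset.range j).powerset, ‖P (χ A)‖) * c := by rw [Finset.sum_mul]
      _ ≤ _ := by
          gcongr
          linarith

lemma exists_L (W : ℕ → ℝ) (hW1 : ∀ j, 1 ≤ W j)
    (hW : ∀ j, ∀ (u : (ℕ → Bool) → ℂ) (c : ℝ), (∀ ω, ‖u ω‖ ≤ c) →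
      ∃ Q : L2 →L[ℂ] L2, (∀ ω, Q (vec ω) = u (trunc j ω) • vec ω) ∧ ‖Q‖ ≤ W j * c)
    (G : (ℕ → Bool) → ℂ) (ε : ℝ) (hε : ∀ ω, ‖G ω‖ ≤ ε)
    (hG : ∀ j ω ω', (∀ i < j, ω i = ω' i) → ‖G ω - G ω'‖ ≤ (1 / 2) ^ j / W (j + 1)) :
    ∃ L : L2 →L[ℂ] L2, (∀ ω, L (vec ω) = G ω • vec ω) ∧
      ‖L‖ ≤ W 0 * ε + ∑' j, min (W (j + 1) * (2 * ε)) ((1 / 2) ^ j) := by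
  have hε0 : 0 ≤ ε := (norm_nonneg _).trans (hε fun _ => false)
  have hWpos : ∀ j, 0 < W j := fun j => lt_of_lt_of_le one_pos (hW1 j)
  obtain ⟨Q₀, hQ₀, hQ₀n⟩ := hW 0 G ε hε
  have hstep : ∀ j, ∃ Q : L2 →L[ℂ] L2,
      (∀ ω, Q (vec ω) = (G (trunc (j + 1) ω) - G (trunc j ω)) • vec ω) ∧
      ‖Q‖ ≤ min (W (j + 1) * (2 * ε)) ((1 / 2) ^ j) := by
    intro j
    obtain ⟨Q, hQ, hQn⟩ := hW (j + 1) (fun ω => G (trunc (j + 1) ω) - G (trunc j ω))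
      (min (2 * ε) ((1 / 2) ^ j / W (j + 1))) (by
        intro ω
        refine le_min ?_ ?_
        · calc _ ≤ ‖G (trunc (j + 1) ω)‖ + ‖G (trunc j ω)‖ := norm_sub_le _ _
            _ ≤ ε + ε := add_le_add (hε _) (hε _)
            _ = _ := by ring
        · apply hG
          intro i hi
          simp [trunc, hi, Nat.lt_succ_of_lt hi])
    refine ⟨Q, ?_, ?_⟩
    · intro ω
      rw [hQ ω, trunc_trunc le_rfl, trunc_trunc (Nat.le_succ j)]
    · refine le_min ?_ ?_
      · refine hQn.trans ?_
        have := (hWpos (j + 1)).le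
        gcongr
        exact min_le_left _ _
      · refine hQn.trans ?_
        calc W (j + 1) * _ ≤ W (j + 1) * ((1 / 2) ^ j / W (j + 1)) := by
              have := (hWpos (j + 1)).le
              gcongr
              exact min_le_right _ _
          _ = _ := by
              field_simp [(hWpos (j + 1)).ne']
  choose Q hQ hQn using hstep
  have hgeo : Summable fun j : ℕ => ((1 : ℝ) / 2) ^ j := summable_geometric_two
  have hmin : Summable fun j => min (W (j + 1) * (2 * ε)) (((1 : ℝ) / 2) ^ j) := by
    refine Summable.of_nonneg_of_le (fun j => le_min ?_ ?_) (fun j => min_le_right _ _) hgeo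
    · have := (hWpos (j + 1)).le
      positivity
    · positivity
  have hQs : Summable Q := Summable.of_norm_bounded hmin hQn
  refine ⟨Q₀ + ∑' j, Q j, ?_, ?_⟩
  · intro ω
    have h1 : HasSum (fun j => Q j (vec ω)) ((∑' j, Q j) (vec ω)) :=
      hQs.hasSum.mapL (ContinuousLinearMap.apply ℂ L2 (vec ω))
    have h2 := h1.tendsto_sum_nat
    have h3 : ∀ N, ∑ j ∈ Finset.range N, Q j (vec ω)
        = (G (trunc N ω) - G (trunc 0 ω)) • vec ω := by
      intro N
      simp only [hQ]
      rw [← Finset.sum_smul, Finset.sum_range_sub (fun j => G (trunc j ω))]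
    simp only [h3] at h2
    have h4 : Tendsto (fun N => G (trunc N ω)) atTop (𝓝 (G ω)) := by
      rw [tendsto_iff_norm_sub_tendsto_zero]
      refine squeeze_zero (fun _ => norm_nonneg _) (g := fun N : ℕ => ((1 : ℝ) / 2) ^ N) ?_ ?_
      · intro N
        refine (hG N _ _ ?_).trans ?_
        · intro i hi
          simp [trunc, hi]
        · exact div_le_self (by positivity) (hW1 _)
      · exact tendsto_pow_atTop_nhds_zero_of_lt_one (by norm_num) (by norm_num)
    have h5 := (h4.sub_const (G (trunc 0 ω))).smul_const (vec ω)
    have h6 := tendsto_nhds_unique h2 h5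
    rw [ContinuousLinearMap.add_apply, h6, hQ₀, ← add_smul]
    congr 1
    ring
  · refine (norm_add_le _ _).trans (add_le_add hQ₀n ?_)
    exact tsum_of_norm_bounded hmin.hasSum hQn

lemma cylinder_cont (G : (ℕ → Bool) → ℂ) (hG : Continuous G) (η : ℝ) (hη : 0 < η) :
    ∀ᶠ N : ℕ in atTop, ∀ ω ω' : ℕ → Bool, (∀ i < N, ω i = ω' i) → ‖G ω - G ω'‖ ≤ η := by
  letI : MetricSpace (ℕ → Bool) := PiNat.metricSpaceOfDiscreteUniformity fun _ => rfl
  have hu := CompactSpace.uniformContinuous_of_continuous hG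
  rw [Metric.uniformContinuous_iff] at hu
  obtain ⟨δ, hδ, h⟩ := hu η hη
  obtain ⟨N₀, hN₀⟩ := exists_pow_lt_of_lt_one hδ (by norm_num : (1 / 2 : ℝ) < 1)
  filter_upwards [eventually_ge_atTop N₀] with N hN ω ω' hag
  rw [← dist_eq_norm]
  refine (h ?_).le
  have h1 : ω ∈ PiNat.cylinder ω' N₀ :=
    PiNat.mem_cylinder_iff.2 fun i hi => hag i (hi.trans_le hN)
  exact (PiNat.mem_cylinder_iff_dist_le.1 h1).trans_lt hN₀

lemma exists_phi (n : ℕ → ℕ) (K : Set ℂ) (hKc : IsClosed K) (hKunc : ¬ K.Countable)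
    (hunif : ∀ ε > 0, ∀ᶠ k in atTop, ∀ z ∈ K, ‖z ^ n k - 1‖ ≤ ε) (η : ℕ → ℝ)
    (hη : ∀ j, 0 < η j) :
    ∃ φ : (ℕ → Bool) → ℂ, Continuous φ ∧ Function.Injective φ ∧ (∀ ω, φ ω ∈ K) ∧
      ∀ j ω ω', (∀ i < j, ω i = ω' i) → ‖φ ω - φ ω'‖ ≤ η j ∧
        ∀ k, ‖φ ω ^ n k - φ ω' ^ n k‖ ≤ η j := by
  obtain ⟨f, hfK, hfc, hfi⟩ := hKc.exists_nat_bool_injection_of_not_countable hKunc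
  have hfK' : ∀ ω, f ω ∈ K := fun ω => hfK ⟨ω, rfl⟩
  have hN : ∀ j, ∃ N : ℕ, ∀ ω ω' : ℕ → Bool, (∀ i < N, ω i = ω' i) → ‖f ω - f ω'‖ ≤ η j ∧
        ∀ k, ‖f ω ^ n k - f ω' ^ n k‖ ≤ η j := by
    intro j
    obtain ⟨k₀, hk₀⟩ := eventually_atTop.1 (hunif (η j / 2) (half_pos (hη j)))
    have h1 := cylinder_cont f hfc (η j) (hη j)
    have h2 : ∀ᶠ N : ℕ in atTop, ∀ k ∈ Set.Iio k₀, ∀ ω ω' : ℕ → Bool, (∀ i < N, ω i = ω' i) →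
        ‖f ω ^ n k - f ω' ^ n k‖ ≤ η j :=
      (Filter.eventually_all_finite (Set.finite_Iio k₀)).2 fun k _ =>
        cylinder_cont (fun ω => f ω ^ n k) (hfc.pow _) (η j) (hη j)
    obtain ⟨N, hN1, hN2⟩ := (h1.and h2).exists
    refine ⟨N, fun ω ω' hag => ⟨hN1 ω ω' hag, fun k => ?_⟩⟩
    rcases lt_or_ge k k₀ with hk | hk
    · exact hN2 k hk ω ω' hag
    · calc ‖f ω ^ n k - f ω' ^ n k‖ = ‖(f ω ^ n k - 1) - (f ω' ^ n k - 1)‖ := by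
            congr 1; ring
        _ ≤ ‖f ω ^ n k - 1‖ + ‖f ω' ^ n k - 1‖ := norm_sub_le _ _
        _ ≤ η j / 2 + η j / 2 := add_le_add (hk₀ k hk _ (hfK' _)) (hk₀ k hk _ (hfK' _))
        _ = η j := by ring
  choose N hN using hN
  let m : ℕ → ℕ := fun j => ∑ i ∈ Finset.range (j + 1), (N i + 1)
  have hm : StrictMono m := by
    apply strictMono_nat_of_lt_succ
    intro j
    change _ < ∑ i ∈ Finset.range (j + 1 + 1), (N i + 1)
    rw [Finset.sum_range_succ _ (j + 1)]
    change m j < m j + _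
    omega
  have hmN : ∀ j, N j ≤ m j := by
    intro j
    change _ ≤ ∑ i ∈ Finset.range (j + 1), (N i + 1)
    rw [Finset.sum_range_succ]
    omega
  let ι : (ℕ → Bool) → ℕ → Bool := fun ω => Function.extend m ω (fun _ => false)
  have hιm : ∀ ω j, ι ω (m j) = ω j := fun ω j => hm.injective.extend_apply _ _ _
  have hι' : ∀ ω i, (¬ ∃ j, m j = i) → ι ω i = false :=
    fun ω i hi => Function.extend_apply' _ _ _ hi
  have hιc : Continuous ι := by
    refine continuous_pi fun i => ?_
    by_cases hi : ∃ j, m j = i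
    · obtain ⟨j, rfl⟩ := hi
      simp only [hιm]
      exact continuous_apply j
    · simp only [fun ω => hι' ω i hi]
      exact continuous_const
  refine ⟨f ∘ ι, hfc.comp hιc, hfi.comp ?_, fun ω => hfK' _, ?_⟩
  · intro ω ω' h
    funext j
    rw [← hιm ω j, ← hιm ω' j, h]
  · intro j ω ω' hag
    apply hN j
    intro i hi
    by_cases hi' : ∃ l, m l = i
    · obtain ⟨l, rfl⟩ := hi'
      rw [hιm, hιm]
      exact hag l (hm.lt_iff_lt.1 (hi.trans_le (hmN j)))
    · rw [hι' _ _ hi', hι' _ _ hi']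

lemma tendsto_bound (W : ℕ → ℝ) (hW1 : ∀ j, 1 ≤ W j) (tol : ℝ) (htol : 0 < tol) :
    ∃ ε > 0, W 0 * ε + ∑' j, min (W (j + 1) * (2 * ε)) (((1 : ℝ) / 2) ^ j) < tol := by
  have h1 : Tendsto (fun ε : ℝ => ∑' j, min (W (j + 1) * (2 * ε)) (((1 : ℝ) / 2) ^ j))
      (𝓝[>] 0) (𝓝 (∑' _ : ℕ, (0 : ℝ))) := by
    refine tendsto_tsum_of_dominated_convergence (bound := fun j : ℕ => ((1 : ℝ) / 2) ^ j)
      summable_geometric_two ?_ ?_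
    · intro j
      have : Tendsto (fun ε : ℝ => min (W (j + 1) * (2 * ε)) (((1 : ℝ) / 2) ^ j)) (𝓝 0)
          (𝓝 (min (W (j + 1) * (2 * 0)) (((1 : ℝ) / 2) ^ j))) :=
        Continuous.tendsto (by fun_prop) 0
      have h0 : min (W (j + 1) * (2 * 0)) (((1 : ℝ) / 2) ^ j) = 0 := by
        rw [mul_zero, mul_zero]
        exact min_eq_left (by positivity)
      rw [h0] at this
      exact this.mono_left nhdsWithin_le_nhds
    · filter_upwards [self_mem_nhdsWithin] with ε hε j
      have hε' : 0 < ε := hε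
      have := hW1 (j + 1)
      rw [Real.norm_of_nonneg (le_min (by positivity) (by positivity))]
      exact min_le_right _ _
  have h2 : Tendsto (fun ε : ℝ => W 0 * ε) (𝓝[>] 0) (𝓝 (W 0 * 0)) :=
    (Continuous.tendsto (by fun_prop) 0).mono_left nhdsWithin_le_nhds
  have h3 := h2.add h1
  simp only [mul_zero, tsum_zero, add_zero] at h3
  have h4 := (h3.eventually (gt_mem_nhds htol)).and self_mem_nhdsWithin
  obtain ⟨ε, h5, h6⟩ := h4.exists
  exact ⟨ε, h6, h5⟩

lemma main (n : ℕ → ℕ) 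
    (K : Set ℂ) (hK : K ⊆ {z : ℂ | ‖z‖ = 1}) (hKunc : ¬ K.Countable)
    (hunif : TendstoUniformlyOn (fun k (z : ℂ) => z ^ (n k)) (fun _ => 1) atTop K) :
    ∃ T : L2 →L[ℂ] L2,
      PerfectlySpanning T ∧ Tendsto (fun k => ‖T ^ (n k) - 1‖) atTop (𝓝 0) := by
  have hcl1 : closure K ⊆ {z : ℂ | ‖z‖ = 1} :=
    closure_minimal hK (isClosed_eq continuous_norm continuous_const)
  have hclu : ∀ ε > 0, ∀ᶠ k in atTop, ∀ z ∈ closure K, ‖z ^ n k - 1‖ ≤ ε := by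
    intro ε hε
    filter_upwards [(Metric.tendstoUniformlyOn_iff.1 hunif) ε hε] with k hk
    have : closure K ⊆ {z : ℂ | ‖z ^ n k - 1‖ ≤ ε} := by
      refine closure_minimal ?_ (isClosed_le (by fun_prop) continuous_const)
      intro z hz
      have := hk z hz
      rw [dist_comm, dist_eq_norm] at this
      exact this.le
    exact this
  choose W hW1 hW using exists_Op
  have hWpos : ∀ j, 0 < W j := fun j => lt_of_lt_of_le one_pos (hW1 j)
  obtain ⟨φ, hφc, hφi, hφK, hφ⟩ := exists_phi n (closure K) isClosed_closure
    (fun h => hKunc (h.mono subset_closure)) hclu (fun j => (1 / 2) ^ j / W (j + 1))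
    (fun j => by have := hWpos (j + 1); positivity)
  obtain ⟨T, hT, -⟩ := exists_L W hW1 hW φ 1 (fun ω => (hcl1 (hφK ω)).le)
    (fun j ω ω' h => (hφ j ω ω' h).1)
  obtain ⟨μ, hμp, hμa, hμf⟩ := exists_mu
  refine ⟨T, ⟨μ.map φ, Measure.isProbabilityMeasure_map hφc.measurable.aemeasurable,
    ?_, ?_, ?_⟩, ?_⟩
  · rw [Measure.map_apply hφc.measurable
      (isClosed_eq continuous_norm continuous_const).measurableSet.compl]
    have : φ ⁻¹' {z : ℂ | ‖z‖ = 1}ᶜ = ∅ := by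
      ext ω
      simpa using hcl1 (hφK ω)
    rw [this, measure_empty]
  · intro z
    rw [Measure.map_apply hφc.measurable (measurableSet_singleton z)]
    by_cases h : ∃ ω, φ ω = z
    · obtain ⟨ω, rfl⟩ := h
      have : φ ⁻¹' {φ ω} = {ω} := by
        ext ω'
        simp [hφi.eq_iff]
      rw [this, hμa]
    · have : φ ⁻¹' {z} = ∅ := by
        ext ω'
        simp only [Set.mem_preimage, Set.mem_singleton_iff, Set.mem_empty_iff_false, iff_false]
        exact fun h' => h ⟨ω', h'⟩
      rw [this, measure_empty]
  · intro B hB _ hB1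
    rw [Measure.map_apply hφc.measurable hB] at hB1
    have hae : ∀ᵐ ω ∂μ, φ ω ∈ B := by
      have := (prob_compl_eq_zero_iff (μ := μ) (hφc.measurable hB)).2 hB1
      exact this
    rw [Submodule.topologicalClosure_eq_top_iff, Submodule.eq_bot_iff]
    intro x hx
    apply total hμf x
    filter_upwards [hae] with ω hω
    rw [Submodule.mem_orthogonal] at hx
    apply hx
    refine Submodule.mem_iSup_of_mem (φ ω) (Submodule.mem_iSup_of_mem hω ?_)
    rw [Module.End.mem_eigenspace_iff]
    exact hT ω
  · have hdense : Dense ((Submodule.span ℂ (Set.range vec) : Submodule ℂ L2) : Set L2) := by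
      rw [Submodule.dense_iff_topologicalClosure_eq_top,
        Submodule.topologicalClosure_eq_top_iff, Submodule.eq_bot_iff]
      intro x hx
      apply total hμf x
      refine ae_of_all _ fun ω => ?_
      rw [Submodule.mem_orthogonal] at hx
      exact hx _ (Submodule.subset_span ⟨ω, rfl⟩)
    have hpow : ∀ (N : ℕ) ω, (T ^ N) (vec ω) = φ ω ^ N • vec ω := by
      intro N ω
      induction N with
      | zero => simp
      | succ N ih =>
        rw [pow_succ', ContinuousLinearMap.mul_apply, ih, map_smul, hT, smul_smul, pow_succ]
    rw [Metric.tendsto_atTop']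
    intro tol htol
    obtain ⟨ε, hε, hεt⟩ := tendsto_bound W hW1 tol htol
    obtain ⟨k₀, hk₀⟩ := eventually_atTop.1 (hclu ε hε)
    refine ⟨k₀, fun k hk => ?_⟩
    obtain ⟨L, hL, hLn⟩ := exists_L W hW1 hW (fun ω => φ ω ^ n k - 1) ε
      (fun ω => hk₀ k hk.le _ (hφK ω)) (by
        intro j ω ω' h
        rw [sub_sub_sub_cancel_right]
        exact (hφ j ω ω' h).2 k)
    have hLT : T ^ n k - 1 = L := by
      refine ContinuousLinearMap.ext_on hdense ?_
      rintro _ ⟨ω, rfl⟩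
      rw [ContinuousLinearMap.sub_apply, hpow, hL, sub_smul, one_smul]
      rfl
    rw [hLT, Real.dist_eq, sub_zero, abs_of_nonneg (norm_nonneg _)]
    exact hLn.trans_lt hεt

end Rigid

/-- If there is an uncountable subset `K` of the unit circle on which `λ^{n_k} → 1`
uniformly, then there is a bounded operator on `ℓ²(ℕ)` with perfectly spanning unimodular
eigenvectors which is uniformly rigid with respect to `(n_k)`, i.e. `‖T^{n_k} - I‖ → 0`. -/
theorem exists_perfectlySpanning_uniformly_rigid
    (n : ℕ → ℕ) (hmono : StrictMono n) (hpos : ∀ k, 0 < n k)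
    (K : Set ℂ) (hK : K ⊆ {z : ℂ | ‖z‖ = 1}) (hKunc : ¬ K.Countable)
    (hunif : TendstoUniformlyOn (fun k (z : ℂ) => z ^ (n k)) (fun _ => 1) atTop K) :
    ∃ T : (lp (fun _ : ℕ => ℂ) 2) →L[ℂ] (lp (fun _ : ℕ => ℂ) 2),
      PerfectlySpanning T ∧ Tendsto (fun k => ‖T ^ (n k) - 1‖) atTop (𝓝 0) := by
  exact Rigid.main n K hK hKunc hunif
end
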